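/- Let λ, μ, ν be partitions. If the Littlewood–Richardson coefficient c^ν_{λ,μ} equals 1, then for every positive integer N the Littlewood–Richardson coefficient c^{Nν}_{Nλ,Nμ} also equals 1, where Nλ denotes the partition obtained from λ by multiplying every part by N. -/

import Mathlib

/-!  Fulton's conjecture (theorem of Knutson–Tao–Woodward):
if the Littlewood–Richardson coefficient `c^ν_{λ,μ}` equals `1`, then
`c^{Nν}_{Nλ,Nμ} = 1` for every positive integer `N`. -/

open scoped Classical

/-- The cell `(i, j)` (row `i`, column `j`, both `0`-indexed) lies in the skew
Young diagram `ν/λ`. -/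
def InSkew (lam nu : ℕ → ℕ) (x : ℕ × ℕ) : Prop :=
  lam x.1 ≤ x.2 ∧ x.2 < nu x.1

/-- Reading order for the reading word of a skew tableau: rows are read top to
bottom, each row right to left.  `ReadBefore r c x` says that the cell `x`
belongs to the initial segment of the reading word ending with (and including)
the cell in row `r` and column `c`. -/
def ReadBefore (r c : ℕ) (x : ℕ × ℕ) : Prop :=
  x.1 < r ∨ (x.1 = r ∧ c ≤ x.2)

/-- `T` is a Littlewood–Richardson skew tableau of shape `ν/λ` and content `μ`:
a filling of the skew diagram `ν/λ` by positive integers (with `T x = 0`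
outside the diagram) which is weakly increasing along rows, strictly increasing
down columns, contains exactly `μ_m` entries equal to `m` (here `μ_m = mu (m-1)`
since `mu` is `0`-indexed), and whose reading word (rows right-to-left, top to
bottom) has the lattice property: every initial segment contains at least as
many entries equal to `m` as entries equal to `m+1`. -/
def IsLRSkewTableau (lam mu nu : ℕ → ℕ) (T : ℕ × ℕ → ℕ) : Prop :=
  (∀ x : ℕ × ℕ, 0 < T x ↔ InSkew lam nu x) ∧
  (∀ i j j', lam i ≤ j → j ≤ j' → j' < nu i → T (i, j) ≤ T (i, j')) ∧
  (∀ i i' j, i < i' → InSkew lam nu (i, j) → InSkew lam nu (i', j) →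
    T (i, j) < T (i', j)) ∧
  (∀ m, 0 < m →
    Nat.card {x : ℕ × ℕ // InSkew lam nu x ∧ T x = m} = mu (m - 1)) ∧
  (∀ m, 0 < m → ∀ r c : ℕ,
    Nat.card {x : ℕ × ℕ // ReadBefore r c x ∧ InSkew lam nu x ∧ T x = m + 1} ≤
      Nat.card {x : ℕ × ℕ // ReadBefore r c x ∧ InSkew lam nu x ∧ T x = m})

/-- The Littlewood–Richardson coefficient `c^ν_{λ,μ}`, defined combinatorially
as the number of Littlewood–Richardson skew tableaux of shape `ν/λ` and
content `μ`; it is `0` when the diagram of `λ` is not contained in that of `ν`. -/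
noncomputable def lrCoeff (lam mu nu : ℕ → ℕ) : ℕ :=
  if ∀ i, lam i ≤ nu i then
    Nat.card {T : ℕ × ℕ → ℕ // IsLRSkewTableau lam mu nu T}
  else 0

/-- The six unit vectors of the triangular lattice, in counterclockwise order. -/
def hexDir : ZMod 6 → ℤ × ℤ :=
  ![(1, 0), (0, 1), (-1, 1), (-1, 0), (0, -1), (1, -1)]

theorem zmod_six_add :
    ((1 : ZMod 6) + 1 = 2 ∧ (1 : ZMod 6) + 2 = 3 ∧ (1 : ZMod 6) + 3 = 4 ∧ (1 : ZMod 6) + 4 = 5 ∧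
      (1 : ZMod 6) + 5 = 0) ∧
    ((2 : ZMod 6) + 1 = 3 ∧ (2 : ZMod 6) + 2 = 4 ∧ (2 : ZMod 6) + 3 = 5 ∧ (2 : ZMod 6) + 4 = 0 ∧
      (2 : ZMod 6) + 5 = 1) ∧
    ((3 : ZMod 6) + 1 = 4 ∧ (3 : ZMod 6) + 2 = 5 ∧ (3 : ZMod 6) + 3 = 0 ∧ (3 : ZMod 6) + 4 = 1 ∧
      (3 : ZMod 6) + 5 = 2) ∧
    ((4 : ZMod 6) + 1 = 5 ∧ (4 : ZMod 6) + 2 = 0 ∧ (4 : ZMod 6) + 3 = 1 ∧ (4 : ZMod 6) + 4 = 2 ∧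
      (4 : ZMod 6) + 5 = 3) ∧
    ((5 : ZMod 6) + 1 = 0 ∧ (5 : ZMod 6) + 2 = 1 ∧ (5 : ZMod 6) + 3 = 2 ∧ (5 : ZMod 6) + 4 = 3 ∧
      (5 : ZMod 6) + 5 = 4) := by
  decide

theorem hexDir_add_two (k : ZMod 6) : hexDir (k + 2) = hexDir (k + 1) - hexDir k := by
  revert k; decide

theorem hexDir_add_three (k : ZMod 6) : hexDir (k + 3) = - hexDir k := by
  revert k; decide

theorem hexDir_add_four (k : ZMod 6) : hexDir (k + 4) = - hexDir (k + 1) := by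
  revert k; decide

theorem hexDir_add_five (k : ZMod 6) : hexDir (k + 5) = hexDir k - hexDir (k + 1) := by
  revert k; decide

theorem hexDir_ne_zero (k : ZMod 6) : hexDir k ≠ 0 := by
  revert k; decide

theorem add_hexDir_ne (x : ℤ × ℤ) (k : ZMod 6) : x + hexDir k ≠ x := by
  simpa using hexDir_ne_zero k

theorem add_hexDir_add_three (x : ℤ × ℤ) (k : ZMod 6) : x + hexDir k + hexDir (k + 3) = x := by
  rw [hexDir_add_three]; abel

theorem add_hexDir_three_add (x : ℤ × ℤ) (k : ZMod 6) : x + hexDir (k + 3) + hexDir k = x := by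
  rw [hexDir_add_three]; abel

theorem add_self_ne_zmod_six (k : ZMod 6) :
    k + 1 ≠ k ∧ k + 2 ≠ k ∧ k + 3 ≠ k ∧ k + 4 ≠ k ∧ k + 5 ≠ k := by
  revert k; decide

/-- A move either turns counterclockwise around the lattice point `x` across the edge in
direction `k`, or walks along the edge from `x` in direction `k` inside the triangle to its
right. -/
inductive Move where
  | turn (x : ℤ × ℤ) (k : ZMod 6)
  | walk (x : ℤ × ℤ) (k : ZMod 6)

/-- The conditions on a set `C` of triangles and edge weights `s` under which closed routes
are analysed.  The triangle `(x, k)` has vertices `x`, `x + hexDir k`, `x + hexDir (k + 1)`. -/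
structure IsWeb (C : ℤ × ℤ → ZMod 6 → Prop) (s : ℤ × ℤ → ZMod 6 → ℤ) : Prop where
  rot : ∀ x k, C (x + hexDir k) (k + 2) ↔ C x k
  nonneg : ∀ x k, 0 ≤ s x k
  symm : ∀ x k, s (x + hexDir k) (k + 3) = s x k
  border : ∀ x k, ¬ (C x k ∧ C x (k + 5)) → s x k = 2
  closure : ∀ x, (∀ k, s x k + s x (k + 1) = s x (k + 3) + s x (k + 4)) ∨
    (∀ k, ¬ (C x k ∧ C x (k + 1) ∧ C x (k + 2) ∧ C x (k + 5)))

section Routes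

variable {C : ℤ × ℤ → ZMod 6 → Prop} {s : ℤ × ℤ → ZMod 6 → ℤ}

def Move.Valid (C : ℤ × ℤ → ZMod 6 → Prop) (s : ℤ × ℤ → ZMod 6 → ℤ) : Move → Prop
  | .turn x k => s x k ≠ 0 ∧ C x k ∧ C x (k + 5)
  | .walk x k => s x k ≠ 0 ∧ C x (k + 5)

/-- The moves that may follow a turn ending at the edge `(x, k)`. -/
def FollowsTurn (s : ℤ × ℤ → ZMod 6 → ℤ) (x : ℤ × ℤ) (k : ZMod 6) (b : Move) : Prop :=
  (s x (k + 1) ≠ 0 ∧ (b = .turn x (k + 1) ∨ b = .walk x (k + 1))) ∨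
  (s x (k + 1) = 0 ∧ s x (k + 2) ≠ 0 ∧ b = .walk x (k + 2))

/-- The moves that may follow a walk ending at `x` along the edge `(x, k)`. -/
def FollowsWalk (s : ℤ × ℤ → ZMod 6 → ℤ) (x : ℤ × ℤ) (k : ZMod 6) (b : Move) : Prop :=
  (s x (k + 1) ≠ 0 ∧ b = .turn x (k + 1)) ∨
  (s x (k + 1) = 0 ∧ s x (k + 2) ≠ 0 ∧ (b = .turn x (k + 2) ∨ b = .walk x (k + 2))) ∨
  (s x (k + 1) = 0 ∧ s x (k + 2) = 0 ∧ s x (k + 3) ≠ 0 ∧ b = .walk x (k + 3))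

def Move.Step (C : ℤ × ℤ → ZMod 6 → Prop) (s : ℤ × ℤ → ZMod 6 → ℤ) (a b : Move) : Prop :=
  a.Valid C s ∧ b.Valid C s ∧
    match a with
    | .turn x k => FollowsTurn s x k b
    | .walk x k => FollowsWalk s (x + hexDir k) (k + 3) b

theorem step_turn_iff {x : ℤ × ℤ} {k : ZMod 6} {b : Move} :
    Move.Step C s (.turn x k) b ↔
      (Move.turn x k).Valid C s ∧ b.Valid C s ∧ FollowsTurn s x k b := Iff.rfl

theorem step_walk_iff {x : ℤ × ℤ} {k : ZMod 6} {b : Move} :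
    Move.Step C s (.walk (x + hexDir k) (k + 3)) b ↔
      (Move.walk (x + hexDir k) (k + 3)).Valid C s ∧ b.Valid C s ∧ FollowsWalk s x k b := by
  have h : k + 3 + 3 = k := by revert k; decide
  unfold Move.Step
  simp only [add_hexDir_add_three, h]

theorem exists_walk_eq (y : ℤ × ℤ) (l : ZMod 6) :
    ∃ x k, Move.walk y l = .walk (x + hexDir k) (k + 3) := by
  refine ⟨y + hexDir l, l + 3, ?_⟩
  rw [add_hexDir_add_three]
  simp [add_assoc, zmod_six_add]

/-- A step into a turn, read backwards. -/
theorem step_to_turn (hW : IsWeb C s) {x : ℤ × ℤ} {k : ZMod 6} {a : Move}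
    (h : Move.Step C s a (.turn x k)) :
    (s x (k + 5) ≠ 0 ∧ (a = .turn x (k + 5) ∨ a = .walk (x + hexDir (k + 5)) (k + 2))) ∨
    (s x (k + 5) = 0 ∧ s x (k + 4) ≠ 0 ∧ a = .walk (x + hexDir (k + 4)) (k + 1)) := by
  cases a with
  | turn y l =>
    obtain ⟨ha, hb, h⟩ := h
    simp only [FollowsTurn, Move.turn.injEq, reduceCtorEq, and_false, or_false] at h
    obtain ⟨h1, rfl, rfl⟩ := h
    refine Or.inl ⟨?_, Or.inl ?_⟩
    · simpa [add_assoc, zmod_six_add] using ha.1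
    · simp [add_assoc, zmod_six_add]
  | walk y l =>
    obtain ⟨y, l, e⟩ := exists_walk_eq y l
    rw [e] at h ⊢
    obtain ⟨ha, hb, h⟩ := step_walk_iff.1 h
    have ha' : s y l ≠ 0 := by simpa [hW.symm] using ha.1
    simp only [FollowsWalk, Move.turn.injEq, reduceCtorEq, and_false, or_false] at h
    rcases h with ⟨h1, rfl, rfl⟩ | ⟨h1, h2, rfl, rfl⟩
    · simp [add_assoc, zmod_six_add, ha']
    · simp [add_assoc, zmod_six_add, ha', h1]

/-- A step into a walk, read backwards. -/
theorem step_to_walk (hW : IsWeb C s) {x : ℤ × ℤ} {k : ZMod 6} {a : Move}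
    (h : Move.Step C s a (.walk x k)) :
    (s x (k + 5) ≠ 0 ∧ a = .turn x (k + 5)) ∨
    (s x (k + 5) = 0 ∧ s x (k + 4) ≠ 0 ∧
      (a = .turn x (k + 4) ∨ a = .walk (x + hexDir (k + 4)) (k + 1))) ∨
    (s x (k + 5) = 0 ∧ s x (k + 4) = 0 ∧ s x (k + 3) ≠ 0 ∧ a = .walk (x + hexDir (k + 3)) k) := by
  cases a with
  | turn y l =>
    obtain ⟨ha, hb, h⟩ := h
    have ha' : s y l ≠ 0 := ha.1
    simp only [FollowsTurn, Move.walk.injEq, reduceCtorEq, false_or] at h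
    rcases h with ⟨h1, rfl, rfl⟩ | ⟨h1, h2, rfl, rfl⟩
    · simp [add_assoc, zmod_six_add, ha']
    · simp [add_assoc, zmod_six_add, ha', h1]
  | walk y l =>
    obtain ⟨y, l, e⟩ := exists_walk_eq y l
    rw [e] at h ⊢
    obtain ⟨ha, hb, h⟩ := step_walk_iff.1 h
    have ha' : s y l ≠ 0 := by simpa [hW.symm] using ha.1
    simp only [FollowsWalk, Move.walk.injEq, reduceCtorEq, and_false, false_or] at h
    rcases h with ⟨h1, h2, rfl, rfl⟩ | ⟨h1, h2, h3, rfl, rfl⟩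
    · simp [add_assoc, zmod_six_add, ha', h1]
    · simp [add_assoc, zmod_six_add, ha', h1, h2]

/-- `a` leads to `b` in exactly `m` steps. -/
def StepN (C : ℤ × ℤ → ZMod 6 → Prop) (s : ℤ × ℤ → ZMod 6 → ℤ) : ℕ → Move → Move → Prop
  | 0, a, b => a = b
  | m + 1, a, b => ∃ c, Move.Step C s a c ∧ StepN C s m c b

theorem StepN.trans {m l : ℕ} {a b c : Move} (h : StepN C s m a b) (h' : StepN C s l b c) :
    StepN C s (m + l) a c := by
  induction m generalizing a with
  | zero => obtain rfl : a = b := h; simpa using h'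
  | succ m ih =>
    obtain ⟨d, hd, h⟩ := h
    rw [Nat.succ_add]
    exact ⟨d, hd, ih h⟩

theorem stepN_of_seq {z : ℕ → Move} (hz : ∀ i, Move.Step C s (z i) (z (i + 1))) (i m : ℕ) :
    StepN C s m (z i) (z (i + m)) := by
  induction m generalizing i with
  | zero => rfl
  | succ m ih => exact ⟨_, hz i, by simpa [add_assoc, add_comm 1 m] using ih (i + 1)⟩

/-- A closed route of the least possible positive length. -/
structure IsShortCycle (C : ℤ × ℤ → ZMod 6 → Prop) (s : ℤ × ℤ → ZMod 6 → ℤ) (L : ℕ)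
    (z : ℕ → Move) : Prop where
  pos : 0 < L
  per : ∀ i, z (i + L) = z i
  step : ∀ i, Move.Step C s (z i) (z (i + 1))
  le : ∀ m a, 0 < m → StepN C s m a a → L ≤ m

theorem StepN.exists_seq {m : ℕ} {a b : Move} (h : StepN C s m a b) :
    ∃ w : ℕ → Move, w 0 = a ∧ w m = b ∧ ∀ i < m, Move.Step C s (w i) (w (i + 1)) := by
  induction m generalizing a with
  | zero => exact ⟨fun _ => a, rfl, h, fun i hi => absurd hi (Nat.not_lt_zero i)⟩
  | succ m ih =>
    obtain ⟨c, hc, h⟩ := h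
    obtain ⟨w, w0, wm, hw⟩ := ih h
    refine ⟨fun i => if i = 0 then a else w (i - 1), by simp, by simp [wm], fun i hi => ?_⟩
    rcases i with _ | i
    · simpa [w0] using hc
    · simpa using hw i (by omega)

theorem exists_isShortCycle {m : ℕ} {a : Move} (hm : 0 < m) (h : StepN C s m a a) :
    ∃ L z, IsShortCycle C s L z := by
  have hex : ∃ l, 0 < l ∧ ∃ b, StepN C s l b b := ⟨m, hm, a, h⟩
  obtain ⟨hL, b, hb⟩ := Nat.find_spec hex
  set L := Nat.find hex with hLdef
  obtain ⟨w, w0, wL, hw⟩ := hb.exists_seq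
  refine ⟨L, fun i => w (i % L), hL, fun i => by simp, fun i => ?_, fun l c hl hc =>
    Nat.find_min' hex ⟨hl, c, hc⟩⟩
  have h1 : i % L < L := Nat.mod_lt _ hL
  have h2 := hw _ h1
  rcases Nat.lt_or_ge (i % L + 1) L with h3 | h3
  · rwa [show (i + 1) % L = i % L + 1 by
      rw [Nat.add_mod, ← Nat.mod_eq_of_lt h3]; simp]
  · have h4 : i % L + 1 = L := by omega
    have h5 : (i + 1) % L = 0 := by
      rw [← Nat.mod_add_mod, h4, Nat.mod_self]
    rw [h5, w0, ← wL]
    rwa [h4] at h2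

namespace IsShortCycle

variable {L : ℕ} {z : ℕ → Move}

theorem per_mul (hz : IsShortCycle C s L z) (i q : ℕ) : z (i + q * L) = z i := by
  induction q with
  | zero => simp
  | succ q ih => rw [Nat.succ_mul, ← add_assoc, hz.per, ih]

/-- A detour between two positions of a shortest cycle is no shorter than the cycle itself. -/
theorem chord (hz : IsShortCycle C s L z) {q i j : ℕ} (h : StepN C s q (z i) (z j))
    (hq : 0 < q) : ∃ r < q, z j = z (i + 1 + r) := by
  have hL := hz.pos
  obtain ⟨t, ht⟩ : ∃ t, j + (i + 1) * L = i + 1 + t :=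
    ⟨j + (i + 1) * L - (i + 1), by
      nlinarith [Nat.sub_add_cancel (show i + 1 ≤ j + (i + 1) * L by nlinarith)]⟩
  have hr : z (i + 1 + t % L) = z j := by
    rw [← hz.per_mul j (i + 1), ht, ← hz.per_mul (i + 1 + t % L) (t / L)]
    congr 1
    rw [add_assoc, Nat.mod_add_div']
  have hlt : t % L < L := Nat.mod_lt _ hL
  refine ⟨t % L, ?_, hr.symm⟩
  by_contra hcon
  have h2 := stepN_of_seq hz.step (i + 1 + t % L) (L - 1 - t % L)
  rw [show i + 1 + t % L + (L - 1 - t % L) = i + L by omega, hz.per, hr] at h2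
  have := hz.le _ _ (by omega) (h.trans h2)
  omega

theorem eq_of_step (hz : IsShortCycle C s L z) {i j : ℕ} (h : Move.Step C s (z i) (z j)) :
    z j = z (i + 1) := by
  obtain ⟨r, hr, e⟩ := hz.chord (q := 1) ⟨_, h, rfl⟩ one_pos
  obtain rfl : r = 0 := by omega
  exact e

theorem eq_of_step_step (hz : IsShortCycle C s L z) {i j : ℕ} {w : Move}
    (h : Move.Step C s (z i) w) (h' : Move.Step C s w (z j)) :
    z j = z (i + 1) ∨ z j = z (i + 2) := by
  obtain ⟨r, hr, e⟩ := hz.chord (q := 2) ⟨_, h, _, h', rfl⟩ two_pos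
  have : r = 0 ∨ r = 1 := by omega
  rcases this with rfl | rfl
  · exact Or.inl e
  · exact Or.inr e

/-- The predecessor of a position, as a position. -/
theorem exists_pred (hz : IsShortCycle C s L z) (j : ℕ) : ∃ i, z (i + 1) = z j :=
  ⟨j + L - 1, by rw [Nat.sub_add_cancel (by have := hz.pos; omega), hz.per]⟩

theorem exists_later (hz : IsShortCycle C s L z) (i j : ℕ) : ∃ m, z (i + m) = z j := by
  obtain ⟨t, ht⟩ : ∃ t, j + i * L = i + t := ⟨j + i * L - i, by
    have := hz.pos
    nlinarith [Nat.sub_add_cancel (show i ≤ j + i * L by nlinarith)]⟩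
  exact ⟨t, by rw [← ht, hz.per_mul]⟩

theorem succ_eq_of_eq (hz : IsShortCycle C s L z) {i j : ℕ} (h : z i = z j) :
    z (i + 1) = z (j + 1) :=
  hz.eq_of_step (i := j) (by rw [← h]; exact hz.step i)

end IsShortCycle

end Routes

section Routes

variable {C : ℤ × ℤ → ZMod 6 → Prop} {s : ℤ × ℤ → ZMod 6 → ℤ} {L : ℕ} {z : ℕ → Move}

/-- The move `a` ends at the lattice point `x`, on the edge in direction `k`. -/
def Move.ArrivesAt (a : Move) (x : ℤ × ℤ) (k : ZMod 6) : Prop :=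
  a = .turn x k ∨ a = .walk (x + hexDir k) (k + 3)

/-- Between `z i` and `z (i + 1)` the route passes through the corner at `x` of the
triangle `(x, k)`. -/
def Visits (s : ℤ × ℤ → ZMod 6 → ℤ) (z : ℕ → Move) (i : ℕ) (x : ℤ × ℤ) (k : ZMod 6) : Prop :=
  (z i).ArrivesAt x k ∨ (s x k = 0 ∧ (z i).ArrivesAt x (k + 5)) ∨
    (s x k = 0 ∧ s x (k + 5) = 0 ∧ (z i).ArrivesAt x (k + 4))

theorem Move.ArrivesAt.unique {a : Move} {x y : ℤ × ℤ} {k l : ZMod 6} (h : a.ArrivesAt x k)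
    (h' : a.ArrivesAt y l) : x = y ∧ k = l := by
  rcases h with rfl | rfl <;> rcases h' with h' | h'
  · simpa using h'
  · simp at h'
  · simp at h'
  · simp only [walk.injEq, add_left_inj] at h'
    obtain ⟨h, rfl⟩ := h'
    exact ⟨by simpa using h, rfl⟩

theorem Visits.unique {i : ℕ} {x y : ℤ × ℤ} {k l : ZMod 6} (h : Visits s z i x k)
    (h' : Visits s z i y l) : x = y := by
  rcases h with h | ⟨-, h⟩ | ⟨-, -, h⟩ <;> rcases h' with h' | ⟨-, h'⟩ | ⟨-, -, h'⟩ <;>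
    exact (h.unique h').1

namespace IsShortCycle

theorem pred_eq_of_eq (hz : IsShortCycle C s L z) {i j : ℕ} (h : z (i + 1) = z (j + 1)) :
    z i = z j := by
  have key : ∀ m, z (i + 1 + m) = z (j + 1 + m) := by
    intro m
    induction m with
    | zero => exact h
    | succ m ih => exact hz.succ_eq_of_eq ih
  have := hz.pos
  have h2 := key (L - 1)
  rwa [show i + 1 + (L - 1) = i + L by omega, show j + 1 + (L - 1) = j + L by omega, hz.per,
    hz.per] at h2

theorem valid (hz : IsShortCycle C s L z) {i : ℕ} {a : Move} (h : z i = a) : a.Valid C s :=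
  h ▸ (hz.step i).1

theorem ne_zero_of_turn (hz : IsShortCycle C s L z) {i : ℕ} {x : ℤ × ℤ} {k : ZMod 6}
    (h : z i = .turn x k) : s x k ≠ 0 := (hz.valid h).1

theorem ne_zero_of_walk (hz : IsShortCycle C s L z) {i : ℕ} {x : ℤ × ℤ} {k : ZMod 6}
    (h : z i = .walk x k) : s x k ≠ 0 := (hz.valid h).1

theorem ne_zero_of_arrivesAt (hW : IsWeb C s) (hz : IsShortCycle C s L z) {i : ℕ} {x : ℤ × ℤ}
    {k : ZMod 6} (h : (z i).ArrivesAt x k) : s x k ≠ 0 := by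
  rcases h with h | h
  · exact hz.ne_zero_of_turn h
  · rw [← hW.symm]
    exact hz.ne_zero_of_walk h

theorem followsTurn (hz : IsShortCycle C s L z) {i : ℕ} {x : ℤ × ℤ} {k : ZMod 6}
    (h : z i = .turn x k) : FollowsTurn s x k (z (i + 1)) := by
  have := hz.step i
  rw [h] at this
  exact this.2.2

theorem followsWalk (hz : IsShortCycle C s L z) {i : ℕ} {x : ℤ × ℤ} {k : ZMod 6}
    (h : z i = .walk (x + hexDir k) (k + 3)) : FollowsWalk s x k (z (i + 1)) := by
  have := hz.step i
  rw [h] at this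
  exact (step_walk_iff.1 this).2.2

theorem before_turn (hW : IsWeb C s) (hz : IsShortCycle C s L z) {i : ℕ} {x : ℤ × ℤ} {k : ZMod 6}
    (h : z (i + 1) = .turn x k) :
    (s x (k + 5) ≠ 0 ∧ (z i = .turn x (k + 5) ∨ z i = .walk (x + hexDir (k + 5)) (k + 2))) ∨
    (s x (k + 5) = 0 ∧ s x (k + 4) ≠ 0 ∧ z i = .walk (x + hexDir (k + 4)) (k + 1)) :=
  step_to_turn hW (h ▸ hz.step i)

theorem before_walk (hW : IsWeb C s) (hz : IsShortCycle C s L z) {i : ℕ} {x : ℤ × ℤ} {k : ZMod 6}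
    (h : z (i + 1) = .walk x k) :
    (s x (k + 5) ≠ 0 ∧ z i = .turn x (k + 5)) ∨
    (s x (k + 5) = 0 ∧ s x (k + 4) ≠ 0 ∧
      (z i = .turn x (k + 4) ∨ z i = .walk (x + hexDir (k + 4)) (k + 1))) ∨
    (s x (k + 5) = 0 ∧ s x (k + 4) = 0 ∧ s x (k + 3) ≠ 0 ∧
      z i = .walk (x + hexDir (k + 3)) k) :=
  step_to_walk hW (h ▸ hz.step i)

theorem not_turn_and_walk_in (hz : IsShortCycle C s L z) {i j : ℕ} {x : ℤ × ℤ} {k : ZMod 6}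
    (hi : z i = .turn x k) : z j ≠ .walk (x + hexDir k) (k + 3) := by
  intro hj
  have fi := hz.followsTurn hi
  have fj := hz.followsWalk hj
  have vi := hz.valid hi
  have vj := hz.valid hj
  have vi' := (hz.step i).2.1
  have vj' := (hz.step j).2.1
  suffices h : z (i + 1) = z (j + 1) by
    have := hz.pred_eq_of_eq h
    rw [hi, hj] at this
    simp at this
  rcases fi with ⟨h1, fi⟩ | ⟨h1, h2, fi⟩
  · rcases fj with ⟨-, fj⟩ | ⟨h1', -⟩ | ⟨h1', -⟩
    · refine (hz.eq_of_step (i := i) (j := j + 1) ?_).symm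
      rw [hi]
      exact step_turn_iff.2 ⟨vi, vj', Or.inl ⟨h1, Or.inl fj⟩⟩
    · exact absurd h1' h1
    · exact absurd h1' h1
  · refine hz.eq_of_step (i := j) (j := i + 1) ?_
    rw [hj]
    exact step_walk_iff.2 ⟨vj, vi', Or.inr (Or.inl ⟨h1, h2, Or.inr fi⟩)⟩

theorem not_turn_and_walk_out (hW : IsWeb C s) (hz : IsShortCycle C s L z) {i j : ℕ} {x : ℤ × ℤ}
    {k : ZMod 6} (hi : z i = .turn x k) : z j ≠ .walk x k := by
  intro hj
  obtain ⟨i', ei⟩ := hz.exists_pred i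
  obtain ⟨j', ej⟩ := hz.exists_pred j
  have bi := hz.before_turn hW (ei.trans hi)
  have bj := hz.before_walk hW (ej.trans hj)
  have vi := (hz.step i').1
  have vj := (hz.step j').1
  have vi' := (hz.step i').2.1
  have vj' := (hz.step j').2.1
  suffices h : z (i' + 1) = z (j' + 1) by
    rw [ei, ej, hi, hj] at h
    simp at h
  rcases bi with ⟨h1, -⟩ | ⟨h1, h2, bi⟩
  · rcases bj with ⟨-, bj⟩ | ⟨h1', -⟩ | ⟨h1', -⟩
    · refine hz.eq_of_step (i := j') (j := i' + 1) ?_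
      rw [bj] at vj ⊢
      refine step_turn_iff.2 ⟨vj, vi', Or.inl ?_⟩
      rw [ei, hi]
      simpa [add_assoc, zmod_six_add] using hz.ne_zero_of_turn hi
    · exact absurd h1' h1
    · exact absurd h1' h1
  · refine (hz.eq_of_step (i := i') (j := j' + 1) ?_).symm
    have e : k + 1 = k + 4 + 3 := by simp [add_assoc, zmod_six_add]
    rw [bi, e] at vi ⊢
    refine step_walk_iff.2 ⟨vi, vj', Or.inr (Or.inl ?_)⟩
    rw [ej, hj]
    simpa [add_assoc, zmod_six_add, h1] using hz.ne_zero_of_walk hj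

/-- A shortest cycle never walks along two consecutive sides of a triangle, inside it. -/
theorem not_walk_walk (hW : IsWeb C s) (hz : IsShortCycle C s L z) {i j : ℕ} {x : ℤ × ℤ}
    {k : ZMod 6} (hi : z i = .walk (x + hexDir k) (k + 3)) : z j ≠ .walk x (k + 1) := by
  intro hj
  have h0 := hz.ne_zero_of_walk hj
  rcases hz.followsWalk hi with ⟨-, h⟩ | ⟨h, -⟩ | ⟨h, -⟩
  · exact hz.not_turn_and_walk_out hW h hj
  · exact h0 h
  · exact h0 h

theorem visits_iff_of_ne_zero {i : ℕ} {x : ℤ × ℤ} {k : ZMod 6} (h : s x k ≠ 0) :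
    Visits s z i x k ↔ (z i).ArrivesAt x k := by
  simp [Visits, h]

/-- A move arriving at an edge finds an edge of positive weight within three steps. -/
theorem not_all_zero (hz : IsShortCycle C s L z) {i : ℕ} {x : ℤ × ℤ} {k : ZMod 6}
    (h : (z i).ArrivesAt x k) : ¬ (s x (k + 1) = 0 ∧ s x (k + 2) = 0 ∧ s x (k + 3) = 0) := by
  rintro ⟨h1, h2, h3⟩
  rcases h with h | h
  · simpa [FollowsTurn, h1, h2] using hz.followsTurn h
  · simpa [FollowsWalk, h1, h2, h3] using hz.followsWalk h

theorem visits_iff_of_eq_zero (hz : IsShortCycle C s L z) {i : ℕ} {x : ℤ × ℤ} {k : ZMod 6}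
    (hW : IsWeb C s) (h : s x k = 0) : Visits s z i x k ↔ Visits s z i x (k + 5) := by
  have h1 : ¬ (z i).ArrivesAt x k := fun h' => hz.ne_zero_of_arrivesAt hW h' h
  have h2 : ¬ (s x (k + 5) = 0 ∧ s x (k + 4) = 0 ∧ (z i).ArrivesAt x (k + 3)) := by
    rintro ⟨h5, h4, h3⟩
    have := hz.not_all_zero h3
    simp [add_assoc, zmod_six_add, h5, h4, h] at this
  simp only [Visits, add_assoc, zmod_six_add, h, h1, true_and, false_or]
  tauto

theorem visits_before_iff (hW : IsWeb C s) (hz : IsShortCycle C s L z) {i : ℕ} {x : ℤ × ℤ}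
    {k : ZMod 6} (h : s x k ≠ 0) :
    Visits s z i x (k + 5) ↔ z (i + 1) = .turn x k ∨ z (i + 1) = .walk x k := by
  constructor
  · simp only [Visits, add_assoc, zmod_six_add]
    rintro (h' | ⟨h5, h'⟩ | ⟨h5, h4, h'⟩)
    · rcases h' with h' | h'
      · have := hz.followsTurn h'
        simp only [FollowsTurn, add_assoc, zmod_six_add, add_zero, h] at this
        tauto
      · have := hz.followsWalk h'
        simp only [FollowsWalk, add_assoc, zmod_six_add, add_zero, h] at this
        tauto
    · rcases h' with h' | h'
      · have := hz.followsTurn h'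
        simp only [FollowsTurn, add_assoc, zmod_six_add, add_zero, h5] at this
        tauto
      · have := hz.followsWalk h'
        simp only [FollowsWalk, add_assoc, zmod_six_add, add_zero, h, h5] at this
        tauto
    · rcases h' with h' | h'
      · have := hz.followsTurn h'
        simp only [FollowsTurn, add_assoc, zmod_six_add, h4, h5] at this
        tauto
      · have := hz.followsWalk h'
        simp only [FollowsWalk, add_assoc, zmod_six_add, add_zero, h4, h5] at this
        tauto
  · rintro (h' | h')
    · have := hz.before_turn hW h'
      simp only [Visits, Move.ArrivesAt, add_assoc, zmod_six_add]
      tauto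
    · have := hz.before_walk hW h'
      simp only [Visits, Move.ArrivesAt, add_assoc, zmod_six_add, add_zero]
      tauto

theorem cell_of_visits (hW : IsWeb C s) (hz : IsShortCycle C s L z) {i : ℕ} {x : ℤ × ℤ}
    {k : ZMod 6} (h : Visits s z i x k) : C x k := by
  have flat : s x k = 0 → C x k := by
    intro h0
    by_contra hc
    have := hW.border x k (fun h => hc h.1)
    omega
  rcases h with (h | h) | ⟨h, -⟩ | ⟨h, -⟩
  · exact (hz.valid h).2.1
  · have := (hz.valid h).2
    simp only [add_assoc, zmod_six_add] at this
    exact (hW.rot x k).1 this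
  · exact flat h
  · exact flat h

end IsShortCycle

/-- `1` if the route passes through the corner at `x` of the triangle `(x, k)`, else `0`. -/
noncomputable def cornerCount (s : ℤ × ℤ → ZMod 6 → ℤ) (z : ℕ → Move) (x : ℤ × ℤ) (k : ZMod 6) :
    ℤ := if ∃ i, Visits s z i x k then 1 else 0

/-- `1` if the route contains the move `a`, else `0`. -/
noncomputable def moveCount (z : ℕ → Move) (a : Move) : ℤ := if ∃ i, z i = a then 1 else 0

theorem cornerCount_mem (x : ℤ × ℤ) (k : ZMod 6) :
    0 ≤ cornerCount s z x k ∧ cornerCount s z x k ≤ 1 := by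
  unfold cornerCount; split_ifs <;> simp

theorem moveCount_mem (a : Move) : 0 ≤ moveCount z a ∧ moveCount z a ≤ 1 := by
  unfold moveCount; split_ifs <;> simp

namespace IsShortCycle

theorem cornerCount_of_ne_zero (hz : IsShortCycle C s L z) {x : ℤ × ℤ} {k : ZMod 6}
    (h : s x k ≠ 0) : cornerCount s z x k =
      moveCount z (.turn x k) + moveCount z (.walk (x + hexDir k) (k + 3)) := by
  simp only [cornerCount, moveCount, visits_iff_of_ne_zero h, Move.ArrivesAt, exists_or]
  by_cases h1 : ∃ i, z i = .turn x k
  · obtain ⟨i, hi⟩ := h1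
    have h2 : ¬ ∃ j, z j = .walk (x + hexDir k) (k + 3) := by
      rintro ⟨j, hj⟩
      exact hz.not_turn_and_walk_in hi hj
    simp [h2, show ∃ i, z i = .turn x k from ⟨i, hi⟩]
  · simp [h1]

theorem cornerCount_before (hW : IsWeb C s) (hz : IsShortCycle C s L z) {x : ℤ × ℤ} {k : ZMod 6}
    (h : s x k ≠ 0) : cornerCount s z x (k + 5) =
      moveCount z (.turn x k) + moveCount z (.walk x k) := by
  have e : ∀ a, (∃ i, z (i + 1) = a) ↔ ∃ i, z i = a := by
    intro a
    constructor
    · rintro ⟨i, hi⟩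
      exact ⟨_, hi⟩
    · rintro ⟨i, hi⟩
      obtain ⟨j, hj⟩ := hz.exists_pred i
      exact ⟨j, hj.trans hi⟩
  simp only [cornerCount, moveCount, hz.visits_before_iff hW h, exists_or, e]
  by_cases h1 : ∃ i, z i = .turn x k
  · obtain ⟨i, hi⟩ := h1
    have h2 : ¬ ∃ j, z j = .walk x k := by
      rintro ⟨j, hj⟩
      exact hz.not_turn_and_walk_out hW hi hj
    simp [h2, show ∃ i, z i = .turn x k from ⟨i, hi⟩]
  · simp [h1]

theorem cornerCount_of_eq_zero (hW : IsWeb C s) (hz : IsShortCycle C s L z) {x : ℤ × ℤ}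
    {k : ZMod 6} (h : s x k = 0) : cornerCount s z x k = cornerCount s z x (k + 5) := by
  simp only [cornerCount, hz.visits_iff_of_eq_zero hW h]

theorem cell_of_cornerCount (hW : IsWeb C s) (hz : IsShortCycle C s L z) {x : ℤ × ℤ} {k : ZMod 6}
    (h : cornerCount s z x k ≠ 0) : C x k := by
  unfold cornerCount at h
  split_ifs at h with h'
  · obtain ⟨i, hi⟩ := h'
    exact hz.cell_of_visits hW hi
  · simp at h

theorem cornerCount_edge_of_ne_zero (hW : IsWeb C s) (hz : IsShortCycle C s L z) {x : ℤ × ℤ}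
    {k : ZMod 6} (h : s x k ≠ 0) :
    cornerCount s z x k - cornerCount s z (x + hexDir k) (k + 2) =
      moveCount z (.turn x k) - moveCount z (.turn (x + hexDir k) (k + 3)) := by
  have h' : s (x + hexDir k) (k + 3) ≠ 0 := by rwa [hW.symm]
  have h1 := hz.cornerCount_of_ne_zero h
  have h4 := hz.cornerCount_before hW h'
  rw [show k + 3 + 5 = k + 2 by simp [add_assoc, zmod_six_add]] at h4
  omega

theorem cornerCount_edge (hW : IsWeb C s) (hz : IsShortCycle C s L z) (x : ℤ × ℤ) (k : ZMod 6) :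
    cornerCount s z x k - cornerCount s z (x + hexDir k) (k + 2) =
      cornerCount s z x (k + 5) - cornerCount s z (x + hexDir k) (k + 3) := by
  have e2 : k + 3 + 5 = k + 2 := by simp [add_assoc, zmod_six_add]
  by_cases h : s x k = 0
  · have h' : s (x + hexDir k) (k + 3) = 0 := by rwa [hW.symm]
    have h1 := hz.cornerCount_of_eq_zero hW h
    have h2 := hz.cornerCount_of_eq_zero hW h'
    rw [e2] at h2
    omega
  · have h' : s (x + hexDir k) (k + 3) ≠ 0 := by rwa [hW.symm]
    have h1 := hz.cornerCount_of_ne_zero h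
    have h2 := hz.cornerCount_of_ne_zero h'
    have h3 := hz.cornerCount_before hW h
    have h4 := hz.cornerCount_before hW h'
    rw [e2] at h4
    rw [add_hexDir_add_three, show k + 3 + 3 = k by simp [add_assoc, zmod_six_add]] at h2
    omega

end IsShortCycle
end Routes

section Routes

variable {C : ℤ × ℤ → ZMod 6 → Prop} {s : ℤ × ℤ → ZMod 6 → ℤ} {L : ℕ} {z : ℕ → Move}

/-- The far vertices of the two triangles along the edge `(x, k)`. -/
theorem apex_eqs (x : ℤ × ℤ) (k : ZMod 6) :
    x + hexDir k + hexDir (k + 2) = x + hexDir (k + 1) ∧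
    x + hexDir k + hexDir (k + 4) = x + hexDir (k + 5) ∧
    x + hexDir (k + 1) + hexDir (k + 4) = x ∧
    x + hexDir (k + 1) + hexDir (k + 5) = x + hexDir k ∧
    x + hexDir (k + 5) + hexDir (k + 2) = x ∧
    x + hexDir (k + 5) + hexDir (k + 1) = x + hexDir k := by
  have h2 := hexDir_add_two k
  have h4 := hexDir_add_four k
  have h5 := hexDir_add_five k
  refine ⟨?_, ?_, ?_, ?_, ?_, ?_⟩ <;> simp only [h2, h4, h5] <;> abel

theorem dir_eqs (k : ZMod 6) : k + 3 + 3 = k ∧ k + 4 + 3 = k + 1 ∧ k + 5 + 3 = k + 2 ∧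
    k + 2 + 5 = k + 1 ∧ k + 1 + 5 = k ∧ k + 3 + 5 = k + 2 ∧ k + 5 + 5 = k + 4 ∧
    k + 4 + 5 = k + 3 ∧ k + 3 + 1 = k + 4 ∧ k + 4 + 1 = k + 5 ∧ k + 5 + 1 = k ∧
    k + 1 + 2 = k + 3 ∧ k + 2 + 2 = k + 4 ∧ k + 1 + 1 = k + 2 ∧ k + 2 + 1 = k + 3 ∧
    k + 1 + 3 = k + 4 ∧ k + 2 + 3 = k + 5 := by
  simp [add_assoc, zmod_six_add]

namespace IsShortCycle

theorem cornerCount_of_visits {i : ℕ} {x : ℤ × ℤ} {k : ZMod 6} (h : Visits s z i x k) :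
    cornerCount s z x k = 1 := if_pos ⟨i, h⟩

theorem cornerCount_walk_out (hW : IsWeb C s) (hz : IsShortCycle C s L z) {i : ℕ} {x : ℤ × ℤ}
    {k : ZMod 6} (h : z i = .walk x k) : cornerCount s z x (k + 5) = 1 := by
  obtain ⟨j, hj⟩ := hz.exists_pred i
  exact cornerCount_of_visits
    ((hz.visits_before_iff hW (hz.ne_zero_of_walk h)).2 (Or.inr (hj.trans h)))

theorem cornerCount_walk_in {i : ℕ} {x : ℤ × ℤ}
    {k : ZMod 6} (h : z i = .walk (x + hexDir k) (k + 3)) : cornerCount s z x k = 1 :=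
  cornerCount_of_visits (Or.inl (Or.inr h))

theorem walk_of_visits (hW : IsWeb C s) (hz : IsShortCycle C s L z) {i : ℕ} {x : ℤ × ℤ}
    {k : ZMod 6} (h0 : s x k = 0) (h : Visits s z i x k) :
    z i = .walk (x + hexDir (k + 5)) (k + 2) ∨ z (i + 1) = .walk x (k + 1) := by
  rcases h with h | ⟨-, h | h⟩ | ⟨-, h5, h | h⟩
  · exact absurd h0 (hz.ne_zero_of_arrivesAt hW h)
  · have := hz.followsTurn h
    simp only [FollowsTurn, add_assoc, zmod_six_add, add_zero, h0] at this
    tauto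
  · rw [(dir_eqs k).2.2.1] at h
    exact Or.inl h
  · have := hz.followsTurn h
    simp only [FollowsTurn, add_assoc, zmod_six_add, add_zero, h0, h5] at this
    tauto
  · have := hz.followsWalk h
    simp only [FollowsWalk, add_assoc, zmod_six_add, add_zero, h0, h5] at this
    tauto

theorem walk_of_cornerCount (hW : IsWeb C s) (hz : IsShortCycle C s L z) {x : ℤ × ℤ}
    {k : ZMod 6} (h0 : s x k = 0) (h : cornerCount s z x k ≠ 0) :
    (∃ i, z i = .walk (x + hexDir (k + 5)) (k + 2)) ∨ ∃ i, z i = .walk x (k + 1) := by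
  unfold cornerCount at h
  split_ifs at h with h'
  · obtain ⟨i, hi⟩ := h'
    rcases hz.walk_of_visits hW h0 hi with h | h
    · exact Or.inl ⟨_, h⟩
    · exact Or.inr ⟨_, h⟩
  · simp at h

/-- No walks along `x → w → y`, inside the triangle with corner `w`. -/
theorem not_walk_apex_left (hW : IsWeb C s) (hz : IsShortCycle C s L z) {i j : ℕ} {x : ℤ × ℤ}
    {k : ZMod 6} (hi : z i = .walk x (k + 1)) : z j ≠ .walk (x + hexDir (k + 1)) (k + 5) := by
  have := hz.not_walk_walk hW (i := i) (j := j) (x := x + hexDir (k + 1)) (k := k + 4)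
  rw [(apex_eqs x k).2.2.1, (dir_eqs k).2.1, (dir_eqs k).2.2.2.2.2.2.2.2.2.1] at this
  exact this hi

theorem not_walk_apex_right (hW : IsWeb C s) (hz : IsShortCycle C s L z) {i j : ℕ} {x : ℤ × ℤ}
    {k : ZMod 6} (hi : z i = .walk (x + hexDir k) (k + 4)) :
    z j ≠ .walk (x + hexDir (k + 5)) (k + 2) := by
  have := hz.not_walk_walk hW (i := i) (j := j) (x := x + hexDir (k + 5)) (k := k + 1)
  rw [(apex_eqs x k).2.2.2.2.2, add_assoc k, add_assoc k] at this
  exact this hi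

theorem cornerCount_le_of_eq_zero (hW : IsWeb C s) (hz : IsShortCycle C s L z) {x : ℤ × ℤ}
    {k : ZMod 6} (h0 : s x k = 0) :
    cornerCount s z x k + cornerCount s z (x + hexDir k) (k + 3) ≤
      cornerCount s z (x + hexDir (k + 1)) (k + 4) +
        cornerCount s z (x + hexDir (k + 5)) (k + 1) := by
  have h0' : s (x + hexDir k) (k + 3) = 0 := by rwa [hW.symm]
  obtain ⟨p1, p2, p3, p4, p5, p6⟩ := apex_eqs x k
  have d := dir_eqs k
  have c1 := cornerCount_mem (s := s) (z := z) x k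
  have c2 := cornerCount_mem (s := s) (z := z) (x + hexDir k) (k + 3)
  have c3 := cornerCount_mem (s := s) (z := z) (x + hexDir (k + 1)) (k + 4)
  have c4 := cornerCount_mem (s := s) (z := z) (x + hexDir (k + 5)) (k + 1)
  have hx := hz.walk_of_cornerCount hW h0
  have hy := hz.walk_of_cornerCount hW h0'
  have e8 : k + 3 + 2 = k + 5 := by simp [add_assoc, zmod_six_add]
  rw [d.2.2.2.2.2.1, e8, d.2.2.2.2.2.2.2.2.1, p1] at hy
  have a1 : (∃ i, z i = .walk (x + hexDir (k + 5)) (k + 2)) →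
      cornerCount s z (x + hexDir (k + 5)) (k + 1) = 1 := by
    rintro ⟨i, hi⟩
    have := hz.cornerCount_walk_out hW hi
    rwa [d.2.2.2.1] at this
  have a2 : (∃ i, z i = .walk x (k + 1)) →
      cornerCount s z (x + hexDir (k + 1)) (k + 4) = 1 := by
    rintro ⟨i, hi⟩
    refine cornerCount_walk_in (i := i) ?_
    rw [p3, d.2.1, hi]
  have a3 : (∃ i, z i = .walk (x + hexDir (k + 1)) (k + 5)) →
      cornerCount s z (x + hexDir (k + 1)) (k + 4) = 1 := by
    rintro ⟨i, hi⟩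
    have := hz.cornerCount_walk_out hW hi
    rwa [d.2.2.2.2.2.2.1] at this
  have a4 : (∃ i, z i = .walk (x + hexDir k) (k + 4)) →
      cornerCount s z (x + hexDir (k + 5)) (k + 1) = 1 := by
    rintro ⟨i, hi⟩
    refine cornerCount_walk_in (i := i) ?_
    rw [p6, hi, add_assoc]
    rfl
  by_cases hc : cornerCount s z x k = 0
  · by_cases hc' : cornerCount s z (x + hexDir k) (k + 3) = 0
    · omega
    · rcases hy hc' with h | h
      · have := a3 h; omega
      · have := a4 h; omega
  · by_cases hc' : cornerCount s z (x + hexDir k) (k + 3) = 0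
    · rcases hx hc with h | h
      · have := a1 h; omega
      · have := a2 h; omega
    · rcases hx hc with h | h <;> rcases hy hc' with h' | h'
      · have := a1 h; have := a3 h'; omega
      · obtain ⟨i, hi⟩ := h
        obtain ⟨j, hj⟩ := h'
        exact absurd hi (hz.not_walk_apex_right hW hj)
      · obtain ⟨i, hi⟩ := h
        obtain ⟨j, hj⟩ := h'
        exact absurd hj (hz.not_walk_apex_left hW hi)
      · have := a2 h; have := a4 h'; omega

end IsShortCycle
end Routes

section Routes

variable {C : ℤ × ℤ → ZMod 6 → Prop} {s : ℤ × ℤ → ZMod 6 → ℤ} {L : ℕ} {z : ℕ → Move}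

theorem IsWeb.cell_of_ne_two (hW : IsWeb C s) {x : ℤ × ℤ} {k : ZMod 6} (h : s x k ≠ 2) :
    C x k ∧ C x (k + 5) := by
  by_contra hc
  exact h (hW.border x k hc)

theorem IsWeb.closure_at (hW : IsWeb C s) {x : ℤ × ℤ} {k : ZMod 6}
    (h : C x k ∧ C x (k + 1) ∧ C x (k + 2) ∧ C x (k + 5)) (q : ZMod 6) :
    s x q + s x (q + 1) = s x (q + 3) + s x (q + 4) ∧
    s x (q + 1) + s x (q + 2) = s x (q + 4) + s x (q + 5) ∧
    s x (q + 2) + s x (q + 3) = s x (q + 5) + s x q := by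
  rcases hW.closure x with hc | hc
  · have h1 := hc (q + 1)
    have h2 := hc (q + 2)
    simp only [add_assoc, zmod_six_add, add_zero] at h1 h2
    exact ⟨hc q, h1, h2⟩
  · exact absurd h (hc k)

namespace IsShortCycle

/-- If a shortest cycle turns both ways across an edge, it passes through the corner opposite
to this edge. -/
theorem cornerCount_of_turn_turn (hW : IsWeb C s) (hz : IsShortCycle C s L z) {i j : ℕ}
    {x : ℤ × ℤ} {k : ZMod 6} (hi : z i = .turn x k)
    (hj : z j = .turn (x + hexDir k) (k + 3)) :
    cornerCount s z (x + hexDir (k + 1)) (k + 4) = 1 := by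
  by_contra hc
  obtain ⟨p1, p2, p3, p4, p5, p6⟩ := apex_eqs x k
  have d := dir_eqs k
  obtain ⟨j', hj'⟩ := hz.exists_pred j
  have hs := hz.ne_zero_of_turn hi
  have hs' := hz.ne_zero_of_turn hj
  have vi := hz.valid hi
  have vj := (hz.step j').1
  have vi' := (hz.step i).2.1
  have vw : (Move.walk (x + hexDir k) (k + 3)).Valid C s := by
    refine ⟨hs', ?_⟩
    rw [d.2.2.2.2.2.1, hW.rot]
    exact vi.2.1
  have h1 : Move.Step C s (z j') (.walk (x + hexDir k) (k + 3)) := by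
    have hb := hz.before_turn hW (hj'.trans hj)
    simp only [add_assoc k, zmod_six_add] at hb
    rcases hb with ⟨h2, h | h⟩ | ⟨h2, h3, h⟩
    · rw [h] at vj ⊢
      refine step_turn_iff.2 ⟨vj, vw, Or.inl ?_⟩
      simp only [add_assoc k, zmod_six_add]
      exact ⟨hs', by simp⟩
    · rw [p1] at h
      have := hz.cornerCount_walk_out hW h
      rw [d.2.2.2.2.2.2.1] at this
      exact absurd this hc
    · rw [← d.2.2.2.2.2.2.2.2.2.2.2.2.2.2.2.1] at h
      rw [h] at vj ⊢
      refine step_walk_iff.2 ⟨vj, vw, Or.inr (Or.inl ?_)⟩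
      simp only [add_assoc k, zmod_six_add]
      exact ⟨h2, hs', by simp⟩
  have h2 : Move.Step C s (.walk (x + hexDir k) (k + 3)) (z (i + 1)) := by
    refine step_walk_iff.2 ⟨vw, vi', ?_⟩
    rcases hz.followsTurn hi with ⟨h3, h | h⟩ | ⟨h3, h4, h⟩
    · exact Or.inl ⟨h3, h⟩
    · refine absurd (cornerCount_walk_in (i := i + 1) ?_) hc
      rw [p3, d.2.1, h]
    · exact Or.inr (Or.inl ⟨h3, h4, Or.inr h⟩)
  have hne := add_hexDir_ne x k
  rcases hz.eq_of_step_step h1 h2 with h | h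
  · rw [hj', hj] at h
    have := hz.followsTurn hi
    rw [h] at this
    simp [FollowsTurn, hne] at this
  · have := hz.pred_eq_of_eq (i := i) (j := j' + 1) h
    rw [hj', hi, hj] at this
    simp [hne.symm] at this

theorem meets_again_of_turn_after (hW : IsWeb C s) (hz : IsShortCycle C s L z) {i m : ℕ}
    {v : ℤ × ℤ} {q : ZMod 6}
    (hm : z (i + (m + 1)) = .walk v q) (hs : s v q = 1) (h1 : s v (q + 1) = 0)
    (hA : z (i + 1) = .turn v (q + 2)) :
    ∃ a b p, a ≤ b ∧ b < a + (m + 1) ∧ z a = .walk v p ∧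
      z b = .walk (v + hexDir p) (p + 3) ∧ s v p = 1 := by
  have cq := hW.cell_of_ne_two (x := v) (k := q) (by omega)
  have k1 := hW.cell_of_ne_two (x := v) (k := q + 1) (by omega)
  obtain ⟨e1, e2, e3⟩ := hW.closure_at (x := v) (k := q) ⟨cq.1, k1.1, (hz.valid hA).2.1, cq.2⟩ q
  have n3 := hW.nonneg v (q + 3)
  have n4 := hW.nonneg v (q + 4)
  have n5 := hW.nonneg v (q + 5)
  have h2 := hz.ne_zero_of_turn hA
  have gA := hz.followsTurn hA
  have fB := hz.before_walk hW (i := i + m) hm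
  have n25 : (2 : ZMod 6) ≠ 5 := by decide
  have hm0 : m ≠ 0 := by
    rintro rfl
    rw [zero_add, hA] at hm
    simp at hm
  have hm1 : z (i + m) ≠ .turn v (q + 2) → ∃ l, m = l + 2 := by
    intro h
    refine ⟨m - 2, ?_⟩
    have : m ≠ 1 := by
      rintro rfl
      exact h hA
    omega
  have hm2 : ∀ l, m = l + 2 → z (i + l + 1) ≠ .turn v (q + 2) → 1 ≤ l := by
    rintro l rfl h
    by_contra hl
    obtain rfl : l = 0 := by omega
    exact h hA
  simp only [FollowsTurn, add_assoc q, zmod_six_add] at gA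
  by_cases h4 : s v (q + 4) = 0
  · have hB : z (i + m) = .turn v (q + 5) := by
      rcases fB with ⟨-, fB⟩ | ⟨fB, -⟩ | ⟨fB, -⟩
      · exact fB
      · omega
      · omega
    obtain ⟨l, rfl⟩ := hm1 (by simp [hB, n25.symm])
    have hP := hz.before_turn hW (i := i + l + 1) hB
    simp only [add_assoc q, zmod_six_add, add_zero, h4, ne_eq, not_true_eq_false, false_and,
      false_or, true_and] at hP
    have hl := hm2 l rfl (by simp [hP.2])
    rcases gA with ⟨h3, gA | gA⟩ | ⟨h3, -⟩
    · refine absurd hP.2 ?_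
      have := hz.not_turn_and_walk_in (j := i + l + 1) gA
      rwa [(dir_eqs q).1] at this
    · exact ⟨i + 1 + 1, i + l + 1, q + 3, by omega, by omega, gA, by rw [hP.2, (dir_eqs q).1],
        by omega⟩
    · omega
  · have gA' : z (i + 1 + 1) = .walk v (q + 4) := by
      rcases gA with ⟨h3, -⟩ | ⟨-, -, gA⟩
      · omega
      · exact gA
    have nt : ∀ j, z j ≠ .turn v (q + 4) := fun j hj => hz.not_turn_and_walk_out hW hj gA'
    by_cases h5 : s v (q + 5) = 0
    · have hB : z (i + m) = .walk (v + hexDir (q + 4)) (q + 1) := by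
        rcases fB with ⟨fB, -⟩ | ⟨-, -, fB | fB⟩ | ⟨-, fB, -⟩
        · exact absurd h5 fB
        · exact absurd fB (nt _)
        · exact fB
        · exact absurd fB h4
      obtain ⟨l, rfl⟩ := hm1 (by simp [hB])
      exact ⟨i + 1 + 1, i + (l + 2), q + 4, by omega, by omega, gA',
        by rw [hB, (dir_eqs q).2.1], by omega⟩
    · have hB : z (i + m) = .turn v (q + 5) := by
        rcases fB with ⟨-, fB⟩ | ⟨fB, -⟩ | ⟨fB, -⟩
        · exact fB
        · exact absurd fB h5
        · exact absurd fB h5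
      obtain ⟨l, rfl⟩ := hm1 (by simp [hB, n25.symm])
      have hP := hz.before_turn hW (i := i + l + 1) hB
      simp only [add_assoc q, zmod_six_add, add_zero] at hP
      rcases hP with ⟨-, hP | hP⟩ | ⟨hP, -⟩
      · exact absurd hP (nt _)
      · have hl := hm2 l rfl (by simp [hP])
        exact ⟨i + 1 + 1, i + l + 1, q + 4, by omega, by omega, gA',
          by rw [hP, (dir_eqs q).2.1], by omega⟩
      · exact absurd hP h4

theorem meets_again_of_turn_before (hW : IsWeb C s) (hz : IsShortCycle C s L z) {i m : ℕ}
    {v : ℤ × ℤ} {q : ZMod 6} (hi : z i = .walk (v + hexDir q) (q + 3))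
    (hm : z (i + (m + 1)) = .walk v q) (hs : s v q = 1) (h5 : s v (q + 5) = 0)
    (hB : z (i + m) = .turn v (q + 4)) :
    ∃ a b p, a ≤ b ∧ b < a + (m + 1) ∧ z a = .walk v p ∧
      z b = .walk (v + hexDir p) (p + 3) ∧ s v p = 1 := by
  have cq := hW.cell_of_ne_two (x := v) (k := q) (by omega)
  have k5 := hW.cell_of_ne_two (x := v) (k := q + 5) (by omega)
  have kB := (hz.valid hB).2
  rw [(dir_eqs q).2.2.2.2.2.2.2.1] at kB
  have cl := hW.closure_at (x := v) (k := q + 4)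
    (by simpa only [add_assoc q, zmod_six_add, add_zero] using ⟨kB.1, k5.1, cq.1, kB.2⟩) q
  obtain ⟨e1, e2, e3⟩ := cl
  have n1 := hW.nonneg v (q + 1)
  have n2 := hW.nonneg v (q + 2)
  have n3 := hW.nonneg v (q + 3)
  have h4 := hz.ne_zero_of_turn hB
  have fA := hz.followsWalk hi
  have n41 : (4 : ZMod 6) ≠ 1 := by decide
  obtain ⟨l, rfl⟩ : ∃ l, m = l + 1 := by
    refine ⟨m - 1, ?_⟩
    have : m ≠ 0 := by
      rintro rfl
      rw [add_zero, hi] at hB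
      simp at hB
    omega
  have hP := hz.before_turn hW (i := i + l) hB
  simp only [add_assoc q, zmod_six_add, add_zero] at hP
  have hl1 : z (i + 1) ≠ .turn v (q + 4) → 1 ≤ l := by
    intro h
    by_contra hl
    obtain rfl : l = 0 := by omega
    exact h hB
  have hl2 : z (i + 1) ≠ .turn v (q + 4) → z (i + 1 + 1) ≠ .turn v (q + 4) → 2 ≤ l := by
    intro h h'
    by_contra hl
    obtain rfl : l = 1 := by have := hl1 h; omega
    exact h' hB
  by_cases h2 : s v (q + 2) = 0
  · have hA : z (i + 1) = .turn v (q + 1) := by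
      rcases fA with ⟨-, fA⟩ | ⟨fA, -⟩ | ⟨fA, -⟩
      · exact fA
      · omega
      · omega
    have gA := hz.followsTurn hA
    simp only [FollowsTurn, add_assoc q, zmod_six_add] at gA
    have gA' : z (i + 1 + 1) = .walk v (q + 3) := by
      rcases gA with ⟨h3, -⟩ | ⟨-, -, gA⟩
      · exact absurd h2 h3
      · exact gA
    have hl := hl2 (by simp [hA, n41.symm]) (by simp [gA'])
    rcases hP with ⟨-, hP | hP⟩ | ⟨hP, -⟩
    · exact absurd gA' (hz.not_turn_and_walk_out hW hP)
    · exact ⟨i + 1 + 1, i + l, q + 3, by omega, by omega, gA', by rw [hP, (dir_eqs q).1],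
        by omega⟩
    · omega
  · have hP' : z (i + l) = .walk (v + hexDir (q + 2)) (q + 5) := by
      rcases hP with ⟨h3, -⟩ | ⟨-, -, hP⟩
      · omega
      · exact hP
    have nt : ∀ j, z j ≠ .turn v (q + 2) := fun j hj => by
      have := hz.not_turn_and_walk_in (j := i + l) hj
      simp only [add_assoc q, zmod_six_add] at this
      exact this hP'
    have e5 : q + 2 + 3 = q + 5 := by simp only [add_assoc q, zmod_six_add]
    by_cases h1 : s v (q + 1) = 0
    · have hA : z (i + 1) = .walk v (q + 2) := by
        rcases fA with ⟨fA, -⟩ | ⟨-, -, fA | fA⟩ | ⟨-, fA, -⟩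
        · exact absurd h1 fA
        · exact absurd fA (nt _)
        · exact fA
        · exact absurd fA h2
      have hl := hl1 (by simp [hA])
      exact ⟨i + 1, i + l, q + 2, by omega, by omega, hA, by rw [hP', e5], by omega⟩
    · have hA : z (i + 1) = .turn v (q + 1) := by
        rcases fA with ⟨-, fA⟩ | ⟨fA, -⟩ | ⟨fA, -⟩
        · exact fA
        · exact absurd fA h1
        · exact absurd fA h1
      have gA := hz.followsTurn hA
      simp only [FollowsTurn, add_assoc q, zmod_six_add] at gA
      have gA' : z (i + 1 + 1) = .walk v (q + 2) := by
        rcases gA with ⟨-, gA | gA⟩ | ⟨h3, -⟩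
        · exact absurd gA (nt _)
        · exact gA
        · exact absurd h3 h2
      have hl := hl2 (by simp [hA, n41.symm]) (by simp [gA'])
      exact ⟨i + 1 + 1, i + l, q + 2, by omega, by omega, gA', by rw [hP', e5], by omega⟩

theorem not_walk_both_ways (hW : IsWeb C s) (hz : IsShortCycle C s L z) (m : ℕ) :
    ∀ (i : ℕ) (v : ℤ × ℤ) (q : ZMod 6), z i = .walk (v + hexDir q) (q + 3) →
      z (i + m) = .walk v q → s v q ≠ 1 := by
  induction m using Nat.strong_induction_on with
  | _ m ih =>
  intro i v q hi hm hs
  have closer : ∀ a b p, a ≤ b → b < a + m → z a = .walk v p →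
      z b = .walk (v + hexDir p) (p + 3) → s v p = 1 → False := by
    intro a b p hab hb ha hb' hp
    obtain ⟨c, rfl⟩ := Nat.exists_eq_add_of_le hab
    refine ih c (by omega) a (v + hexDir p) (p + 3) ?_ hb' ?_
    · rw [add_hexDir_add_three, (dir_eqs p).1, ha]
    · rw [hW.symm, hp]
  have hv := add_hexDir_ne v q
  obtain ⟨q1, q2, q3, q4, q5⟩ := add_self_ne_zmod_six q
  rcases m with _ | m
  · rw [add_zero, hi] at hm
    simp [hv] at hm
  have fA := hz.followsWalk hi
  have fB := hz.before_walk hW (i := i + m) hm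
  have cq := hW.cell_of_ne_two (x := v) (k := q) (by omega)
  have n1 := hW.nonneg v (q + 1)
  have n2 := hW.nonneg v (q + 2)
  have n3 := hW.nonneg v (q + 3)
  have n4 := hW.nonneg v (q + 4)
  have n5 := hW.nonneg v (q + 5)
  have cz : ∀ p, s v p = 0 → C v p ∧ C v (p + 5) := fun p hp =>
    hW.cell_of_ne_two (by omega)
  have vq : (Move.turn v q).Valid C s := ⟨by omega, cq⟩
  have vA := (hz.step (i + 1)).1
  have vB := (hz.step (i + m)).1
  -- The detour through `turn v q` shows that one of the two strands must avoid it.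
  have trouble : ¬ (Move.Step C s (z (i + m)) (.turn v q) ∧
      Move.Step C s (.turn v q) (z (i + 1))) := by
    rintro ⟨h1, h2⟩
    rcases hz.eq_of_step_step h1 h2 with h | h
    · rw [show i + m + 1 = i + (m + 1) by omega, hm] at h
      rw [h] at fA
      simp only [FollowsWalk, reduceCtorEq, Move.walk.injEq, true_and, false_or] at fA
      have : q ≠ q + 2 ∧ q ≠ q + 3 := ⟨Ne.symm q2, Ne.symm q3⟩
      tauto
    · have h := hz.pred_eq_of_eq (i := i) (j := i + m + 1) h
      rw [show i + m + 1 = i + (m + 1) by omega, hm, hi] at h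
      simp [hv] at h
  have stepB5 : z (i + m) = .turn v (q + 5) → Move.Step C s (z (i + m)) (.turn v q) := by
    intro h
    rw [h] at vB ⊢
    refine step_turn_iff.2 ⟨vB, vq, Or.inl ?_⟩
    simp [add_assoc, zmod_six_add, hs]
  have stepB4 : s v (q + 5) = 0 → z (i + m) = .walk (v + hexDir (q + 4)) (q + 1) →
      Move.Step C s (z (i + m)) (.turn v q) := by
    intro h5 h
    rw [← (dir_eqs q).2.1] at h
    rw [h] at vB ⊢
    refine step_walk_iff.2 ⟨vB, vq, Or.inr (Or.inl ?_)⟩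
    simp [add_assoc, zmod_six_add, hs, h5]
  have stepA1 : s v (q + 1) ≠ 0 → z (i + 1) = .turn v (q + 1) →
      Move.Step C s (.turn v q) (z (i + 1)) := fun h1 h =>
    step_turn_iff.2 ⟨vq, vA, Or.inl ⟨h1, Or.inl h⟩⟩
  have stepA2 : s v (q + 1) = 0 → s v (q + 2) ≠ 0 → z (i + 1) = .walk v (q + 2) →
      Move.Step C s (.turn v q) (z (i + 1)) := fun h1 h2 h =>
    step_turn_iff.2 ⟨vq, vA, Or.inr ⟨h1, h2, h⟩⟩
  have link : s v (q + 1) = 0 → s v (q + 2) = 0 → s v (q + 3) = 1 → s v (q + 4) = 0 →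
      s v (q + 5) = 0 → False := by
    intro h1 h2 h3 h4 h5
    simp only [FollowsWalk, h1, h2, h3, h4, h5, ne_eq, not_true_eq_false, false_and, true_and,
      and_false, false_or, one_ne_zero, not_false_eq_true] at fA fB
    rcases m with _ | m
    · rw [add_zero, hi] at fB
      simp [q3] at fB
    · exact closer (i + 1) (i + (m + 1)) (q + 3) (by omega) (by omega) fA
        (by rw [fB, (dir_eqs q).1]) h3
  have blockedA : s v (q + 1) = 0 → s v (q + 2) ≠ 0 → z (i + 1) = .turn v (q + 2) → False := by
    intro h1 h2 hA
    obtain ⟨a, b, p, hab, hb, ha, hb', hp⟩ := hz.meets_again_of_turn_after hW hm hs h1 hA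
    exact closer a b p hab hb ha hb' hp
  have blockedB : s v (q + 5) = 0 → s v (q + 4) ≠ 0 → z (i + m) = .turn v (q + 4) → False := by
    intro h5 h4 hB
    obtain ⟨a, b, p, hab, hb, ha, hb', hp⟩ := hz.meets_again_of_turn_before hW hi hm hs h5 hB
    exact closer a b p hab hb ha hb' hp
  have c1 := cz (q + 1)
  have c2 := cz (q + 2)
  have c4 := cz (q + 4)
  have c5 := cz (q + 5)
  simp only [add_assoc, zmod_six_add, add_zero] at c1 c2 c4 c5
  have finish : Move.Step C s (.turn v q) (z (i + 1)) → False := by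
    intro hA
    rcases fB with ⟨h5, hB⟩ | ⟨h5, h4, hB | hB⟩ | ⟨h5, h4, h3, hB⟩
    · exact trouble ⟨stepB5 hB, hA⟩
    · exact blockedB h5 h4 hB
    · exact trouble ⟨stepB4 h5 hB, hA⟩
    · obtain ⟨e1, e2, e3⟩ := hW.closure_at (x := v) (k := q + 4)
        (by simpa only [add_assoc q, zmod_six_add, add_zero] using
          ⟨(c4 h4).1, (c5 h5).1, cq.1, (c4 h4).2⟩) q
      exact link (by omega) (by omega) (by omega) h4 h5
  rcases fA with ⟨h1, hA⟩ | ⟨h1, h2, hA | hA⟩ | ⟨h1, h2, h3, hA⟩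
  · exact finish (stepA1 h1 hA)
  · exact blockedA h1 h2 hA
  · exact finish (stepA2 h1 h2 hA)
  · obtain ⟨e1, e2, e3⟩ := hW.closure_at (x := v) (k := q)
      ⟨cq.1, (c1 h1).1, (c2 h2).1, cq.2⟩ q
    exact link h1 h2 (by omega) (by omega) (by omega)

theorem cornerCount_le_of_eq_one (hW : IsWeb C s) (hz : IsShortCycle C s L z) {x : ℤ × ℤ}
    {k : ZMod 6} (h1 : s x k = 1) :
    cornerCount s z x k + cornerCount s z (x + hexDir k) (k + 3) ≤
      1 + cornerCount s z (x + hexDir (k + 1)) (k + 4) +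
        cornerCount s z (x + hexDir (k + 5)) (k + 1) := by
  have h1' : s (x + hexDir k) (k + 3) = 1 := by rwa [hW.symm]
  by_contra! hc
  have c1 := cornerCount_mem (s := s) (z := z) x k
  have c2 := cornerCount_mem (s := s) (z := z) (x + hexDir k) (k + 3)
  have c3 := cornerCount_mem (s := s) (z := z) (x + hexDir (k + 1)) (k + 4)
  have c4 := cornerCount_mem (s := s) (z := z) (x + hexDir (k + 5)) (k + 1)
  have c5 := cornerCount_mem (s := s) (z := z) (x + hexDir k) (k + 2)
  have c6 := cornerCount_mem (s := s) (z := z) x (k + 5)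
  have g := hz.cornerCount_edge hW x k
  have t1 := hz.cornerCount_of_ne_zero (x := x) (k := k) (by omega)
  have t2 := hz.cornerCount_before hW (x := x) (k := k) (by omega)
  have m1 := moveCount_mem (z := z) (.turn x k)
  have m2 := moveCount_mem (z := z) (.walk (x + hexDir k) (k + 3))
  have m3 := moveCount_mem (z := z) (.walk x k)
  by_cases ht : ∃ i, z i = .turn x k
  · have t3 := hz.cornerCount_of_ne_zero (x := x + hexDir k) (k := k + 3) (by omega)
    rw [(dir_eqs k).1, add_hexDir_add_three] at t3
    have e1 : moveCount z (.turn x k) = 1 := if_pos ht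
    have e2 : moveCount z (.turn (x + hexDir k) (k + 3)) ≠ 0 := by omega
    obtain ⟨i, hi⟩ := ht
    have hj : ∃ j, z j = .turn (x + hexDir k) (k + 3) := by
      by_contra hj
      exact e2 (if_neg hj)
    obtain ⟨j, hj⟩ := hj
    have := hz.cornerCount_of_turn_turn hW hi hj
    omega
  · have e1 : moveCount z (.turn x k) = 0 := if_neg ht
    have w1 : ∃ i, z i = .walk (x + hexDir k) (k + 3) := by
      by_contra hw
      have : moveCount z (.walk (x + hexDir k) (k + 3)) = 0 := if_neg hw
      omega
    have w2 : ∃ i, z i = .walk x k := by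
      by_contra hw
      have : moveCount z (.walk x k) = 0 := if_neg hw
      omega
    obtain ⟨i, hi⟩ := w1
    obtain ⟨j, hj⟩ := w2
    obtain ⟨m, hm⟩ := hz.exists_later i j
    exact hz.not_walk_both_ways hW m i x k hi (hm.trans hj) h1

end IsShortCycle
end Routes

section Routes

variable {C : ℤ × ℤ → ZMod 6 → Prop} {s : ℤ × ℤ → ZMod 6 → ℤ} {L : ℕ} {z : ℕ → Move}

/-- The edge `(x, k)` is flat, or the route turns across it. -/
def Crossed (s : ℤ × ℤ → ZMod 6 → ℤ) (z : ℕ → Move) (x : ℤ × ℤ) (k : ZMod 6) : Prop :=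
  s x k = 0 ∨ ∃ i, z i = .turn x k

/-- The route passes through all three corners of a triangle, or through none of them. -/
def CornerBalanced (s : ℤ × ℤ → ZMod 6 → ℤ) (z : ℕ → Move) : Prop :=
  ∀ x k, cornerCount s z x k = cornerCount s z (x + hexDir k) (k + 2)

theorem exists_visits {x : ℤ × ℤ} {k : ZMod 6} (h : cornerCount s z x k = 1) :
    ∃ i, Visits s z i x k := by
  by_contra hc
  have : cornerCount s z x k = 0 := if_neg hc
  omega

theorem not_crossed {x : ℤ × ℤ} {k : ZMod 6} (h : ¬ Crossed s z x k) :
    s x k ≠ 0 ∧ ∀ i, z i ≠ .turn x k := by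
  unfold Crossed at h
  push Not at h
  exact h

theorem arrivesAt_of_turn {i : ℕ} {x : ℤ × ℤ} {k : ZMod 6} (h : z i = .turn x k) :
    Visits s z i x k := Or.inl (Or.inl h)

namespace IsShortCycle

theorem turn_of_balanced (hW : IsWeb C s) (hz : IsShortCycle C s L z) (hg : CornerBalanced s z)
    {i : ℕ} {x : ℤ × ℤ} {k : ZMod 6} (h : z i = .turn x k) :
    ∃ j, z j = .turn (x + hexDir k) (k + 3) := by
  have := hz.cornerCount_edge_of_ne_zero hW (hz.ne_zero_of_turn h)
  have e : moveCount z (.turn x k) = 1 := if_pos ⟨i, h⟩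
  by_contra hc
  have e' : moveCount z (.turn (x + hexDir k) (k + 3)) = 0 := if_neg hc
  have := hg x k
  omega

theorem crossed_flip (hW : IsWeb C s) (hz : IsShortCycle C s L z) (hg : CornerBalanced s z)
    {x : ℤ × ℤ} {k : ZMod 6} (h : Crossed s z x k) : Crossed s z (x + hexDir k) (k + 3) := by
  rcases h with h | ⟨i, h⟩
  · exact Or.inl (by rwa [hW.symm])
  · exact Or.inr (hz.turn_of_balanced hW hg h)

theorem next_eq_walk (hW : IsWeb C s) (hz : IsShortCycle C s L z) {i : ℕ} {x : ℤ × ℤ}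
    {k : ZMod 6} (hc : ¬ Crossed s z x (k + 1)) (h : Visits s z i x k) :
    z (i + 1) = .walk x (k + 1) := by
  obtain ⟨h0, ht⟩ := not_crossed hc
  rw [← (dir_eqs k).2.2.2.2.1] at h
  exact ((hz.visits_before_iff hW h0).1 h).resolve_left (ht _)

theorem eq_walk_in {i : ℕ} {x : ℤ × ℤ} {k : ZMod 6} (hc : ¬ Crossed s z x k)
    (h : Visits s z i x k) : z i = .walk (x + hexDir k) (k + 3) := by
  obtain ⟨h0, ht⟩ := not_crossed hc
  exact ((visits_iff_of_ne_zero h0).1 h).resolve_left (ht _)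

theorem next_eq_turn (hW : IsWeb C s) (hz : IsShortCycle C s L z) {i j : ℕ} {x : ℤ × ℤ}
    {k : ZMod 6} (ht : z j = .turn x (k + 1)) (h : Visits s z i x k) :
    z (i + 1) = .turn x (k + 1) := by
  rw [← (dir_eqs k).2.2.2.2.1] at h
  exact ((hz.visits_before_iff hW (hz.ne_zero_of_turn ht)).1 h).resolve_right
    (hz.not_turn_and_walk_out hW ht)

theorem eq_turn (hz : IsShortCycle C s L z) {i j : ℕ} {x : ℤ × ℤ}
    {k : ZMod 6} (ht : z j = .turn x k) (h : Visits s z i x k) : z i = .turn x k :=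
  ((visits_iff_of_ne_zero (hz.ne_zero_of_turn ht)).1 h).resolve_right (hz.not_turn_and_walk_in ht)

/-- In a triangle all of whose edges are crossed, no edge is flat. -/
theorem ne_zero_of_all_crossed (hW : IsWeb C s) (hz : IsShortCycle C s L z)
    {i l : ℕ} {x : ℤ × ℤ} {k : ZMod 6} (hx : Visits s z i x k)
    (hw : Visits s z l (x + hexDir (k + 1)) (k + 4)) (h0 : Crossed s z x k)
    (h2 : Crossed s z (x + hexDir (k + 1)) (k + 5)) : s x (k + 1) ≠ 0 := by
  intro hs
  have hs' : s (x + hexDir (k + 1)) (k + 4) = 0 := by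
    rw [← (dir_eqs k).2.2.2.2.2.2.2.2.2.2.2.2.2.2.2.1, hW.symm, hs]
  have hx' : Visits s z i x (k + 1) := by
    rw [hz.visits_iff_of_eq_zero hW hs, (dir_eqs k).2.2.2.2.1]
    exact hx
  have a := hz.walk_of_visits hW hs hx'
  have b := hz.walk_of_visits hW hs' hw
  have e := (apex_eqs x (k + 1)).2.1
  simp only [add_assoc k, zmod_six_add, add_zero] at a b e
  rcases a with a | a
  · rcases h0 with h | ⟨j, h⟩
    · have := hz.ne_zero_of_walk a
      rw [hW.symm] at this
      exact this h
    · exact hz.not_turn_and_walk_in h a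
  · rcases b with b | b
    · have h := hz.not_walk_apex_left hW (x := x) (k := k + 1) (i := i + 1) (j := l)
      simp only [add_assoc k, zmod_six_add, add_zero] at h
      refine h a ?_
      rw [b]
      congr 1
      rw [hexDir_add_three, hexDir_add_two]
      abel
    · rcases h2 with h | ⟨j, h⟩
      · exact hz.ne_zero_of_walk b h
      · exact hz.not_turn_and_walk_out hW h b

theorem not_all_crossed (hW : IsWeb C s) (hz : IsShortCycle C s L z) (hg : CornerBalanced s z)
    {i j l : ℕ} {x : ℤ × ℤ} {k : ZMod 6} (hx : Visits s z i x k)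
    (hy : Visits s z j (x + hexDir k) (k + 2)) (hw : Visits s z l (x + hexDir (k + 1)) (k + 4))
    (h0 : Crossed s z x k) (h1 : Crossed s z x (k + 1))
    (h2 : Crossed s z (x + hexDir (k + 1)) (k + 5)) : False := by
  obtain ⟨p1, p2, p3, p4, p5, p6⟩ := apex_eqs x k
  have h0' := hz.crossed_flip hW hg h0
  have h1' := hz.crossed_flip hW hg h1
  have h2' := hz.crossed_flip hW hg h2
  rw [(dir_eqs k).2.2.2.2.2.2.2.2.2.2.2.2.2.2.2.1] at h1'
  rw [p4, (dir_eqs k).2.2.1] at h2'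
  have s1 := hz.ne_zero_of_all_crossed hW hx hw h0 h2
  have s2 := hz.ne_zero_of_all_crossed hW (i := j) (l := i) (x := x + hexDir k) (k := k + 2)
  have s0 := hz.ne_zero_of_all_crossed hW (i := l) (l := j) (x := x + hexDir (k + 1))
    (k := k + 4)
  simp only [add_assoc k, zmod_six_add, add_zero] at s2 s0
  rw [add_hexDir_add_three] at s2
  rw [p4] at s0
  have s2 := s2 hy hx h2' h1
  have s0 := s0 hw hy h1' h0'
  have s1' : s (x + hexDir (k + 1)) (k + 4) ≠ 0 := by
    have := hW.symm x (k + 1)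
    rw [(dir_eqs k).2.2.2.2.2.2.2.2.2.2.2.2.2.2.2.1] at this
    rwa [this]
  have s0' : s x k ≠ 0 := by rwa [hW.symm] at s2
  obtain ⟨a, ha⟩ := h0.resolve_left s0'
  obtain ⟨a', ha'⟩ := h0'.resolve_left s2
  obtain ⟨b, hb⟩ := h1.resolve_left s1
  have s3 : s (x + hexDir k) (k + 2) ≠ 0 := by
    have := hW.symm (x + hexDir (k + 1)) (k + 5)
    rw [p4, (dir_eqs k).2.2.1] at this
    rwa [this]
  obtain ⟨c, hc⟩ := h2'.resolve_left s3
  have hne := add_hexDir_ne x k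
  have vc := hz.valid hc
  have vw : (Move.walk (x + hexDir k) (k + 3)).Valid C s := by
    refine ⟨s2, ?_⟩
    rw [(dir_eqs k).2.2.2.2.2.1]
    exact vc.2.1
  have step1 : Move.Step C s (z c) (.walk (x + hexDir k) (k + 3)) := by
    rw [hc]
    refine step_turn_iff.2 ⟨vc, vw, Or.inl ?_⟩
    simp only [add_assoc k, zmod_six_add]
    exact ⟨s2, by simp⟩
  have step2 : Move.Step C s (.walk (x + hexDir k) (k + 3)) (z b) := by
    rw [hb]
    exact step_walk_iff.2 ⟨vw, hz.valid hb, Or.inl ⟨s1, rfl⟩⟩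
  have nc : z (c + 1) = .turn (x + hexDir k) (k + 3) := by
    have := hz.followsTurn hc
    simp only [FollowsTurn, add_assoc k, zmod_six_add, s2, ne_eq, not_false_eq_true, true_and,
      false_and, or_false] at this
    exact this.resolve_right (hz.not_turn_and_walk_out hW ha')
  rcases hz.eq_of_step_step step1 step2 with h | h
  · rw [nc, hb] at h
    simp [hne.symm] at h
  · obtain ⟨b', hb'⟩ := hz.exists_pred b
    have pb := hz.before_turn hW (hb'.trans hb)
    simp only [add_assoc k, zmod_six_add, add_zero, s0', ne_eq, not_false_eq_true, true_and,
      false_and, or_false] at pb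
    have pb := pb.resolve_right (hz.not_turn_and_walk_in ha)
    have := hz.pred_eq_of_eq (hb'.trans h)
    rw [nc, pb] at this
    simp [hne.symm] at this

theorem not_visits_both (hW : IsWeb C s) (hz : IsShortCycle C s L z) (hg : CornerBalanced s z)
    (m : ℕ) :
    ∀ (i : ℕ) (x : ℤ × ℤ) (k : ZMod 6), Crossed s z x k → Visits s z i x k →
      ¬ Visits s z (i + m) (x + hexDir k) (k + 2) := by
  induction m using Nat.strong_induction_on with
  | _ m ih =>
  intro i x k h0 hx hy
  obtain ⟨p1, p2, p3, p4, p5, p6⟩ := apex_eqs x k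
  have hxy := add_hexDir_ne x k
  have hxw := add_hexDir_ne x (k + 1)
  have hwy := add_hexDir_ne (x + hexDir (k + 1)) (k + 5)
  rw [p4] at hwy
  obtain ⟨l, hw⟩ : ∃ l, Visits s z l (x + hexDir (k + 1)) (k + 4) := by
    refine exists_visits ?_
    have g1 := hg x k
    have g2 := hg (x + hexDir k) (k + 2)
    rw [p1, (dir_eqs k).2.2.2.2.2.2.2.2.2.2.2.2.1, cornerCount_of_visits hy] at g2
    exact g2.symm
  obtain ⟨m, rfl⟩ : ∃ n, m = n + 1 := by
    refine ⟨m - 1, ?_⟩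
    have : m ≠ 0 := by
      rintro rfl
      exact hxy (hy.unique hx)
    omega
  have e1 : s x (k + 1) = s (x + hexDir (k + 1)) (k + 4) := by
    have := hW.symm x (k + 1)
    rw [(dir_eqs k).2.2.2.2.2.2.2.2.2.2.2.2.2.2.2.1] at this
    exact this.symm
  have e2 : s (x + hexDir (k + 1)) (k + 5) = s (x + hexDir k) (k + 2) := by
    have := hW.symm (x + hexDir (k + 1)) (k + 5)
    rw [p4, (dir_eqs k).2.2.1] at this
    exact this.symm
  by_cases h1 : Crossed s z x (k + 1) <;>
    by_cases h2 : Crossed s z (x + hexDir (k + 1)) (k + 5)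
  · exact hz.not_all_crossed hW hg hx hy hw h0 h1 h2
  · have h2' : ¬ Crossed s z (x + hexDir k) (k + 2) := by
      intro h
      have := hz.crossed_flip hW hg h
      rw [p1, (dir_eqs k).2.2.2.2.2.2.2.2.2.2.2.2.2.2.2.2] at this
      exact h2 this
    have hy' := eq_walk_in h2' hy
    rw [p1, (dir_eqs k).2.2.2.2.2.2.2.2.2.2.2.2.2.2.2.2] at hy'
    have hw' : Visits s z (i + m) (x + hexDir (k + 1)) (k + 4) := by
      rw [← (dir_eqs k).2.2.2.2.2.2.1]
      exact (hz.visits_before_iff hW (hz.ne_zero_of_walk hy')).2 (Or.inr hy')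
    rcases h1 with h1 | ⟨j, h1⟩
    · refine ih m (by omega) i x (k + 1) (Or.inl h1) ?_ ?_
      · rw [hz.visits_iff_of_eq_zero hW h1, (dir_eqs k).2.2.2.2.1]
        exact hx
      · rw [e1] at h1
        rw [hz.visits_iff_of_eq_zero hW h1] at hw'
        simpa only [add_assoc k, zmod_six_add] using hw'
    · have t1 := hz.next_eq_turn hW h1 hx
      obtain ⟨j', h1'⟩ := hz.turn_of_balanced hW hg h1
      rw [(dir_eqs k).2.2.2.2.2.2.2.2.2.2.2.2.2.2.2.1] at h1'
      have t2 := hz.eq_turn h1' hw'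
      have m0 : m ≠ 0 := by
        rintro rfl
        exact hxw (hw'.unique hx)
      have m1 : m ≠ 1 := by
        rintro rfl
        rw [t1] at t2
        simp [hxw.symm] at t2
      obtain ⟨r, rfl⟩ : ∃ r, m = r + 2 := ⟨m - 2, by omega⟩
      refine ih r (by omega) (i + 1) x (k + 1) (Or.inr ⟨j, h1⟩) (arrivesAt_of_turn t1) ?_
      have := (hz.visits_before_iff hW (i := i + 1 + r) (hz.ne_zero_of_turn t2)).2
        (Or.inl (by rw [← t2]; congr 1; omega))
      simpa only [add_assoc k, zmod_six_add] using this
  · have hx' := hz.next_eq_walk hW h1 hx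
    have hw' : Visits s z (i + 1) (x + hexDir (k + 1)) (k + 4) :=
      Or.inl (Or.inr (by rw [p3, (dir_eqs k).2.1, hx']))
    rcases h2 with h2 | ⟨j, h2⟩
    · refine ih m (by omega) (i + 1) (x + hexDir (k + 1)) (k + 5) (Or.inl h2) ?_ ?_
      · rw [hz.visits_iff_of_eq_zero hW h2, (dir_eqs k).2.2.2.2.2.2.1]
        exact hw'
      · rw [e2] at h2
        rw [hz.visits_iff_of_eq_zero hW h2, (dir_eqs k).2.2.2.1] at hy
        rw [p4, show i + 1 + m = i + (m + 1) by omega]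
        simpa only [add_assoc k, zmod_six_add] using hy
    · have t1 : z (i + 1 + 1) = .turn (x + hexDir (k + 1)) (k + 5) := by
        have := hz.next_eq_turn hW (i := i + 1) (j := j) (x := x + hexDir (k + 1)) (k := k + 4)
        simp only [add_assoc k, zmod_six_add] at this
        exact this h2 hw'
      obtain ⟨j', h2'⟩ := hz.turn_of_balanced hW hg h2
      rw [p4, (dir_eqs k).2.2.1] at h2'
      have t2 := hz.eq_turn h2' hy
      have m0 : m ≠ 0 := by
        rintro rfl
        exact hwy (hy.unique hw')
      have m1 : m ≠ 1 := by
        rintro rfl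
        rw [show i + (1 + 1) = i + 1 + 1 by omega, t1] at t2
        simp [hwy.symm] at t2
      obtain ⟨r, rfl⟩ : ∃ r, m = r + 2 := ⟨m - 2, by omega⟩
      refine ih r (by omega) (i + 1 + 1) (x + hexDir (k + 1)) (k + 5) (Or.inr ⟨j, h2⟩)
        (arrivesAt_of_turn t1) ?_
      have := (hz.visits_before_iff hW (i := i + 1 + 1 + r) (hz.ne_zero_of_turn t2)).2
        (Or.inl (by rw [← t2]; congr 1; omega))
      rw [p4]
      simpa only [add_assoc k, zmod_six_add] using this
  · have hx' := hz.next_eq_walk hW h1 hx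
    have hw' := hz.next_eq_walk hW (x := x + hexDir (k + 1)) (k := k + 4) (i := l)
    simp only [add_assoc k, zmod_six_add] at hw'
    exact hz.not_walk_apex_left hW hx' (hw' h2 hw)

theorem not_balanced (hW : IsWeb C s) (hz : IsShortCycle C s L z) : ¬ CornerBalanced s z := by
  intro hg
  obtain ⟨x, k, h⟩ : ∃ x k, Visits s z 0 x k := by
    rcases h : z 0 with ⟨x, k⟩ | ⟨x, k⟩
    · exact ⟨x, k, arrivesAt_of_turn h⟩
    · obtain ⟨y, l, e⟩ := exists_walk_eq x k
      exact ⟨y, l, Or.inl (Or.inr (h.trans e))⟩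
  have g1 := hg x k
  have g2 := hg (x + hexDir k) (k + 2)
  rw [cornerCount_of_visits h] at g1
  rw [(apex_eqs x k).1, (dir_eqs k).2.2.2.2.2.2.2.2.2.2.2.2.1, ← g1] at g2
  by_cases h0 : Crossed s z x k
  · obtain ⟨j, hj⟩ := exists_visits g1.symm
    obtain ⟨m, hm⟩ := hz.exists_later 0 j
    refine hz.not_visits_both hW hg m 0 x k h0 h ?_
    unfold Visits at hj ⊢
    rwa [hm]
  · have h1 : Crossed s z x (k + 1) := by
      by_contra h1
      exact hz.not_walk_walk hW (eq_walk_in h0 h) (hz.next_eq_walk hW h1 h)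
    obtain ⟨j, hj⟩ := exists_visits g2.symm
    obtain ⟨m, hm⟩ := hz.exists_later j 0
    have h1' := hz.crossed_flip hW hg h1
    rw [(dir_eqs k).2.2.2.2.2.2.2.2.2.2.2.2.2.2.2.1] at h1'
    refine hz.not_visits_both hW hg m j _ _ h1' hj ?_
    simp only [add_assoc k, zmod_six_add, add_zero, (apex_eqs x k).2.2.1]
    unfold Visits at h ⊢
    rwa [hm]

end IsShortCycle
end Routes

section Hives

/-- Lattice points of the triangle of side `n`. -/
def InTri (n : ℤ) (x : ℤ × ℤ) : Prop := 0 ≤ x.1 ∧ 0 ≤ x.2 ∧ x.1 + x.2 ≤ n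

/-- The unit triangle with vertices `x`, `x + hexDir k`, `x + hexDir (k + 1)` lies in the
triangle of side `n`. -/
def Cell (n : ℤ) (x : ℤ × ℤ) (k : ZMod 6) : Prop :=
  InTri n x ∧ InTri n (x + hexDir k) ∧ InTri n (x + hexDir (k + 1))

/-- The concavity defect of `h` across the edge `(x, k)`. -/
def slack (h : ℤ × ℤ → ℤ) (x : ℤ × ℤ) (k : ZMod 6) : ℤ :=
  h x + h (x + hexDir k) - h (x + hexDir (k + 1)) - h (x + hexDir (k + 5))

/-- Hives: functions on the triangle of side `n` that are concave across each inner edge. -/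
def IsHive (n : ℤ) (h : ℤ × ℤ → ℤ) : Prop :=
  ∀ x k, Cell n x k → Cell n x (k + 5) → 0 ≤ slack h x k

/-- The concavity defects of a hive, with boundary edges counted as strictly concave. -/
noncomputable def edgeWeight (n : ℤ) (h : ℤ × ℤ → ℤ) (x : ℤ × ℤ) (k : ZMod 6) : ℤ :=
  if Cell n x k ∧ Cell n x (k + 5) then slack h x k else 2

theorem hexDir_values : hexDir 0 = (1, 0) ∧ hexDir 1 = (0, 1) ∧ hexDir 2 = (-1, 1) ∧
    hexDir 3 = (-1, 0) ∧ hexDir 4 = (0, -1) ∧ hexDir 5 = (1, -1) := by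
  decide

theorem zmod_six_cases (k : ZMod 6) : k = 0 ∨ k = 1 ∨ k = 2 ∨ k = 3 ∨ k = 4 ∨ k = 5 := by
  revert k; decide

theorem inTri_of_neighbours {n : ℤ} {x : ℤ × ℤ} {k : ZMod 6} (h0 : InTri n (x + hexDir k))
    (h1 : InTri n (x + hexDir (k + 1))) (h2 : InTri n (x + hexDir (k + 2)))
    (h3 : InTri n (x + hexDir (k + 3))) (h5 : InTri n (x + hexDir (k + 5))) (l : ZMod 6) :
    InTri n (x + hexDir l) := by
  obtain ⟨v0, v1, v2, v3, v4, v5⟩ := hexDir_values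
  rcases zmod_six_cases k with rfl | rfl | rfl | rfl | rfl | rfl <;>
  rcases zmod_six_cases l with rfl | rfl | rfl | rfl | rfl | rfl <;>
  simp only [InTri, zmod_six_add, zero_add, add_zero, v0, v1, v2, v3, v4, v5, Prod.fst_add,
    Prod.snd_add] at * <;> omega

theorem cell_rotate {n : ℤ} {x : ℤ × ℤ} {k : ZMod 6} :
    Cell n (x + hexDir k) (k + 2) ↔ Cell n x k := by
  unfold Cell
  rw [(apex_eqs x k).1, (dir_eqs k).2.2.2.2.2.2.2.2.2.2.2.2.2.2.1, add_hexDir_add_three]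
  tauto

theorem cell_flip {n : ℤ} {x : ℤ × ℤ} {k : ZMod 6} :
    Cell n (x + hexDir k) (k + 3) ↔ Cell n x (k + 5) := by
  unfold Cell
  rw [(dir_eqs k).2.2.2.2.2.2.2.2.1, (apex_eqs x k).2.1, (dir_eqs k).2.2.2.2.2.2.2.2.2.2.1,
    add_hexDir_add_three]
  tauto

theorem slack_flip {h : ℤ × ℤ → ℤ} {x : ℤ × ℤ} {k : ZMod 6} :
    slack h (x + hexDir k) (k + 3) = slack h x k := by
  unfold slack
  rw [(dir_eqs k).2.2.2.2.2.2.2.2.1, (dir_eqs k).2.2.2.2.2.1, (apex_eqs x k).1,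
    (apex_eqs x k).2.1, add_hexDir_add_three]
  ring

theorem slack_add (h : ℤ × ℤ → ℤ) (x : ℤ × ℤ) (k : ZMod 6) :
    slack h x k + slack h x (k + 1) = slack h x (k + 3) + slack h x (k + 4) := by
  simp only [slack, add_assoc k, zmod_six_add, add_zero]
  ring

theorem edgeWeight_of_cell {n : ℤ} {h : ℤ × ℤ → ℤ} {x : ℤ × ℤ} {k : ZMod 6} (h1 : Cell n x k)
    (h2 : Cell n x (k + 5)) : edgeWeight n h x k = slack h x k := if_pos ⟨h1, h2⟩

theorem IsHive.isWeb {n : ℤ} {h : ℤ × ℤ → ℤ} (hh : IsHive n h) :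
    IsWeb (Cell n) (edgeWeight n h) where
  rot _ _ := cell_rotate
  nonneg x k := by
    unfold edgeWeight
    split_ifs with hc
    · exact hh x k hc.1 hc.2
    · norm_num
  symm x k := by
    unfold edgeWeight
    rw [cell_flip, (dir_eqs k).2.2.2.2.2.1, cell_rotate, slack_flip]
    simp only [and_comm]
  border x k hc := if_neg hc
  closure x := by
    by_cases hx : ∀ l, InTri n (x + hexDir l)
    · by_cases h0 : InTri n x
      · left
        have hc : ∀ l, Cell n x l := fun l => ⟨h0, hx _, hx _⟩
        intro k
        simp only [edgeWeight_of_cell (hc _) (hc _), slack_add]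
      · right
        intro k hc
        exact h0 hc.1.1
    · right
      rintro k ⟨c0, c1, c2, c5⟩
      have := c2.2.2
      rw [(dir_eqs k).2.2.2.2.2.2.2.2.2.2.2.2.2.2.1] at this
      exact hx (inTri_of_neighbours c0.2.1 c1.2.1 c2.2.1 this c5.2.1)

section Potential

variable {n : ℤ} {c : ℤ × ℤ → ZMod 6 → ℤ}

/-- The jump along the edge `(x, k)` determined by corner counts. -/
def jump (c : ℤ × ℤ → ZMod 6 → ℤ) (x : ℤ × ℤ) (k : ZMod 6) : ℤ :=
  c x k - c (x + hexDir k) (k + 2)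

/-- The function with the given jumps, vanishing below the line `x.2 = 0`. -/
def potential (c : ℤ × ℤ → ZMod 6 → ℤ) (x : ℤ × ℤ) : ℤ :=
  ∑ b ∈ Finset.range x.2.toNat, jump c (x.1, b) 1

theorem jump_triangle (x : ℤ × ℤ) (k : ZMod 6) :
    jump c x k + jump c (x + hexDir k) (k + 2) + jump c (x + hexDir (k + 1)) (k + 4) = 0 := by
  unfold jump
  obtain ⟨p1, -, p3, -⟩ := apex_eqs x k
  rw [p1, p3]
  simp only [add_assoc k, zmod_six_add, add_zero]
  ring

theorem jump_flip
    (he : ∀ x k, c x k - c (x + hexDir k) (k + 2) = c x (k + 5) - c (x + hexDir k) (k + 3))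
    (x : ℤ × ℤ) (k : ZMod 6) : jump c (x + hexDir k) (k + 3) = - jump c x k := by
  have h1 := he x k
  unfold jump
  rw [add_hexDir_add_three]
  simp only [add_assoc k, zmod_six_add] at *
  omega

theorem jump_of_not_cell (hc : ∀ x k, c x k ≠ 0 → Cell n x k) {x : ℤ × ℤ} {k : ZMod 6}
    (h : ¬ Cell n x k) : jump c x k = 0 := by
  have h1 : c x k = 0 := by
    by_contra h'
    exact h (hc _ _ h')
  have h2 : c (x + hexDir k) (k + 2) = 0 := by
    by_contra h'
    exact h (cell_rotate.1 (hc _ _ h'))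
  simp [jump, h1, h2]

theorem jump_of_not_cell' (hc : ∀ x k, c x k ≠ 0 → Cell n x k)
    (he : ∀ x k, c x k - c (x + hexDir k) (k + 2) = c x (k + 5) - c (x + hexDir k) (k + 3))
    {x : ℤ × ℤ} {k : ZMod 6} (h : ¬ Cell n x (k + 5)) : jump c x k = 0 := by
  have := jump_flip he x k
  rw [jump_of_not_cell hc (mt cell_flip.1 h)] at this
  omega

theorem potential_add_one (hc : ∀ x k, c x k ≠ 0 → Cell n x k) (x : ℤ × ℤ) :
    potential c (x + hexDir 1) - potential c x = jump c x 1 := by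
  obtain ⟨i, j⟩ := x
  rw [hexDir_values.2.1]
  rcases lt_or_ge j 0 with hj | hj
  · rw [jump_of_not_cell hc (fun h => absurd h.1.2.1 (not_le.2 hj))]
    have e1 : (j + 1).toNat = 0 := by omega
    have e2 : j.toNat = 0 := by omega
    simp [potential, e1, e2]
  · lift j to ℕ using hj
    have e1 : ((j : ℤ) + 1).toNat = j + 1 := by omega
    simp [potential, e1, Finset.sum_range_succ]

theorem potential_add_zero (hc : ∀ x k, c x k ≠ 0 → Cell n x k)
    (he : ∀ x k, c x k - c (x + hexDir k) (k + 2) = c x (k + 5) - c (x + hexDir k) (k + 3))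
    (x : ℤ × ℤ) : potential c (x + hexDir 0) - potential c x = jump c x 0 := by
  obtain ⟨v0, v1, v2, v3, v4, v5⟩ := hexDir_values
  obtain ⟨i, j⟩ := x
  have below : ∀ j ≤ 0, potential c ((i, j) + hexDir 0) - potential c (i, j) =
      jump c (i, j) 0 := by
    intro j hj
    rw [jump_of_not_cell' hc he (fun h => ?_)]
    · have e2 : j.toNat = 0 := by omega
      simp [potential, v0, e2]
    · have := h.2.1.2.1
      simp only [zero_add, v5, Prod.mk_add_mk] at this
      omega
  rcases le_or_gt j 0 with hj | hj
  · exact below j hj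
  · lift j to ℕ using hj.le
    clear hj
    induction j with
    | zero => exact below _ le_rfl
    | succ j ih =>
      have a1 := potential_add_one hc (i, (j : ℤ))
      have a2 := potential_add_one hc (i + 1, (j : ℤ))
      have t1 := jump_triangle (c := c) (i, (j : ℤ)) 0
      have t2 := jump_triangle (c := c) (i + 1, (j : ℤ)) 1
      have f1 := jump_flip he (i + 1, (j : ℤ)) 2
      have f2 := jump_flip he (i, (j : ℤ)) 1
      have f3 := jump_flip he (i, (j : ℤ) + 1) 0
      simp only [zmod_six_add, zero_add, v0, v1, v2, v3, v4, v5, Prod.mk_add_mk, add_zero,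
        add_neg_cancel_right] at *
      push_cast
      omega

theorem potential_sub (hc : ∀ x k, c x k ≠ 0 → Cell n x k)
    (he : ∀ x k, c x k - c (x + hexDir k) (k + 2) = c x (k + 5) - c (x + hexDir k) (k + 3))
    (x : ℤ × ℤ) (k : ZMod 6) :
    potential c (x + hexDir k) - potential c x = jump c x k := by
  have flip : ∀ l, (∀ y, potential c (y + hexDir l) - potential c y = jump c y l) →
      ∀ y, potential c (y + hexDir (l + 3)) - potential c y = jump c y (l + 3) := by
    intro l hl y
    have h1 := hl (y + hexDir (l + 3))
    have h2 := jump_flip he (y + hexDir (l + 3)) l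
    rw [add_hexDir_three_add] at h1 h2
    omega
  have h0 := potential_add_zero hc he
  have h1 := potential_add_one hc
  have h2 : ∀ y, potential c (y + hexDir 2) - potential c y = jump c y 2 := by
    intro y
    obtain ⟨z, rfl⟩ : ∃ z, y = z + hexDir 0 := ⟨y - hexDir 0, by simp⟩
    have t := jump_triangle (c := c) z 0
    have f := jump_flip he z 1
    have a1 := h0 z
    have a2 := h1 z
    have p := (apex_eqs z 0).1
    simp only [zmod_six_add, zero_add] at *
    rw [p]
    omega
  have h3 := flip 0 h0
  have h4 := flip 1 h1
  have h5 := flip 2 h2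
  simp only [zmod_six_add, zero_add] at h3 h4 h5
  rcases zmod_six_cases k with rfl | rfl | rfl | rfl | rfl | rfl
  exacts [h0 x, h1 x, h2 x, h3 x, h4 x, h5 x]

theorem slack_potential (hc : ∀ x k, c x k ≠ 0 → Cell n x k)
    (he : ∀ x k, c x k - c (x + hexDir k) (k + 2) = c x (k + 5) - c (x + hexDir k) (k + 3))
    (x : ℤ × ℤ) (k : ZMod 6) : slack (potential c) x k =
      c (x + hexDir (k + 1)) (k + 4) + c (x + hexDir (k + 5)) (k + 1) - c x k -
        c (x + hexDir k) (k + 3) := by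
  have a := potential_sub hc he x
  have a0 := a k
  have a1 := a (k + 1)
  have a5 := a (k + 5)
  have e0 := he x k
  have e1 := he x (k + 1)
  have e5 := he x (k + 5)
  simp only [jump, slack, add_assoc k, zmod_six_add, add_zero] at *
  omega

theorem potential_left (hc : ∀ x k, c x k ≠ 0 → Cell n x k) (j : ℤ) : potential c (0, j) = 0 := by
  refine Finset.sum_eq_zero fun b _ => ?_
  refine jump_of_not_cell hc fun h => ?_
  have := h.2.2.1
  rw [zmod_six_add.1.1, hexDir_values.2.2.1] at this
  simp at this

theorem potential_diag (hc : ∀ x k, c x k ≠ 0 → Cell n x k)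
    (he : ∀ x k, c x k - c (x + hexDir k) (k + 2) = c x (k + 5) - c (x + hexDir k) (k + 3))
    (i : ℕ) : potential c (i, n - i) = 0 := by
  induction i with
  | zero => exact potential_left hc _
  | succ i ih =>
    have h := potential_sub hc he ((i + 1 : ℕ), n - (i + 1 : ℕ)) 2
    have v := hexDir_values.2.2.1
    rw [jump_of_not_cell' hc he] at h
    · rw [v] at h
      simp only [Prod.mk_add_mk] at h
      rw [show (((i + 1 : ℕ) : ℤ) + -1, n - ((i + 1 : ℕ) : ℤ) + 1) = ((i : ℤ), n - (i : ℤ)) by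
        push_cast; ext <;> ring, ih] at h
      omega
    · intro h'
      have := h'.2.1.2.2
      rw [zmod_six_add.2.1.2.2.2.2, hexDir_values.2.1] at this
      simp at this
      omega

end Potential

/-- A closed route in a hive yields a different hive with the same boundary. -/
theorem IsHive.exists_ne_of_stepN {n : ℤ} {h : ℤ × ℤ → ℤ} (hh : IsHive n h) {m : ℕ} {a : Move}
    (hm : 0 < m) (ha : StepN (Cell n) (edgeWeight n h) m a a) :
    ∃ h', IsHive n h' ∧ (∀ x, InTri n x → (x.1 = 0 ∨ x.2 = 0 ∨ x.1 + x.2 = n) → h' x = h x) ∧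
      ∃ x, InTri n x ∧ h' x ≠ h x := by
  obtain ⟨L, z, hz⟩ := exists_isShortCycle hm ha
  have hW := hh.isWeb
  set s := edgeWeight n h with hs
  have hc : ∀ x k, cornerCount s z x k ≠ 0 → Cell n x k := fun x k => hz.cell_of_cornerCount hW
  have he := hz.cornerCount_edge hW
  refine ⟨fun x => h x + potential (cornerCount s z) x, ?_, ?_, ?_⟩
  · intro x k h1 h2
    have e : slack (fun x => h x + potential (cornerCount s z) x) x k =
        slack h x k + slack (potential (cornerCount s z)) x k := by
      unfold slack; ring
    rw [e, slack_potential hc he]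
    have e1 : s x k = slack h x k := edgeWeight_of_cell h1 h2
    have c1 := cornerCount_mem (s := s) (z := z) x k
    have c2 := cornerCount_mem (s := s) (z := z) (x + hexDir k) (k + 3)
    have c3 := cornerCount_mem (s := s) (z := z) (x + hexDir (k + 1)) (k + 4)
    have c4 := cornerCount_mem (s := s) (z := z) (x + hexDir (k + 5)) (k + 1)
    have h0 := hh x k h1 h2
    have b0 := hz.cornerCount_le_of_eq_zero hW (x := x) (k := k)
    have b1 := hz.cornerCount_le_of_eq_one hW (x := x) (k := k)
    by_cases h0' : s x k = 0
    · have := b0 h0'; omega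
    · by_cases h1' : s x k = 1
      · have := b1 h1'; omega
      · omega
  · rintro ⟨i, j⟩ ⟨h1, h2, h3⟩ hb
    simp only at h1 h2 h3 hb ⊢
    suffices potential (cornerCount s z) (i, j) = 0 by omega
    rcases hb with rfl | rfl | hb
    · exact potential_left hc j
    · simp [potential]
    · lift i to ℕ using h1
      obtain rfl : j = n - i := by omega
      exact potential_diag hc he i
  · by_contra! hx
    refine hz.not_balanced hW fun x k => ?_
    by_cases hxk : Cell n x k
    · have h1 := hx _ hxk.1
      have h2 := hx _ hxk.2.1
      have h3 := potential_sub hc he x k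
      unfold jump at h3
      omega
    · have := jump_of_not_cell hc hxk
      unfold jump at this
      omega

end Hives

section Hives

/-- The determinant of two lattice vectors. -/
def cross (u v : ℤ × ℤ) : ℤ := u.1 * v.2 - u.2 * v.1

/-- The affine function agreeing with `h` at the vertices of the triangle `(x, k)`. -/
def plane (h : ℤ × ℤ → ℤ) (x : ℤ × ℤ) (k : ZMod 6) (p : ℤ × ℤ) : ℤ :=
  h x + cross (p - x) (hexDir (k + 1)) * (h (x + hexDir k) - h x) +
    cross (hexDir k) (p - x) * (h (x + hexDir (k + 1)) - h x)

theorem cross_hexDir (k : ZMod 6) : cross (hexDir k) (hexDir (k + 1)) = 1 := by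
  revert k; decide

theorem cross_combination (i j : ℤ) (k : ZMod 6) :
    cross (i • hexDir k + j • hexDir (k + 1)) (hexDir (k + 1)) = i ∧
    cross (hexDir k) (i • hexDir k + j • hexDir (k + 1)) = j := by
  have h := cross_hexDir k
  unfold cross at *
  simp only [Prod.fst_add, Prod.snd_add, Prod.smul_fst, Prod.smul_snd, smul_eq_mul]
  constructor
  · linear_combination i * h
  · linear_combination j * h

theorem eq_combination (v : ℤ × ℤ) (k : ZMod 6) :
    v = cross v (hexDir (k + 1)) • hexDir k + cross (hexDir k) v • hexDir (k + 1) := by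
  have h := cross_hexDir k
  unfold cross at *
  ext
  · simp only [Prod.fst_add, Prod.smul_fst, smul_eq_mul]
    linear_combination -v.1 * h
  · simp only [Prod.snd_add, Prod.smul_snd, smul_eq_mul]
    linear_combination -v.2 * h

theorem plane_rotate (h : ℤ × ℤ → ℤ) (x : ℤ × ℤ) (k : ZMod 6) (p : ℤ × ℤ) :
    plane h (x + hexDir k) (k + 2) p = plane h x k p := by
  have e := cross_hexDir k
  unfold plane
  rw [(apex_eqs x k).1, (dir_eqs k).2.2.2.2.2.2.2.2.2.2.2.2.2.2.1, add_hexDir_add_three,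
    hexDir_add_three, hexDir_add_two]
  unfold cross at *
  simp only [Prod.fst_add, Prod.snd_add, Prod.fst_sub, Prod.snd_sub, Prod.fst_neg, Prod.snd_neg]
  linear_combination (h x - h (x + hexDir k)) * e

theorem plane_before (h : ℤ × ℤ → ℤ) (x : ℤ × ℤ) (k : ZMod 6) (p : ℤ × ℤ) :
    plane h x (k + 5) p = plane h x k p + slack h x k * cross (hexDir k) (p - x) := by
  unfold plane slack
  rw [(dir_eqs k).2.2.2.2.2.2.2.2.2.2.1]
  have e : cross (hexDir (k + 5)) (p - x) =
      cross (hexDir k) (p - x) + cross (p - x) (hexDir (k + 1)) := by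
    rw [hexDir_add_five]
    unfold cross
    simp only [Prod.fst_sub, Prod.snd_sub]
    ring
  have e2 : cross (p - x) (hexDir k) = - cross (hexDir k) (p - x) := by
    unfold cross; ring
  rw [e, e2]
  ring

theorem InTri.of_cone {n : ℤ} {x : ℤ × ℤ} {k : ZMod 6} {i j a b : ℤ} (hx : InTri n x)
    (hp : InTri n (x + i • hexDir k + j • hexDir (k + 1))) (ha : 0 ≤ a) (hai : a ≤ i) (hb : 0 ≤ b)
    (hbj : b ≤ j) : InTri n (x + a • hexDir k + b • hexDir (k + 1)) := by
  obtain ⟨v0, v1, v2, v3, v4, v5⟩ := hexDir_values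
  rcases zmod_six_cases k with rfl | rfl | rfl | rfl | rfl | rfl <;>
  simp only [InTri, zmod_six_add, zero_add, v0, v1, v2, v3, v4, v5, Prod.fst_add,
    Prod.snd_add, Prod.smul_fst, Prod.smul_snd, smul_eq_mul] at * <;> omega

theorem InTri.of_line {n : ℤ} {x : ℤ × ℤ} {k : ZMod 6} {i a : ℤ} (hx : InTri n x)
    (hp : InTri n (x + i • hexDir k)) (ha : 0 ≤ a) (hai : a ≤ i) :
    InTri n (x + a • hexDir k) := by
  have := InTri.of_cone (k := k) (j := 0) (b := 0) hx (by simpa using hp) ha hai le_rfl le_rfl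
  simpa using this

namespace IsHive

variable {n : ℤ} {h : ℤ × ℤ → ℤ}

theorem add_le_two_mul (hh : IsHive n h) {y : ℤ × ℤ} {k : ZMod 6} (h0 : InTri n y)
    (h1 : InTri n (y + hexDir k)) (h2 : InTri n (y + hexDir (k + 3))) :
    h (y + hexDir k) + h (y + hexDir (k + 3)) ≤ 2 * h y := by
  have key : (InTri n (y + hexDir (k + 1)) ∧ InTri n (y + hexDir (k + 2))) ∨
      (InTri n (y + hexDir (k + 4)) ∧ InTri n (y + hexDir (k + 5))) := by
    obtain ⟨v0, v1, v2, v3, v4, v5⟩ := hexDir_values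
    rcases zmod_six_cases k with rfl | rfl | rfl | rfl | rfl | rfl <;>
    simp only [InTri, zmod_six_add, zero_add, add_zero, v0, v1, v2, v3, v4, v5, Prod.fst_add,
      Prod.snd_add] at * <;> omega
  rcases key with ⟨k1, k2⟩ | ⟨k4, k5⟩
  · have s1 := hh y (k + 1)
    have s2 := hh y (k + 2)
    simp only [Cell, slack, add_assoc k, zmod_six_add, add_zero, and_imp] at s1 s2
    have := s1 h0 k1 k2 h0 h1 k1
    have := s2 h0 k2 h2 h0 k1 k2
    omega
  · have s1 := hh y (k + 4)
    have s2 := hh y (k + 5)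
    simp only [Cell, slack, add_assoc k, zmod_six_add, add_zero, and_imp] at s1 s2
    have := s1 h0 k4 k5 h0 h2 k4
    have := s2 h0 k5 h1 h0 k4 k5
    omega

theorem le_of_nonneg (hh : IsHive n h) {x : ℤ × ℤ} {k : ZMod 6} (i : ℕ) (h0 : InTri n x)
    (hi : InTri n (x + (i : ℤ) • hexDir k)) :
    h (x + (i : ℤ) • hexDir k) ≤ h x + i * (h (x + hexDir k) - h x) := by
  have slope : ∀ j : ℕ, j < i →
      h (x + ((j + 1 : ℕ) : ℤ) • hexDir k) - h (x + (j : ℤ) • hexDir k) ≤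
        h (x + hexDir k) - h x := by
    intro j
    induction j with
    | zero => intro _; simp
    | succ j ih =>
      intro hj
      have a0 := InTri.of_line (a := (j : ℤ)) h0 hi (by omega) (by omega)
      have a1 := InTri.of_line (a := ((j + 1 : ℕ) : ℤ)) h0 hi (by omega) (by omega)
      have a2 := InTri.of_line (a := ((j + 1 + 1 : ℕ) : ℤ)) h0 hi (by omega) (by omega)
      have e2 : x + ((j + 1 + 1 : ℕ) : ℤ) • hexDir k =
          x + ((j + 1 : ℕ) : ℤ) • hexDir k + hexDir k := by
        push_cast; module
      have e0 : x + (j : ℤ) • hexDir k =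
          x + ((j + 1 : ℕ) : ℤ) • hexDir k + hexDir (k + 3) := by
        rw [hexDir_add_three]; push_cast; module
      have := ih (by omega)
      rw [e2] at a2 ⊢
      rw [e0] at a0 this
      have := hh.add_le_two_mul a1 a2 a0
      omega
  have : ∀ j : ℕ, j ≤ i → h (x + (j : ℤ) • hexDir k) ≤ h x + j * (h (x + hexDir k) - h x) := by
    intro j
    induction j with
    | zero => intro _; simp
    | succ j ih =>
      intro hj
      have := ih (by omega)
      have := slope j (by omega)
      push_cast at *
      linarith
  exact this i le_rfl

theorem le_line (hh : IsHive n h) {x : ℤ × ℤ} {k : ZMod 6} (i : ℤ) (h0 : InTri n x)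
    (h1 : InTri n (x + hexDir k)) (hi : InTri n (x + i • hexDir k)) :
    h (x + i • hexDir k) ≤ h x + i * (h (x + hexDir k) - h x) := by
  rcases le_or_gt 0 i with h' | h'
  · lift i to ℕ using h'
    exact hh.le_of_nonneg i h0 hi
  · obtain ⟨j, hj⟩ : ∃ j : ℕ, (j : ℤ) = 1 - i := ⟨(1 - i).toNat, by omega⟩
    have e : x + hexDir k + (j : ℤ) • hexDir (k + 3) = x + i • hexDir k := by
      rw [hexDir_add_three, hj]; module
    have := hh.le_of_nonneg (x := x + hexDir k) (k := k + 3) j h1 (by rwa [e])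
    rw [e, add_hexDir_add_three, hj] at this
    linarith

/-- The parallelogram inequality. -/
theorem add_le_add_of_cone (hh : IsHive n h) {x : ℤ × ℤ} {k : ZMod 6} (i j : ℕ) (hx : InTri n x)
    (hp : InTri n (x + (i : ℤ) • hexDir k + (j : ℤ) • hexDir (k + 1))) :
    h x + h (x + (i : ℤ) • hexDir k + (j : ℤ) • hexDir (k + 1)) ≤
      h (x + (i : ℤ) • hexDir k) + h (x + (j : ℤ) • hexDir (k + 1)) := by
  set D : ℕ → ℕ → ℤ := fun a b => h (x + (a : ℤ) • hexDir k + (b : ℤ) • hexDir (k + 1)) with hD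
  have unit : ∀ a b, a < i → b < j → D a b + D (a + 1) (b + 1) ≤ D (a + 1) b + D a (b + 1) := by
    intro a b ha hb
    have a00 := InTri.of_cone (a := (a : ℤ)) (b := (b : ℤ)) hx hp (by omega) (by omega) (by omega)
      (by omega)
    have a10 := InTri.of_cone (a := ((a + 1 : ℕ) : ℤ)) (b := (b : ℤ)) hx hp (by omega) (by omega)
      (by omega) (by omega)
    have a01 := InTri.of_cone (a := (a : ℤ)) (b := ((b + 1 : ℕ) : ℤ)) hx hp (by omega) (by omega)
      (by omega) (by omega)
    have a11 := InTri.of_cone (a := ((a + 1 : ℕ) : ℤ)) (b := ((b + 1 : ℕ) : ℤ)) hx hp (by omega)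
      (by omega) (by omega) (by omega)
    simp only [hD]
    set y := x + (a : ℤ) • hexDir k + (b : ℤ) • hexDir (k + 1) with hy
    have e10 : x + ((a + 1 : ℕ) : ℤ) • hexDir k + (b : ℤ) • hexDir (k + 1) = y + hexDir k := by
      rw [hy]; push_cast; module
    have e01 : x + (a : ℤ) • hexDir k + ((b + 1 : ℕ) : ℤ) • hexDir (k + 1) =
        y + hexDir (k + 1) := by
      rw [hy]; push_cast; module
    have e11 : x + ((a + 1 : ℕ) : ℤ) • hexDir k + ((b + 1 : ℕ) : ℤ) • hexDir (k + 1) =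
        y + hexDir k + hexDir (k + 1) := by
      rw [hy]; push_cast; module
    rw [e10] at a10 ⊢
    rw [e01] at a01 ⊢
    rw [e11] at a11 ⊢
    have s := hh (y + hexDir k) (k + 2)
    simp only [Cell, slack, add_assoc k, zmod_six_add, and_imp] at s
    rw [(apex_eqs y k).1, add_hexDir_add_three] at s
    have := s a10 a01 a00 a10 a11 a01
    omega
  have row : ∀ b, b < j → ∀ a, a ≤ i → D 0 b + D a (b + 1) ≤ D a b + D 0 (b + 1) := by
    intro b hb a
    induction a with
    | zero => intro _; omega
    | succ a ih =>
      intro ha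
      have := ih (by omega)
      have := unit a b (by omega) hb
      omega
  have all : ∀ b, b ≤ j → D 0 0 + D i b ≤ D i 0 + D 0 b := by
    intro b
    induction b with
    | zero => intro _; omega
    | succ b ih =>
      intro hb
      have := ih (by omega)
      have := row b (by omega) i le_rfl
      omega
  simpa [hD] using all j le_rfl

/-- A hive lies below the affine extension of its restriction to any unit triangle, at points
in the two opposite cones at a vertex of that triangle. -/
theorem le_plane_of_cone (hh : IsHive n h) {x : ℤ × ℤ} {k : ZMod 6} (hc : Cell n x k) {i j : ℤ}
    (hp : InTri n (x + i • hexDir k + j • hexDir (k + 1)))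
    (hij : (0 ≤ i ∧ 0 ≤ j) ∨ (i ≤ 0 ∧ j ≤ 0)) :
    h (x + i • hexDir k + j • hexDir (k + 1)) ≤
      h x + i * (h (x + hexDir k) - h x) + j * (h (x + hexDir (k + 1)) - h x) := by
  rcases hij with ⟨hi, hj⟩ | ⟨hi, hj⟩
  · lift i to ℕ using hi
    lift j to ℕ using hj
    have a1 := InTri.of_cone (a := (i : ℤ)) (b := 0) hc.1 hp (by omega) le_rfl le_rfl (by omega)
    have a2 := InTri.of_cone (a := 0) (b := (j : ℤ)) hc.1 hp (by omega) (by omega) (by omega) le_rfl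
    simp only [zero_smul, add_zero] at a1 a2
    have l1 := hh.le_line _ hc.1 hc.2.1 a1
    have l2 := hh.le_line _ hc.1 hc.2.2 a2
    have := hh.add_le_add_of_cone i j hc.1 hp
    linarith
  · obtain ⟨i', hi'⟩ : ∃ i' : ℕ, (i' : ℤ) = -i := ⟨(-i).toNat, by omega⟩
    obtain ⟨j', hj'⟩ : ∃ j' : ℕ, (j' : ℤ) = -j := ⟨(-j).toNat, by omega⟩
    have e1 : ∀ y, y + i • hexDir k = y + (i' : ℤ) • hexDir (k + 3) := by
      intro y; rw [hexDir_add_three, hi']; module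
    have e2 : ∀ y, y + j • hexDir (k + 1) = y + (j' : ℤ) • hexDir (k + 3 + 1) := by
      intro y
      rw [(dir_eqs k).2.2.2.2.2.2.2.2.1, hexDir_add_four, hj']; module
    rw [e1, e2] at hp
    have a1 := InTri.of_cone (a := (i' : ℤ)) (b := 0) hc.1 hp (by omega) le_rfl le_rfl (by omega)
    have a2 := InTri.of_cone (a := 0) (b := (j' : ℤ)) hc.1 hp (by omega) (by omega) (by omega)
      le_rfl
    have := hh.add_le_add_of_cone i' j' hc.1 hp
    simp only [zero_smul, add_zero] at a1 a2
    rw [← e1] at a1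
    rw [← e2] at a2
    rw [← e1, ← e2, ← e2] at this
    have l1 := hh.le_line _ hc.1 hc.2.1 a1
    have l2 := hh.le_line _ hc.1 hc.2.2 a2
    linarith

/-- A hive lies below the affine extension of its restriction to any unit triangle. -/
theorem le_plane (hh : IsHive n h) {x : ℤ × ℤ} {k : ZMod 6} (hc : Cell n x k) {p : ℤ × ℤ}
    (hp : InTri n p) : h p ≤ plane h x k p := by
  have key : ∀ (y : ℤ × ℤ) (l : ZMod 6), Cell n y l →
      ((0 ≤ cross (p - y) (hexDir (l + 1)) ∧ 0 ≤ cross (hexDir l) (p - y)) ∨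
        (cross (p - y) (hexDir (l + 1)) ≤ 0 ∧ cross (hexDir l) (p - y) ≤ 0)) →
      h p ≤ plane h y l p := by
    intro y l hl hs
    have e : y + cross (p - y) (hexDir (l + 1)) • hexDir l +
        cross (hexDir l) (p - y) • hexDir (l + 1) = p := by
      rw [add_assoc, ← eq_combination]; abel
    have := hh.le_plane_of_cone hl (by rwa [e]) hs
    rwa [e] at this
  have c1 := hc
  rw [← cell_rotate] at c1
  have c2 := c1
  rw [← cell_rotate] at c2
  have k0 := key _ _ hc
  have k1 := key _ _ c1
  have k2 := key _ _ c2
  rw [plane_rotate] at k1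
  rw [plane_rotate, plane_rotate] at k2
  have e := cross_hexDir k
  simp only [add_assoc, zmod_six_add] at k1 k2
  have e1 : cross (p - (x + hexDir k)) (hexDir (k + 3)) = cross (hexDir k) (p - x) := by
    rw [hexDir_add_three]; unfold cross
    simp only [Prod.fst_sub, Prod.snd_sub, Prod.fst_add, Prod.snd_add, Prod.fst_neg, Prod.snd_neg]
    ring
  have e2 : cross (hexDir (k + 2)) (p - (x + hexDir k)) =
      1 - cross (p - x) (hexDir (k + 1)) - cross (hexDir k) (p - x) := by
    rw [hexDir_add_two]; unfold cross at *
    simp only [Prod.fst_sub, Prod.snd_sub, Prod.fst_add, Prod.snd_add]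
    linear_combination e
  have e3 : cross (p - (x + (hexDir k + hexDir (k + 2)))) (hexDir (k + 5)) =
      1 - cross (p - x) (hexDir (k + 1)) - cross (hexDir k) (p - x) := by
    rw [hexDir_add_two, hexDir_add_five]; unfold cross at *
    simp only [Prod.fst_sub, Prod.snd_sub, Prod.fst_add, Prod.snd_add]
    linear_combination e
  have e4 : cross (hexDir (k + 4)) (p - (x + (hexDir k + hexDir (k + 2)))) =
      cross (p - x) (hexDir (k + 1)) := by
    rw [hexDir_add_two, hexDir_add_four]; unfold cross
    simp only [Prod.fst_sub, Prod.snd_sub, Prod.fst_add, Prod.snd_add, Prod.fst_neg, Prod.snd_neg]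
    ring
  rw [e1, e2] at k1
  rw [e3, e4] at k2
  by_contra hlt
  have := mt k0 hlt
  have := mt k1 hlt
  have := mt k2 hlt
  omega

end IsHive
end Hives

section Hives

/-- `p` lies in the region of linearity of `h` containing the triangle `(x, k)`. -/
def Face (n : ℤ) (h : ℤ × ℤ → ℤ) (x : ℤ × ℤ) (k : ZMod 6) (p : ℤ × ℤ) : Prop :=
  InTri n p ∧ h p = plane h x k p

/-- `p` lies on the segment of linearity of `h` containing the edge `(x, k)`. -/
def Side (n : ℤ) (h : ℤ × ℤ → ℤ) (x : ℤ × ℤ) (k : ZMod 6) (p : ℤ × ℤ) : Prop :=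
  cross (hexDir k) (p - x) = 0 ∧ Face n h x k p

/-- The boundary of the triangle of side `n`. -/
def OnBorder (n : ℤ) (x : ℤ × ℤ) : Prop := x.1 = 0 ∨ x.2 = 0 ∨ x.1 + x.2 = n

variable {n : ℤ} {h H : ℤ × ℤ → ℤ} {x p q : ℤ × ℤ} {k : ZMod 6}

theorem plane_self : plane h x k x = h x := by
  simp [plane, cross]

theorem face_rotate : Face n h (x + hexDir k) (k + 2) p ↔ Face n h x k p := by
  unfold Face; rw [plane_rotate]

theorem face_self (hx : InTri n x) : Face n h x k x := ⟨hx, plane_self.symm⟩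

theorem side_self (hx : InTri n x) : Side n h x k x := by
  refine ⟨by simp [cross], face_self hx⟩

theorem side_iff_before :
    Side n h x k p ↔ cross (hexDir k) (p - x) = 0 ∧ Face n h x (k + 5) p := by
  unfold Side Face
  rw [plane_before]
  constructor
  · rintro ⟨h1, h2, h3⟩
    exact ⟨h1, h2, by rw [h1, h3]; ring⟩
  · rintro ⟨h1, h2, h3⟩
    refine ⟨h1, h2, ?_⟩
    rw [h1] at h3
    linarith

theorem cross_flip (x p : ℤ × ℤ) (k : ZMod 6) :
    cross (hexDir (k + 3)) (p - (x + hexDir k)) = - cross (hexDir k) (p - x) := by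
  rw [hexDir_add_three]
  unfold cross
  simp only [Prod.fst_sub, Prod.snd_sub, Prod.fst_add, Prod.snd_add, Prod.fst_neg, Prod.snd_neg]
  ring

theorem side_flip : Side n h (x + hexDir k) (k + 3) p ↔ Side n h x k p := by
  rw [side_iff_before, (dir_eqs k).2.2.2.2.2.1, face_rotate, cross_flip, neg_eq_zero]
  rfl

/-- Lattice points on a border edge line are border points. -/
theorem onBorder_of_not_cell (hx : InTri n x) (hxk : InTri n (x + hexDir k))
    (hc : ¬ (Cell n x k ∧ Cell n x (k + 5))) (hp : InTri n p)
    (hq : cross (hexDir k) (p - x) = 0) : OnBorder n p := by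
  obtain ⟨v0, v1, v2, v3, v4, v5⟩ := hexDir_values
  unfold cross at hq
  rcases zmod_six_cases k with rfl | rfl | rfl | rfl | rfl | rfl <;>
  simp only [OnBorder, Cell, InTri, zmod_six_add, zero_add, v0, v1, v2, v3, v4, v5,
    Prod.fst_add, Prod.snd_add, Prod.fst_sub, Prod.snd_sub] at * <;> omega

theorem cross_nonneg_of_border (hc : Cell n x k) (hc5 : ¬ Cell n x (k + 5)) (hp : InTri n p) :
    0 ≤ cross (hexDir k) (p - x) := by
  obtain ⟨v0, v1, v2, v3, v4, v5⟩ := hexDir_values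
  unfold cross
  rcases zmod_six_cases k with rfl | rfl | rfl | rfl | rfl | rfl <;>
  simp only [Cell, InTri, zmod_six_add, zero_add, v0, v1, v2, v3, v4, v5,
    Prod.fst_add, Prod.snd_add, Prod.fst_sub, Prod.snd_sub] at * <;> omega

theorem edgeWeight_eq_zero (hs : edgeWeight n h x k = 0) :
    Cell n x k ∧ Cell n x (k + 5) ∧ slack h x k = 0 := by
  unfold edgeWeight at hs
  split_ifs at hs with hc
  · exact ⟨hc.1, hc.2, hs⟩
  · norm_num at hs

theorem face_flat (hs : edgeWeight n h x k = 0) : Face n h x (k + 5) p ↔ Face n h x k p := by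
  unfold Face
  rw [plane_before, (edgeWeight_eq_zero hs).2.2, zero_mul, add_zero]

theorem face_flat_succ (hs : edgeWeight n h x (k + 1) = 0) :
    Face n h x (k + 1) p ↔ Face n h x k p := by
  rw [← face_flat hs, (dir_eqs k).2.2.2.2.1]

namespace IsHive

theorem cross_nonneg_of_face (hh : IsHive n h) (hc : Cell n x k) (hs : edgeWeight n h x k ≠ 0)
    (hp : Face n h x k p) : 0 ≤ cross (hexDir k) (p - x) := by
  by_cases hc5 : Cell n x (k + 5)
  · rw [edgeWeight_of_cell hc hc5] at hs
    have h1 := hh x k hc hc5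
    have h2 := hh.le_plane hc5 hp.1
    rw [plane_before, ← hp.2] at h2
    have : 0 < slack h x k := by omega
    nlinarith
  · exact cross_nonneg_of_border hc hc5 hp.1

theorem cross_nonneg_of_face_succ (hh : IsHive n h) (hc : Cell n x k)
    (hs : edgeWeight n h x (k + 1) ≠ 0) (hp : Face n h x k p) :
    0 ≤ cross (p - x) (hexDir (k + 1)) := by
  have e : x + hexDir k + hexDir (k + 2) = x + hexDir (k + 1) := (apex_eqs x k).1
  have e4 : k + 2 + 2 = k + 4 := (dir_eqs k).2.2.2.2.2.2.2.2.2.2.2.2.1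
  have c2 : Cell n (x + hexDir (k + 1)) (k + 4) := by
    rwa [← e, ← e4, cell_rotate, cell_rotate]
  have f2 : Face n h (x + hexDir (k + 1)) (k + 4) p := by
    rwa [← e, ← e4, face_rotate, face_rotate]
  have s2 : edgeWeight n h (x + hexDir (k + 1)) (k + 4) ≠ 0 := by
    have := hh.isWeb.symm x (k + 1)
    rw [(dir_eqs k).2.2.2.2.2.2.2.2.2.2.2.2.2.2.2.1] at this
    rwa [this]
  have := hh.cross_nonneg_of_face c2 s2 f2
  rw [hexDir_add_four] at this
  unfold cross at *
  simp only [Prod.fst_sub, Prod.snd_sub, Prod.fst_add, Prod.snd_add, Prod.fst_neg,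
    Prod.snd_neg] at *
  linarith

/-- Projecting a point of a face onto two strict sides of a corner. -/
theorem face_parallelogram (hh : IsHive n h) (hH : IsHive n H) (hc : Cell n x k)
    (hs : edgeWeight n h x k ≠ 0) (hs1 : edgeWeight n h x (k + 1) ≠ 0) (hp : Face n h x k p) :
    ∃ q r, Side n h x k q ∧ Side n h x (k + 1) r ∧ h x + h p = h q + h r ∧
      H x + H p ≤ H q + H r := by
  have hj := hh.cross_nonneg_of_face hc hs hp
  have hi := hh.cross_nonneg_of_face_succ hc hs1 hp
  have hpl := hp.2
  unfold plane at hpl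
  have hxp : x + cross (p - x) (hexDir (k + 1)) • hexDir k +
      cross (hexDir k) (p - x) • hexDir (k + 1) = p := by
    rw [add_assoc, ← eq_combination]; abel
  generalize cross (p - x) (hexDir (k + 1)) = i at *
  generalize cross (hexDir k) (p - x) = j at *
  subst hxp
  lift i to ℕ using hi
  lift j to ℕ using hj
  have a1 := InTri.of_cone (a := (i : ℤ)) (b := 0) hc.1 hp.1 (by omega) le_rfl le_rfl (by omega)
  have a2 := InTri.of_cone (a := 0) (b := (j : ℤ)) hc.1 hp.1 (by omega) (by omega) (by omega) le_rfl
  simp only [zero_smul, add_zero] at a1 a2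
  have l1 := hh.le_line _ hc.1 hc.2.1 a1
  have l2 := hh.le_line _ hc.1 hc.2.2 a2
  have l3 := hh.add_le_add_of_cone i j hc.1 hp.1
  have l4 := hH.add_le_add_of_cone i j hc.1 hp.1
  have e := cross_hexDir k
  refine ⟨_, _, ⟨?_, a1, ?_⟩, side_iff_before.2 ⟨?_, a2, ?_⟩, by linarith, l4⟩
  · simp [cross]; ring
  · have e1 : cross (x + (i : ℤ) • hexDir k - x) (hexDir (k + 1)) = i := by
      simpa using (cross_combination i 0 k).1
    have e2 : cross (hexDir k) (x + (i : ℤ) • hexDir k - x) = 0 := by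
      simpa using (cross_combination i 0 k).2
    rw [plane, e1, e2]
    linarith
  · simp [cross]; ring
  · rw [(dir_eqs k).2.2.2.2.1]
    have e1 : cross (x + (j : ℤ) • hexDir (k + 1) - x) (hexDir (k + 1)) = 0 := by
      simpa using (cross_combination 0 j k).1
    have e2 : cross (hexDir k) (x + (j : ℤ) • hexDir (k + 1) - x) = j := by
      simpa using (cross_combination 0 j k).2
    rw [plane, e1, e2]
    linarith

/-- Completing points on two strict sides of a `120°` corner to a parallelogram. -/
theorem face_complete (hh : IsHive n h) (hH : IsHive n H) (hc : Cell n x k)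
    (hs : edgeWeight n h x k ≠ 0) (hs1 : edgeWeight n h x (k + 1) = 0)
    (hs2 : edgeWeight n h x (k + 2) ≠ 0) {r : ℤ × ℤ} (hq : Side n h x k q)
    (hr : Side n h x (k + 2) r) :
    ∃ p, Face n h x (k + 1) p ∧ h x + h p = h q + h r ∧ H q + H r ≤ H x + H p := by
  have e11 : k + 1 + 1 = k + 2 := (dir_eqs k).2.2.2.2.2.2.2.2.2.2.2.2.2.1
  have hrf : Face n h x k r := by
    have := (side_iff_before.1 hr).2
    rw [(dir_eqs k).2.2.2.1] at this
    rwa [← face_flat_succ hs1]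
  have hqf : Face n h x (k + 1) q := (face_flat_succ hs1).2 hq.2
  have c1 := (edgeWeight_eq_zero hs1).1
  have hj := hh.cross_nonneg_of_face hc hs hrf
  have hi := hh.cross_nonneg_of_face_succ c1 (by rwa [e11]) hqf
  rw [e11] at hi
  have e := cross_hexDir k
  have hq0 := hq.1
  have hr0 := hr.1
  have hu := hexDir_add_two k
  have hqx : x + cross (q - x) (hexDir (k + 2)) • hexDir k = q := by
    conv_rhs => rw [← add_sub_cancel x q, eq_combination (q - x) k, hq0]
    rw [zero_smul, add_zero]
    congr 2
    rw [hu]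
    unfold cross at *
    simp only [Prod.fst_sub, Prod.snd_sub] at *
    linarith
  have hrx : x + cross (hexDir k) (r - x) • hexDir (k + 2) = r := by
    have e2 : cross (r - x) (hexDir (k + 1)) = - cross (hexDir k) (r - x) := by
      rw [hu] at hr0
      unfold cross at *
      simp only [Prod.fst_sub, Prod.snd_sub] at *
      linarith
    conv_rhs => rw [← add_sub_cancel x r, eq_combination (r - x) k, e2]
    rw [hu]; module
  generalize cross (q - x) (hexDir (k + 2)) = i at *
  generalize cross (hexDir k) (r - x) = j at *
  subst hqx hrx
  lift i to ℕ using hi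
  lift j to ℕ using hj
  set p := x + (i : ℤ) • hexDir k + (j : ℤ) • hexDir (k + 2) with hp
  have tp : InTri n p := by
    have t1 := hq.2.1
    have t2 := hr.2.1
    have t0 := hc.1
    rw [hp]
    clear * - t0 t1 t2
    obtain ⟨v0, v1, v2, v3, v4, v5⟩ := hexDir_values
    rcases zmod_six_cases k with rfl | rfl | rfl | rfl | rfl | rfl <;>
    simp only [InTri, zmod_six_add, zero_add, v0, v1, v2, v3, v4, v5, Prod.fst_add,
      Prod.snd_add, Prod.smul_fst, Prod.smul_snd, smul_eq_mul] at * <;> omega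
  have er : x + (i : ℤ) • hexDir k + (j : ℤ) • hexDir (k + 2) + (i : ℤ) • hexDir (k + 3) =
      x + (j : ℤ) • hexDir (k + 2) := by
    rw [hexDir_add_three]; module
  have ex : x + (i : ℤ) • hexDir k + (i : ℤ) • hexDir (k + 3) = x := by
    rw [hexDir_add_three]; module
  have par : ∀ g, IsHive n g → g (x + (i : ℤ) • hexDir k) + g (x + (j : ℤ) • hexDir (k + 2)) ≤
      g p + g x := by
    intro g hg
    have := hg.add_le_add_of_cone (x := x + (i : ℤ) • hexDir k) (k := k + 2) j i hq.2.1
      (by rw [(dir_eqs k).2.2.2.2.2.2.2.2.2.2.2.2.2.2.1, er]; exact hr.2.1)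
    rwa [(dir_eqs k).2.2.2.2.2.2.2.2.2.2.2.2.2.2.1, er, ex, ← hp] at this
  have p1 := par h hh
  have p2 := par H hH
  have pl : plane h x (k + 1) p + h x = plane h x (k + 1) (x + (i : ℤ) • hexDir k) +
      plane h x (k + 1) (x + (j : ℤ) • hexDir (k + 2)) := by
    rw [hp]
    unfold plane cross
    simp only [Prod.fst_sub, Prod.snd_sub, Prod.fst_add, Prod.snd_add, Prod.smul_fst,
      Prod.smul_snd]
    ring
  have hrf1 := (face_flat_succ hs1).2 hrf
  rw [← hqf.2, ← hrf1.2] at pl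
  have lp := hh.le_plane c1 tp
  exact ⟨p, ⟨tp, by linarith⟩, by linarith, by linarith⟩

end IsHive
end Hives

section Hives

/-- Two hives of which the first, scaled by `N`, agrees with the second on the border. -/
structure Comparable (n N : ℤ) (h H : ℤ × ℤ → ℤ) : Prop where
  fst : IsHive n h
  snd : IsHive n H
  border : ∀ x, InTri n x → OnBorder n x → H x = N * h x

variable {n N : ℤ} {h H : ℤ × ℤ → ℤ} {x p q : ℤ × ℤ} {k : ZMod 6}

/-- All four edges at `x` other than the edges in directions `k` and `k + 3` are flat. -/
def Straight (n : ℤ) (h : ℤ × ℤ → ℤ) (x : ℤ × ℤ) (k : ZMod 6) : Prop :=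
  edgeWeight n h x (k + 1) = 0 ∧ edgeWeight n h x (k + 2) = 0 ∧ edgeWeight n h x (k + 4) = 0 ∧
    edgeWeight n h x (k + 5) = 0

/-- The moves along which the difference `H - N * h` grows. -/
def Move.Positive (n N : ℤ) (h H : ℤ × ℤ → ℤ) : Move → Prop
  | .turn x k => (Move.turn x k).Valid (Cell n) (edgeWeight n h) ∧ ¬ Straight n h x k ∧
      ∃ q, Side n h x k q ∧ H x - N * h x < H q - N * h q
  | .walk x k => (Move.walk x k).Valid (Cell n) (edgeWeight n h) ∧
      ∃ p, Face n h x (k + 5) p ∧ ∀ q, Side n h x k q → H q - N * h q < H p - N * h p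

namespace Comparable

theorem gap_of_side (hc : Comparable n N h H) (hx : InTri n x) (hxk : InTri n (x + hexDir k))
    (hb : ¬ (Cell n x k ∧ Cell n x (k + 5))) (hq : Side n h x k q) :
    H x - N * h x = 0 ∧ H q - N * h q = 0 := by
  have b1 := onBorder_of_not_cell hx hxk hb hx (by simp [cross])
  have b2 := onBorder_of_not_cell hx hxk hb hq.2.1 hq.1
  rw [hc.border _ hx b1, hc.border _ hq.2.1 b2]
  simp

theorem positive_turn (hc : Comparable n N h H) (hs : edgeWeight n h x k ≠ 0)
    (hC : Cell n x (k + 5)) (h2 : ¬ Straight n h x k) (hq : Side n h x k q)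
    (hlt : H x - N * h x < H q - N * h q) : (Move.turn x k).Positive n N h H := by
  refine ⟨?_, h2, q, hq, hlt⟩
  by_cases hCk : Cell n x k
  · exact ⟨hs, hCk, hC⟩
  · have := hC.2.2
    rw [(dir_eqs k).2.2.2.2.2.2.2.2.2.2.1] at this
    have := hc.gap_of_side hC.1 this (by tauto) hq
    omega

theorem exists_step_walk (hc : Comparable n N h H)
    (ha : (Move.walk (x + hexDir k) (k + 3)).Positive n N h H) :
    ∃ b : Move, b.Positive n N h H ∧
      Move.Step (Cell n) (edgeWeight n h) (.walk (x + hexDir k) (k + 3)) b := by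
  obtain ⟨hv, p, hp, hq⟩ := ha
  have hW := hc.fst.isWeb
  suffices ∃ b : Move, b.Positive n N h H ∧ FollowsWalk (edgeWeight n h) x k b by
    obtain ⟨b, hb, hf⟩ := this
    refine ⟨b, hb, step_walk_iff.2 ⟨hv, ?_, hf⟩⟩
    cases b <;> exact hb.1
  obtain ⟨hs, hC⟩ := hv
  rw [hW.symm] at hs
  rw [(dir_eqs k).2.2.2.2.2.1, cell_rotate] at hC
  rw [(dir_eqs k).2.2.2.2.2.1, face_rotate] at hp
  simp only [side_flip] at hq
  have hqx := hq x (side_self hC.1)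
  by_cases h1 : edgeWeight n h x (k + 1) = 0
  · have C1 := (edgeWeight_eq_zero h1).1
    by_cases h2 : edgeWeight n h x (k + 2) = 0
    · have C2 := (edgeWeight_eq_zero h2).1
      have h3 : edgeWeight n h x (k + 3) ≠ 0 := by
        intro h3
        have C3 := (edgeWeight_eq_zero h3).1
        have := hW.closure_at (x := x) (k := k + 1)
          (by simpa only [add_assoc k, zmod_six_add, add_zero] using ⟨C1, C2, C3, hC⟩) k
        have := hW.nonneg x (k + 4)
        have := hW.nonneg x (k + 5)
        omega
      refine ⟨.walk x (k + 3), ⟨⟨h3, ?_⟩, p, ?_, ?_⟩, Or.inr (Or.inr ⟨h1, h2, h3, rfl⟩)⟩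
      · rwa [(dir_eqs k).2.2.2.2.2.1]
      · rw [(dir_eqs k).2.2.2.2.2.1, ← (dir_eqs k).2.2.2.2.2.2.2.2.2.2.2.2.2.1]
        rw [face_flat_succ (by rwa [(dir_eqs k).2.2.2.2.2.2.2.2.2.2.2.2.2.1]), face_flat_succ h1]
        exact hp
      · intro q hq'
        refine hq q ?_
        rw [side_iff_before, (dir_eqs k).2.2.2.2.2.1,
          ← (dir_eqs k).2.2.2.2.2.2.2.2.2.2.2.2.2.1] at hq'
        rw [face_flat_succ (by rwa [(dir_eqs k).2.2.2.2.2.2.2.2.2.2.2.2.2.1]),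
          face_flat_succ h1] at hq'
        refine ⟨?_, hq'.2⟩
        have := hq'.1
        rw [hexDir_add_three] at this
        unfold cross at *
        simp only [Prod.fst_neg, Prod.snd_neg] at this
        linarith
    · by_cases hpos : (Move.walk x (k + 2)).Positive n N h H
      · exact ⟨_, hpos, Or.inr (Or.inl ⟨h1, h2, Or.inr rfl⟩)⟩
      · have hv2 : (Move.walk x (k + 2)).Valid (Cell n) (edgeWeight n h) :=
          ⟨h2, by rwa [(dir_eqs k).2.2.2.1]⟩
        have : ∃ q, Side n h x (k + 2) q ∧ H p - N * h p ≤ H q - N * h q := by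
          by_contra hcon
          push Not at hcon
          refine hpos ⟨hv2, p, ?_, hcon⟩
          rw [(dir_eqs k).2.2.2.1, face_flat_succ h1]
          exact hp
        obtain ⟨r, hr, hle⟩ := this
        refine ⟨.turn x (k + 2), ?_, Or.inr (Or.inl ⟨h1, h2, Or.inl rfl⟩)⟩
        refine hc.positive_turn h2 (by rwa [(dir_eqs k).2.2.2.1]) ?_ hr (by omega)
        rintro ⟨-, -, h0, -⟩
        simp only [add_assoc k, zmod_six_add, add_zero] at h0
        exact hs h0
  · obtain ⟨q, r, hq1, hr, e1, e2⟩ := hc.fst.face_parallelogram hc.snd hC hs h1 hp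
    have := hq q hq1
    have e3 : N * h x + N * h p = N * h q + N * h r := by
      rw [← mul_add, e1, mul_add]
    refine ⟨.turn x (k + 1), ?_, Or.inl ⟨h1, rfl⟩⟩
    refine hc.positive_turn h1 (by rwa [(dir_eqs k).2.2.2.2.1]) ?_ hr (by omega)
    rintro ⟨-, -, -, h0⟩
    simp only [add_assoc k, zmod_six_add, add_zero] at h0
    exact hs h0

theorem exists_max_side (hx : InTri n x) (g : ℤ × ℤ → ℤ) :
    ∃ r, Side n h x k r ∧ ∀ q, Side n h x k q → g q ≤ g r := by
  have hfin : {q | Side n h x k q}.Finite := by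
    refine (Set.finite_Icc ((0 : ℤ), (0 : ℤ)) (n, n)).subset ?_
    rintro q ⟨-, ⟨h1, h2, h3⟩, -⟩
    simp only [Set.mem_Icc, Prod.le_def]
    refine ⟨⟨h1, h2⟩, ?_, ?_⟩ <;> omega
  obtain ⟨r, hr, hm⟩ := Set.exists_max_image _ g hfin ⟨x, side_self hx⟩
  exact ⟨r, hr, hm⟩

theorem exists_step_turn (hc : Comparable n N h H)
    (ha : (Move.turn x k).Positive n N h H) :
    ∃ b : Move, b.Positive n N h H ∧ Move.Step (Cell n) (edgeWeight n h) (.turn x k) b := by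
  obtain ⟨hv, h2s, q, hq, hlt⟩ := ha
  have hW := hc.fst.isWeb
  suffices ∃ b : Move, b.Positive n N h H ∧ FollowsTurn (edgeWeight n h) x k b by
    obtain ⟨b, hb, hf⟩ := this
    refine ⟨b, hb, step_turn_iff.2 ⟨hv, ?_, hf⟩⟩
    cases b <;> exact hb.1
  obtain ⟨hs, hC, hC5⟩ := hv
  by_cases h1 : edgeWeight n h x (k + 1) = 0
  · have C1 := (edgeWeight_eq_zero h1).1
    have h2 : edgeWeight n h x (k + 2) ≠ 0 := by
      intro h2
      have C2 := (edgeWeight_eq_zero h2).1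
      have := hW.closure_at (x := x) (k := k) ⟨hC, C1, C2, hC5⟩ k
      have := hW.nonneg x (k + 4)
      have := hW.nonneg x (k + 5)
      exact h2s ⟨h1, h2, by omega, by omega⟩
    obtain ⟨r, hr, hmax⟩ := exists_max_side (h := h) (k := k + 2) hC.1 (fun q => H q - N * h q)
    obtain ⟨p, hp, e1, e2⟩ := hc.fst.face_complete hc.snd hC hs h1 h2 hq hr
    have e3 : N * h x + N * h p = N * h q + N * h r := by
      rw [← mul_add, e1, mul_add]
    refine ⟨.walk x (k + 2), ⟨⟨h2, ?_⟩, p, ?_, ?_⟩, Or.inr ⟨h1, h2, rfl⟩⟩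
    · rwa [(dir_eqs k).2.2.2.1]
    · rwa [(dir_eqs k).2.2.2.1]
    · intro q' hq'
      have := hmax q' hq'
      omega
  · by_cases hpos : (Move.walk x (k + 1)).Positive n N h H
    · exact ⟨_, hpos, Or.inl ⟨h1, Or.inr rfl⟩⟩
    · have : ∃ r, Side n h x (k + 1) r ∧ H q - N * h q ≤ H r - N * h r := by
        by_contra hcon
        push Not at hcon
        refine hpos ⟨⟨h1, by rwa [(dir_eqs k).2.2.2.2.1]⟩, q, ?_, hcon⟩
        rw [(dir_eqs k).2.2.2.2.1]
        exact hq.2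
      obtain ⟨r, hr, hle⟩ := this
      refine ⟨.turn x (k + 1), ?_, Or.inl ⟨h1, Or.inl rfl⟩⟩
      refine hc.positive_turn h1 (by rwa [(dir_eqs k).2.2.2.2.1]) ?_ hr (by omega)
      rintro ⟨-, -, -, h0⟩
      simp only [add_assoc k, zmod_six_add, add_zero] at h0
      exact hs h0

theorem exists_step (hc : Comparable n N h H) {a : Move} (ha : a.Positive n N h H) :
    ∃ b : Move, b.Positive n N h H ∧ Move.Step (Cell n) (edgeWeight n h) a b := by
  cases a with
  | turn x k => exact hc.exists_step_turn ha
  | walk y l =>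
    obtain ⟨x, k, e⟩ := exists_walk_eq y l
    rw [e] at ha ⊢
    exact hc.exists_step_walk ha

theorem finite_positive : {a : Move | a.Positive n N h H}.Finite := by
  have hfin : {x | InTri n x}.Finite := by
    refine (Set.finite_Icc ((0 : ℤ), (0 : ℤ)) (n, n)).subset ?_
    rintro q ⟨h1, h2, h3⟩
    simp only [Set.mem_Icc, Prod.le_def]
    refine ⟨⟨h1, h2⟩, ?_, ?_⟩ <;> omega
  have h2 := hfin.prod (Set.finite_univ (α := ZMod 6))
  refine ((h2.image fun y => Move.turn y.1 y.2).union (h2.image fun y => Move.walk y.1 y.2)).subset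
    ?_
  intro a ha
  cases a with
  | turn x k => exact Or.inl ⟨(x, k), ⟨ha.1.2.1.1, trivial⟩, rfl⟩
  | walk x k => exact Or.inr ⟨(x, k), ⟨ha.1.2.1, trivial⟩, rfl⟩

theorem exists_stepN (hc : Comparable n N h H) {a : Move} (ha : a.Positive n N h H) :
    ∃ (m : ℕ) (b : Move), 0 < m ∧ StepN (Cell n) (edgeWeight n h) m b b := by
  choose f hf using fun a : {a : Move // a.Positive n N h H} => hc.exists_step a.2
  let g : {a : Move // a.Positive n N h H} → {a : Move // a.Positive n N h H} :=
    fun a => ⟨f a, (hf a).1⟩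
  let z : ℕ → {a : Move // a.Positive n N h H} := fun i => g^[i] ⟨a, ha⟩
  have hz : ∀ i, Move.Step (Cell n) (edgeWeight n h) (z i) (z (i + 1)) := by
    intro i
    simp only [z, Function.iterate_succ_apply']
    exact (hf _).2
  have : Finite {a : Move // a.Positive n N h H} := finite_positive.to_subtype
  obtain ⟨i, j, hne, e⟩ := Finite.exists_ne_map_eq_of_infinite z
  wlog hij : i < j generalizing i j
  · exact this j i hne.symm e.symm (by omega)
  have := stepN_of_seq hz i (j - i)
  rw [Nat.add_sub_cancel' hij.le, ← e] at this
  exact ⟨j - i, _, by omega, this⟩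

end Comparable
end Hives

section Hives

variable {n N : ℤ} {h H : ℤ × ℤ → ℤ} {x p q : ℤ × ℤ} {k : ZMod 6}

/-- The difference `H - N * h` has maximum `0` on the region of linearity of `h` containing the
triangle `(x, k)`. -/
def ZeroMax (n N : ℤ) (h H : ℤ × ℤ → ℤ) (x : ℤ × ℤ) (k : ZMod 6) : Prop :=
  (∃ p, Face n h x k p ∧ 0 ≤ H p - N * h p) ∧ ∀ p, Face n h x k p → H p - N * h p ≤ 0

theorem zeroMax_rotate : ZeroMax n N h H (x + hexDir k) (k + 2) ↔ ZeroMax n N h H x k := by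
  unfold ZeroMax
  simp only [face_rotate]

theorem cells_of_interior (hp : InTri n p) (hb : ¬ OnBorder n p) (k : ZMod 6) : Cell n p k := by
  obtain ⟨v0, v1, v2, v3, v4, v5⟩ := hexDir_values
  rcases zmod_six_cases k with rfl | rfl | rfl | rfl | rfl | rfl <;>
  simp only [OnBorder, Cell, InTri, zmod_six_add, zero_add, v0, v1, v2, v3, v4, v5,
    Prod.fst_add, Prod.snd_add] at * <;> omega

namespace Comparable

theorem exists_side_of_not_positive (h1 : ¬ (Move.walk x k).Positive n N h H)
    (hs : edgeWeight n h x k ≠ 0) (hc : Cell n x (k + 5)) (hp : Face n h x (k + 5) p) :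
    ∃ q, Side n h x k q ∧ H p - N * h p ≤ H q - N * h q := by
  by_contra hcon
  push Not at hcon
  exact h1 ⟨⟨hs, hc⟩, p, hp, hcon⟩

theorem zeroMax_before (hc : Comparable n N h H) (hno : ∀ a : Move, ¬ a.Positive n N h H)
    (hx : Cell n x k) (hx5 : Cell n x (k + 5)) (hb : ZeroMax n N h H x k) :
    ZeroMax n N h H x (k + 5) := by
  by_cases hs : edgeWeight n h x k = 0
  · unfold ZeroMax
    simp only [face_flat hs]
    exact hb
  · obtain ⟨⟨p, hp, hp0⟩, hb⟩ := hb
    constructor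
    · obtain ⟨q, hq, hle⟩ := exists_side_of_not_positive (hno (.walk (x + hexDir k) (k + 3)))
        (by rwa [hc.fst.isWeb.symm]) (by rwa [(dir_eqs k).2.2.2.2.2.1, cell_rotate])
        (p := p) (by rwa [(dir_eqs k).2.2.2.2.2.1, face_rotate])
      rw [side_flip, side_iff_before] at hq
      exact ⟨q, hq.2, hp0.trans hle⟩
    · intro p hp
      obtain ⟨q, hq, hle⟩ := exists_side_of_not_positive (hno (.walk x k)) hs hx5 hp
      exact hle.trans (hb q hq.2)

theorem zeroMax_border (hc : Comparable n N h H) (hno : ∀ a : Move, ¬ a.Positive n N h H)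
    {j : ℤ} (hx : Cell n (0, j) 0) : ZeroMax n N h H (0, j) 0 := by
  have e : (1 : ZMod 6) + 5 = 0 := by decide
  have hx1 : InTri n ((0, j) + hexDir 1) := by simpa using hx.2.2
  have hb : ¬ (Cell n (0, j) 1 ∧ Cell n (0, j) (1 + 5)) := by
    rintro ⟨⟨-, -, h1, -⟩, -⟩
    rw [zmod_six_add.1.1, hexDir_values.2.2.1] at h1
    simp at h1
  have hs : edgeWeight n h (0, j) 1 = 2 := hc.fst.isWeb.border _ _ hb
  refine ⟨⟨(0, j), face_self hx.1, ?_⟩, ?_⟩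
  · rw [(hc.gap_of_side hx.1 hx1 hb (side_self hx.1)).1]
  · intro p hp
    obtain ⟨q, hq, hle⟩ := exists_side_of_not_positive (hno (.walk (0, j) 1)) (by omega)
      (by rwa [e]) (p := p) (by rwa [e])
    have := hc.gap_of_side hx.1 hx1 hb hq
    omega

theorem zeroMax_zero (hc : Comparable n N h H) (hno : ∀ a : Move, ¬ a.Positive n N h H) (i : ℕ)
    {j : ℤ} (hx : Cell n ((i : ℤ), j) 0) : ZeroMax n N h H ((i : ℤ), j) 0 := by
  induction i with
  | zero => exact hc.zeroMax_border hno (by simpa using hx)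
  | succ i ih =>
    have e : (((i + 1 : ℕ) : ℤ), j) = ((i : ℤ), j) + hexDir 0 := by
      rw [hexDir_values.1]; ext <;> simp
    have c0 : Cell n ((i : ℤ), j) 0 := by
      obtain ⟨v0, v1, v2, v3, v4, v5⟩ := hexDir_values
      simp only [Cell, InTri, zero_add, v0, v1, Prod.fst_add, Prod.snd_add] at *
      push_cast at hx
      omega
    have c1 : Cell n (((i + 1 : ℕ) : ℤ), j) (2 + 5) := by
      rw [zmod_six_add.2.1.2.2.2.2]
      obtain ⟨v0, v1, v2, v3, v4, v5⟩ := hexDir_values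
      simp only [Cell, InTri, zero_add, zmod_six_add, v0, v1, v2, Prod.fst_add, Prod.snd_add] at *
      push_cast at *
      omega
    have b := ih c0
    rw [← zeroMax_rotate, ← e, zero_add] at b
    have c2 : Cell n (((i + 1 : ℕ) : ℤ), j) 2 := by
      rwa [← cell_rotate, ← e, zero_add] at c0
    have b1 := hc.zeroMax_before hno c2 c1 b
    rw [zmod_six_add.2.1.2.2.2.2] at c1 b1
    have b0 := hc.zeroMax_before hno c1 (by rwa [zmod_six_add.1.2.2.2.2]) b1
    rwa [zmod_six_add.1.2.2.2.2] at b0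

theorem zeroMax_interior (hc : Comparable n N h H) (hno : ∀ a : Move, ¬ a.Positive n N h H)
    (hp : InTri n p) (hb : ¬ OnBorder n p) (k : ZMod 6) : ZeroMax n N h H p k := by
  have c := cells_of_interior hp hb
  have b0 : ZeroMax n N h H p 0 := by
    have := hc.zeroMax_zero hno p.1.toNat (j := p.2)
    rw [Int.toNat_of_nonneg hp.1] at this
    exact this (c 0)
  have st : ∀ l : ZMod 6, ZeroMax n N h H p l → ZeroMax n N h H p (l + 5) :=
    fun l hl => hc.zeroMax_before hno (c l) (c _) hl
  have b5 := st 0 b0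
  rw [zero_add] at b5
  have b4 := st _ b5
  rw [zmod_six_add.2.2.2.2.2.2.2.2] at b4
  have b3 := st _ b4
  rw [zmod_six_add.2.2.2.1.2.2.2.2] at b3
  have b2 := st _ b3
  rw [zmod_six_add.2.2.1.2.2.2.2] at b2
  have b1 := st _ b2
  rw [zmod_six_add.2.1.2.2.2.2] at b1
  rcases zmod_six_cases k with rfl | rfl | rfl | rfl | rfl | rfl <;> assumption

/-- Distinct comparable hives have a positive move. -/
theorem exists_positive (hc : Comparable n N h H) (hx : InTri n x) (hne : H x ≠ N * h x) :
    ∃ a : Move, a.Positive n N h H := by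
  by_contra hno
  push Not at hno
  have hfin : {x | InTri n x}.Finite := by
    refine (Set.finite_Icc ((0 : ℤ), (0 : ℤ)) (n, n)).subset ?_
    rintro q ⟨h1, h2, h3⟩
    simp only [Set.mem_Icc, Prod.le_def]
    refine ⟨⟨h1, h2⟩, ?_, ?_⟩ <;> omega
  obtain ⟨p0, hp0, hmin⟩ := Set.exists_min_image _ (fun p => H p - N * h p) hfin ⟨x, hx⟩
  have hfin2 : {p | InTri n p ∧ H p - N * h p = H p0 - N * h p0}.Finite :=
    hfin.subset fun p hp => hp.1
  obtain ⟨p, ⟨hp, hpe⟩, hmax⟩ := Set.exists_max_image _ (fun p : ℤ × ℤ => 2 * p.1 + p.2) hfin2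
    ⟨p0, hp0, rfl⟩
  have hbx : ¬ OnBorder n x := fun hb => hne (hc.border x hx hb)
  have hxle := (hc.zeroMax_interior hno hx hbx 0).2 x (face_self hx)
  have hneg : H p - N * h p < 0 := by
    have := hmin x hx
    omega
  have hbp : ¬ OnBorder n p := by
    intro hb
    have := hc.border p hp hb
    omega
  have c := cells_of_interior hp hbp
  have hst : ∃ k, Straight n h p k := by
    by_contra hst
    push Not at hst
    have hflat : ∀ k, edgeWeight n h p k = 0 := by
      intro k
      by_contra hs
      obtain ⟨⟨p', hp', hp'0⟩, -⟩ := hc.zeroMax_interior hno hp hbp (k + 5)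
      obtain ⟨q, hq, hle⟩ := exists_side_of_not_positive (hno (.walk p k)) hs (c _) hp'
      exact hno _ (hc.positive_turn hs (c _) (hst k) hq (by omega))
    exact hst 0 ⟨hflat _, hflat _, hflat _, hflat _⟩
  obtain ⟨k, h1, h2, -, -⟩ := hst
  have s1 := (edgeWeight_eq_zero h1).2.2
  have s2 := (edgeWeight_eq_zero h2).2.2
  simp only [slack, add_assoc k, zmod_six_add, add_zero] at s1 s2
  have i0 : InTri n (p + hexDir k) := (c k).2.1
  have i3 : InTri n (p + hexDir (k + 3)) := (c _).2.1
  have e1 : 2 * h p = h (p + hexDir k) + h (p + hexDir (k + 3)) := by omega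
  have e2 := hc.snd.add_le_two_mul hp i0 i3
  have m0 := hmin _ i0
  have m3 := hmin _ i3
  have e3 : 2 * (N * h p) = N * h (p + hexDir k) + N * h (p + hexDir (k + 3)) := by
    linear_combination N * e1
  have x0 := hmax _ ⟨i0, by omega⟩
  have x3 := hmax _ ⟨i3, by omega⟩
  have hf : ∀ k : ZMod 6, 2 * (hexDir k).1 + (hexDir k).2 ≠ 0 := by decide
  have := hf k
  rw [hexDir_add_three] at x3
  simp only [Prod.fst_add, Prod.snd_add, Prod.fst_neg, Prod.snd_neg] at x0 x3
  omega

end Comparable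

/-- If a scaled hive is not determined by its border values, then neither is the hive itself. -/
theorem Comparable.exists_ne (hc : Comparable n N h H) (hx : InTri n x) (hne : H x ≠ N * h x) :
    ∃ h', IsHive n h' ∧ (∀ x, InTri n x → OnBorder n x → h' x = h x) ∧
      ∃ x, InTri n x ∧ h' x ≠ h x := by
  obtain ⟨a, ha⟩ := hc.exists_positive hx hne
  obtain ⟨m, b, hm, hb⟩ := hc.exists_stepN ha
  exact hc.fst.exists_ne_of_stepN hm hb

end Hives

section Patterns

/-- The row-count patterns of Littlewood–Richardson tableaux: `P r m` is the number of cells of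
row `r` of `nu` that lie in `lam` or have an entry at most `m`. -/
structure IsPattern (n : ℕ) (lam mu nu : ℕ → ℕ) (P : ℕ → ℕ → ℕ) : Prop where
  zero : ∀ r, P r 0 = lam r
  top : ∀ r m, r < m → P r m = nu r
  mono : ∀ r m, P r m ≤ P r (m + 1)
  strict : ∀ r m, P (r + 1) (m + 1) ≤ P r m
  lattice : ∀ r m, ∑ i ∈ Finset.range (r + 1), P i (m + 2) + ∑ i ∈ Finset.range r, P i m ≤
    ∑ i ∈ Finset.range r, P i (m + 1) + ∑ i ∈ Finset.range (r + 1), P i (m + 1)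
  content : ∀ m, ∑ i ∈ Finset.range n, P i (m + 1) = ∑ i ∈ Finset.range n, P i m + mu m

/-- The filling `T` has row counts `P`. -/
def HasRowCounts (nu : ℕ → ℕ) (P : ℕ → ℕ → ℕ) (T : ℕ × ℕ → ℕ) : Prop :=
  (∀ r c, nu r ≤ c → T (r, c) = 0) ∧ ∀ r c m, c < nu r → (T (r, c) ≤ m ↔ c < P r m)

variable {n : ℕ} {lam mu nu : ℕ → ℕ} {P P' : ℕ → ℕ → ℕ} {T T' : ℕ × ℕ → ℕ}

theorem HasRowCounts.filling_unique (h : HasRowCounts nu P T) (h' : HasRowCounts nu P T') :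
    T = T' := by
  ext ⟨r, c⟩
  rcases lt_or_ge c (nu r) with hc | hc
  · apply le_antisymm
    · rw [h.2 r c _ hc, ← h'.2 r c _ hc]
    · rw [h'.2 r c _ hc, ← h.2 r c _ hc]
  · rw [h.1 r c hc, h'.1 r c hc]

theorem HasRowCounts.pattern_unique (hP : ∀ r m, P r m ≤ nu r) (hP' : ∀ r m, P' r m ≤ nu r)
    (h : HasRowCounts nu P T) (h' : HasRowCounts nu P' T) : P = P' := by
  ext r m
  have key : ∀ c < nu r, (c < P r m ↔ c < P' r m) := fun c hc => by
    rw [← h.2 r c m hc, ← h'.2 r c m hc]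
  have h1 := hP r m
  have h2 := hP' r m
  apply le_antisymm
  · by_contra hlt
    have := key (P' r m) (by omega)
    omega
  · by_contra hlt
    have := key (P r m) (by omega)
    omega

theorem HasRowCounts.mem_iff (hP : ∀ r m, P r m ≤ nu r) (h0 : ∀ r, P r 0 = lam r)
    (hmono : ∀ r, Monotone (P r)) (h : HasRowCounts nu P T) (m : ℕ) (x : ℕ × ℕ) :
    InSkew lam nu x ∧ T x = m + 1 ↔ P x.1 m ≤ x.2 ∧ x.2 < P x.1 (m + 1) := by
  obtain ⟨r, c⟩ := x
  have h1 := hP r (m + 1)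
  have h2 := hmono r (Nat.zero_le m)
  rw [h0] at h2
  unfold InSkew
  dsimp only
  constructor
  · rintro ⟨⟨-, hc⟩, hT⟩
    have e1 := h.2 r c m hc
    have e2 := h.2 r c (m + 1) hc
    omega
  · rintro ⟨hc1, hc2⟩
    have hc : c < nu r := by omega
    have e1 := h.2 r c m hc
    have e2 := h.2 r c (m + 1) hc
    omega

/-- The number of entries `m + 1` in an initial segment of the reading word. -/
theorem HasRowCounts.card_readBefore (hP : ∀ r m, P r m ≤ nu r) (h0 : ∀ r, P r 0 = lam r)
    (hmono : ∀ r, Monotone (P r)) (h : HasRowCounts nu P T) (m r c : ℕ) :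
    Nat.card {x : ℕ × ℕ // ReadBefore r c x ∧ InSkew lam nu x ∧ T x = m + 1} +
      ∑ i ∈ Finset.range r, P i m =
    ∑ i ∈ Finset.range r, P i (m + 1) + (P r (m + 1) - max c (P r m)) := by
  set F : Finset (Σ _ : ℕ, ℕ) := (Finset.range (r + 1)).sigma fun i =>
    Finset.Ico (if i < r then P i m else max c (P i m)) (P i (m + 1)) with hF
  rw [Nat.subtype_card (F.map (Equiv.sigmaEquivProd ℕ ℕ).toEmbedding)]
  · rw [Finset.card_map, hF, Finset.card_sigma, Finset.sum_range_succ]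
    simp only [Nat.card_Ico, lt_irrefl, if_false]
    have : ∀ i ∈ Finset.range r, P i (m + 1) - (if i < r then P i m else max c (P i m)) =
        P i (m + 1) - P i m := by
      intro i hi
      rw [if_pos (Finset.mem_range.1 hi)]
    rw [Finset.sum_congr rfl this, add_right_comm, ← Finset.sum_add_distrib]
    congr 1
    exact Finset.sum_congr rfl fun i _ => Nat.sub_add_cancel (hmono i (Nat.le_succ m))
  · rintro ⟨i, j⟩
    rw [h.mem_iff hP h0 hmono]
    simp only [Finset.mem_map_equiv, hF, Finset.mem_sigma, Finset.mem_range, Finset.mem_Ico,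
      Equiv.sigmaEquivProd_symm_apply, ReadBefore]
    split_ifs with hi
    · omega
    · constructor
      · rintro ⟨h1, h2, h3⟩
        have : i = r := by omega
        subst this
        omega
      · rintro ⟨h1, h2, h3⟩
        have : i = r := by omega
        subst this
        omega

/-- The number of entries `m + 1`. -/
theorem HasRowCounts.card_entries (hP : ∀ r m, P r m ≤ nu r) (h0 : ∀ r, P r 0 = lam r)
    (hmono : ∀ r, Monotone (P r)) (h : HasRowCounts nu P T) (hnu : ∀ i, n ≤ i → nu i = 0)
    (m : ℕ) :
    Nat.card {x : ℕ × ℕ // InSkew lam nu x ∧ T x = m + 1} + ∑ i ∈ Finset.range n, P i m =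
      ∑ i ∈ Finset.range n, P i (m + 1) := by
  have key := h.card_readBefore hP h0 hmono m n 0
  have h1 := hP n (m + 1)
  rw [hnu n le_rfl] at h1
  have e : ∀ x : ℕ × ℕ, (ReadBefore n 0 x ∧ InSkew lam nu x ∧ T x = m + 1) ↔
      (InSkew lam nu x ∧ T x = m + 1) := by
    intro x
    refine and_iff_right_of_imp ?_
    rintro ⟨⟨-, hx⟩, -⟩
    left
    by_contra hn
    rw [hnu x.1 (by omega)] at hx
    omega
  simp only [e] at key
  omega

namespace IsPattern

theorem monotone (hP : IsPattern n lam mu nu P) (r : ℕ) : Monotone (P r) :=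
  monotone_nat_of_le_succ (hP.mono r)

theorem le (hP : IsPattern n lam mu nu P) (r m : ℕ) : P r m ≤ nu r := by
  have := hP.monotone r (show m ≤ m + r + 1 by omega)
  rwa [hP.top r (m + r + 1) (by omega)] at this

theorem strict_of_lt (hP : IsPattern n lam mu nu P) {i j : ℕ} (hij : i < j) (m : ℕ) :
    P j (m + 1) ≤ P i m := by
  induction j, hij using Nat.le_induction with
  | base => exact hP.strict i m
  | succ j hj ih => exact ((hP.strict j m).trans (hP.mono j m)).trans ih

theorem exists_tableau (hnu0 : ∀ i, n ≤ i → nu i = 0)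
    (hP : IsPattern n lam mu nu P) :
    ∃ T, IsLRSkewTableau lam mu nu T ∧ HasRowCounts nu P T := by
  have hex : ∀ r c, c < nu r → ∃ m, c < P r m := fun r c hc =>
    ⟨r + 1, by rwa [hP.top r _ (Nat.lt_succ_self r)]⟩
  let T : ℕ × ℕ → ℕ := fun x => if hx : x.2 < nu x.1 then Nat.find (hex x.1 x.2 hx) else 0
  have hT : HasRowCounts nu P T := by
    refine ⟨fun r c hc => dif_neg (by simpa using hc), fun r c m hc => ?_⟩
    have : T (r, c) = Nat.find (hex r c hc) := dif_pos hc
    rw [this, Nat.find_le_iff]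
    exact ⟨fun ⟨m', h1, h2⟩ => h2.trans_le (hP.monotone r h1), fun h => ⟨m, le_rfl, h⟩⟩
  have hpos : ∀ x : ℕ × ℕ, 0 < T x ↔ InSkew lam nu x := by
    rintro ⟨r, c⟩
    unfold InSkew
    dsimp only
    rcases lt_or_ge c (nu r) with hc | hc
    · have := hT.2 r c 0 hc
      rw [hP.zero] at this
      omega
    · rw [hT.1 r c hc]
      omega
  refine ⟨T, ⟨hpos, ?_, ?_, ?_, ?_⟩, hT⟩
  · intro i j j' _ hj hj'
    rw [hT.2 i j _ (hj.trans_lt hj')]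
    exact hj.trans_lt ((hT.2 i j' _ hj').1 le_rfl)
  · intro i i' j hi hs hs'
    have h1 := (hpos _).2 hs'
    obtain ⟨m, hm⟩ : ∃ m, T (i', j) = m + 1 := ⟨T (i', j) - 1, by omega⟩
    have h2 := (hT.2 i' j _ hs'.2).1 hm.le
    have h3 := (hT.2 i j m hs.2).2 (h2.trans_le (hP.strict_of_lt hi m))
    omega
  · intro m hm
    obtain ⟨m, rfl⟩ : ∃ a, m = a + 1 := ⟨m - 1, by omega⟩
    have := hT.card_entries hP.le hP.zero hP.monotone hnu0 m
    have := hP.content m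
    simp only [Nat.add_sub_cancel]
    omega
  · intro m hm r c
    obtain ⟨m, rfl⟩ : ∃ a, m = a + 1 := ⟨m - 1, by omega⟩
    have h1 := hT.card_readBefore hP.le hP.zero hP.monotone (m + 1) r c
    have h2 := hT.card_readBefore hP.le hP.zero hP.monotone m r c
    have h3 := hP.lattice r m
    have h4 := hP.mono r (m + 1)
    rw [Finset.sum_range_succ, Finset.sum_range_succ] at h3
    rw [show m + 1 + 1 = m + 2 from rfl] at h1 h4 ⊢
    omega

end IsPattern

theorem IsLRSkewTableau.exists_pattern (hlam : Antitone lam) (hnu : Antitone nu)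
    (hnu0 : ∀ i, n ≤ i → nu i = 0) (hle : ∀ i, lam i ≤ nu i) (hT : IsLRSkewTableau lam mu nu T) :
    ∃ P, IsPattern n lam mu nu P ∧ HasRowCounts nu P T := by
  obtain ⟨hpos, hrow, hcol, hcont, hlat⟩ := hT
  have hout : ∀ x, ¬ InSkew lam nu x → T x = 0 := by
    intro x hx
    rw [← hpos] at hx
    omega
  have hweak : ∀ r c c', c ≤ c' → c' < nu r → T (r, c) ≤ T (r, c') := by
    intro r c c' h1 h2
    rcases lt_or_ge c (lam r) with h3 | h3
    · rw [hout (r, c) (fun h => absurd h.1 (by simpa using h3))]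
      omega
    · exact hrow r c c' h3 h1 h2
  set P : ℕ → ℕ → ℕ := fun r m => ((Finset.range (nu r)).filter fun c => T (r, c) ≤ m).card with hPd
  have hP : ∀ r m, P r m ≤ nu r := by
    intro r m
    simpa using Finset.card_filter_le (Finset.range (nu r)) fun c => T (r, c) ≤ m
  have hcount : ∀ r c m, c < nu r → (T (r, c) ≤ m ↔ c < P r m) := by
    intro r c m hc
    constructor
    · intro hcm
      have : Finset.range (c + 1) ⊆ (Finset.range (nu r)).filter fun c => T (r, c) ≤ m := by
        intro a ha
        rw [Finset.mem_range] at ha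
        rw [Finset.mem_filter, Finset.mem_range]
        exact ⟨by omega, (hweak r a c (by omega) hc).trans hcm⟩
      have := Finset.card_le_card this
      rw [Finset.card_range] at this
      exact this
    · intro hcm
      by_contra hgt
      have : ((Finset.range (nu r)).filter fun c => T (r, c) ≤ m) ⊆ Finset.range c := by
        intro a ha
        rw [Finset.mem_filter, Finset.mem_range] at ha
        rw [Finset.mem_range]
        by_contra hac
        exact hgt ((hweak r c a (by omega) ha.1).trans ha.2)
      have := Finset.card_le_card this
      rw [Finset.card_range] at this
      simp only [hPd] at hcm
      omega
  have hTc : HasRowCounts nu P T := by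
    refine ⟨fun r c hc => hout _ fun h => ?_, hcount⟩
    have : c < nu r := h.2
    omega
  have h0 : ∀ r, P r 0 = lam r := by
    intro r
    have hl := hle r
    have h1 := hP r 0
    have key : ∀ c < nu r, (c < lam r ↔ c < P r 0) := by
      intro c hc
      rw [← hcount r c 0 hc]
      have := hpos (r, c)
      unfold InSkew at this
      dsimp only at this
      omega
    apply le_antisymm
    · by_contra hlt
      have := key (lam r) (by omega)
      omega
    · by_contra hlt
      have := key (P r 0) (by omega)
      omega
  have hmono : ∀ r m, P r m ≤ P r (m + 1) := by
    intro r m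
    exact Finset.card_le_card (Finset.monotone_filter_right _ fun c _ hc => Nat.le_succ_of_le hc)
  have hmono' : ∀ r, Monotone (P r) := fun r => monotone_nat_of_le_succ (hmono r)
  have hentry : ∀ r c, T (r, c) ≤ r + 1 := by
    intro r
    induction r using Nat.strong_induction_on with
    | _ r ih =>
      intro c
      by_contra hgt
      obtain ⟨m, hm⟩ : ∃ m, T (r, c) = m + 1 := ⟨T (r, c) - 1, by omega⟩
      have hs : InSkew lam nu (r, c) := (hpos _).1 (by omega)
      have h1 := hlat m (by omega) r c
      have hfin : Finite {x : ℕ × ℕ // ReadBefore r c x ∧ InSkew lam nu x ∧ T x = m + 1} := by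
        refine Set.Finite.to_subtype (Set.Finite.subset
          (Set.finite_Icc ((0 : ℕ), (0 : ℕ)) (r, nu 0)) ?_)
        rintro ⟨a, b⟩ ⟨h1, h2, -⟩
        have h3 : b < nu a := h2.2
        have := hnu (Nat.zero_le a)
        simp only [ReadBefore] at h1
        simp only [Set.mem_Icc, Prod.le_def]
        omega
      have : Nonempty {x : ℕ × ℕ // ReadBefore r c x ∧ InSkew lam nu x ∧ T x = m + 1} :=
        ⟨⟨(r, c), Or.inr ⟨rfl, le_rfl⟩, hs, hm⟩⟩
      have h2 := Nat.card_pos (α := {x : ℕ × ℕ // ReadBefore r c x ∧ InSkew lam nu x ∧ T x = m + 1})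
      have h3 : 0 < Nat.card {x : ℕ × ℕ // ReadBefore r c x ∧ InSkew lam nu x ∧ T x = m} := by
        omega
      obtain ⟨⟨⟨a, b⟩, hab, hsab, hTab⟩⟩ := (Nat.card_pos_iff.1 h3).1
      simp only [ReadBefore] at hab
      rcases hab with ha | ⟨rfl, hb⟩
      · have := ih a ha b
        omega
      · have := hweak a c b hb hsab.2
        omega
  refine ⟨P, ⟨h0, ?_, hmono, ?_, ?_, ?_⟩, hTc⟩
  · intro r m hrm
    simp only [hPd]
    rw [Finset.filter_true_of_mem, Finset.card_range]
    intro c _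
    exact (hentry r c).trans hrm
  · intro r m
    refine Finset.card_le_card fun c hc => ?_
    rw [Finset.mem_filter, Finset.mem_range] at hc ⊢
    have hlt := hc.1.trans_le (hnu (Nat.le_succ r))
    refine ⟨hlt, ?_⟩
    by_cases hs : InSkew lam nu (r, c)
    · have h1 : lam r ≤ c := hs.1
      have := hcol r (r + 1) c (Nat.lt_succ_self r) hs
        ⟨(hlam (Nat.le_succ r)).trans h1, hc.1⟩
      omega
    · rw [hout _ hs]
      omega
  · intro r m
    have h1 := hlat (m + 1) (by omega) r (P r (m + 1))
    have h2 := hTc.card_readBefore hP h0 hmono' (m + 1) r (P r (m + 1))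
    have h3 := hTc.card_readBefore hP h0 hmono' m r (P r (m + 1))
    have h4 := hmono r (m + 1)
    rw [Finset.sum_range_succ, Finset.sum_range_succ]
    rw [show m + 1 + 1 = m + 2 from rfl] at h1 h2 h4
    omega
  · intro m
    have h1 := hcont (m + 1) (by omega)
    have h2 := hTc.card_entries hP h0 hmono' hnu0 m
    rw [Nat.add_sub_cancel] at h1
    omega

/-- The Littlewood–Richardson coefficient is `1` exactly when there is a unique pattern. -/
theorem lrCoeff_eq_one_iff (hlam : Antitone lam) (hnu : Antitone nu)
    (hnu0 : ∀ i, n ≤ i → nu i = 0) :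
    lrCoeff lam mu nu = 1 ↔ ∃! P, IsPattern n lam mu nu P := by
  unfold lrCoeff
  split_ifs with hle
  · rw [Nat.card_eq_one_iff_exists]
    constructor
    · rintro ⟨⟨T, hT⟩, huniq⟩
      obtain ⟨P, hP, hPT⟩ := hT.exists_pattern hlam hnu hnu0 hle
      refine ⟨P, hP, fun P' hP' => ?_⟩
      obtain ⟨T', hT', hPT'⟩ := hP'.exists_tableau hnu0
      have : T' = T := congrArg Subtype.val (huniq ⟨T', hT'⟩)
      subst this
      exact HasRowCounts.pattern_unique hP'.le hP.le hPT' hPT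
    · rintro ⟨P, hP, huniq⟩
      obtain ⟨T, hT, hPT⟩ := hP.exists_tableau hnu0
      refine ⟨⟨T, hT⟩, fun ⟨T', hT'⟩ => Subtype.ext ?_⟩
      obtain ⟨P', hP', hPT'⟩ := hT'.exists_pattern hlam hnu hnu0 hle
      rw [huniq P' hP'] at hPT'
      exact hPT'.filling_unique hPT
  · simp only [false_iff]
    rintro ⟨P, hP, -⟩
    refine hle fun i => ?_
    rw [← hP.zero i]
    exact hP.le i 0

end Patterns

section Hives

/-- Concavity may be checked on one edge of each pair of opposite directions. -/
theorem isHive_of_slack {n : ℤ} {h : ℤ × ℤ → ℤ}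
    (h0 : ∀ i j : ℤ, 0 ≤ i → 1 ≤ j → i + j + 1 ≤ n →
      h (i, j + 1) + h (i + 1, j - 1) ≤ h (i, j) + h (i + 1, j))
    (h1 : ∀ i j : ℤ, 1 ≤ i → 0 ≤ j → i + j + 1 ≤ n →
      h (i - 1, j + 1) + h (i + 1, j) ≤ h (i, j) + h (i, j + 1))
    (h2 : ∀ i j : ℤ, 1 ≤ i → 0 ≤ j → i + j + 1 ≤ n →
      h (i - 1, j) + h (i, j + 1) ≤ h (i, j) + h (i - 1, j + 1)) : IsHive n h := by
  have base : ∀ x : ℤ × ℤ, ∀ k : ZMod 6, (k = 0 ∨ k = 1 ∨ k = 2) → Cell n x k →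
      Cell n x (k + 5) → 0 ≤ slack h x k := by
    rintro ⟨i, j⟩ k hk c c5
    obtain ⟨v0, v1, v2, v3, v4, v5⟩ := hexDir_values
    rcases hk with rfl | rfl | rfl <;>
    simp only [Cell, InTri, slack, zmod_six_add, zero_add, v0, v1, v2, v3, v5, Prod.mk_add_mk]
      at * <;>
    simp only [add_zero, ← sub_eq_add_neg] at *
    · have := h0 i j (by omega) (by omega) (by omega)
      omega
    · have := h1 i j (by omega) (by omega) (by omega)
      omega
    · have := h2 i j (by omega) (by omega) (by omega)
      omega
  intro x k c c5
  have e := slack_flip (h := h) (x := x) (k := k)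
  have d : Cell n (x + hexDir k) (k + 3) := cell_flip.2 c5
  have d5 : Cell n (x + hexDir k) (k + 3 + 5) := by
    rw [(dir_eqs k).2.2.2.2.2.1, cell_rotate]
    exact c
  rw [← e]
  rcases zmod_six_cases k with rfl | rfl | rfl | rfl | rfl | rfl
  · rw [e]; exact base _ _ (by decide) c c5
  · rw [e]; exact base _ _ (by decide) c c5
  · rw [e]; exact base _ _ (by decide) c c5
  · exact base _ _ (by decide) d d5
  · exact base _ _ (by decide) d d5
  · exact base _ _ (by decide) d d5

/-- The hive of a pattern. -/
def patternHive (P : ℕ → ℕ → ℕ) (x : ℤ × ℤ) : ℤ :=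
  ((∑ r ∈ Finset.range (x.1 + x.2).toNat, P r x.2.toNat : ℕ) : ℤ)

/-- The border values of the hives counted by a Littlewood–Richardson coefficient. -/
structure HasBorder (n : ℕ) (lam mu nu : ℕ → ℕ) (h : ℤ × ℤ → ℤ) : Prop where
  bottom : ∀ i ≤ n, h ((i : ℤ), 0) = ((∑ r ∈ Finset.range i, lam r : ℕ) : ℤ)
  left : ∀ j ≤ n, h (0, (j : ℤ)) = ((∑ r ∈ Finset.range j, nu r : ℕ) : ℤ)
  diag : ∀ i j, i + j = n → h ((i : ℤ), (j : ℤ)) =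
    ((∑ r ∈ Finset.range n, lam r + ∑ r ∈ Finset.range j, mu r : ℕ) : ℤ)

variable {n : ℕ} {lam mu nu : ℕ → ℕ} {P P' : ℕ → ℕ → ℕ} {h H : ℤ × ℤ → ℤ}

theorem patternHive_natCast (P : ℕ → ℕ → ℕ) (i j : ℕ) :
    patternHive P ((i : ℤ), (j : ℤ)) = ((∑ r ∈ Finset.range (i + j), P r j : ℕ) : ℤ) := by
  have e : ((i : ℤ) + j).toNat = i + j := by omega
  simp only [patternHive, e, Int.toNat_natCast]

theorem exists_natCast_of_inTri {x : ℤ × ℤ} (hx : InTri n x) :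
    ∃ i j : ℕ, i + j ≤ n ∧ x = ((i : ℤ), (j : ℤ)) := by
  obtain ⟨h1, h2, h3⟩ := hx
  refine ⟨x.1.toNat, x.2.toNat, by omega, ?_⟩
  ext <;> simp [h1, h2]

theorem HasBorder.smul_eq {N : ℕ} (hb : HasBorder n lam mu nu h)
    (hB : HasBorder n (fun i => N * lam i) (fun i => N * mu i) (fun i => N * nu i) H)
    (x : ℤ × ℤ) (hx : InTri n x) (hxb : OnBorder n x) : H x = N * h x := by
  obtain ⟨i, j, hij, rfl⟩ := exists_natCast_of_inTri hx
  rcases hxb with h0 | h0 | h0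
  · obtain rfl : i = 0 := by simpa using h0
    rw [Nat.cast_zero, hb.left j (by omega), hB.left j (by omega), ← Finset.mul_sum]
    push_cast; ring
  · obtain rfl : j = 0 := by simpa using h0
    rw [Nat.cast_zero, hb.bottom i (by omega), hB.bottom i (by omega), ← Finset.mul_sum]
    push_cast; ring
  · have : i + j = n := by
      dsimp only at h0
      exact_mod_cast h0
    rw [hb.diag i j this, hB.diag i j this, ← Finset.mul_sum, ← Finset.mul_sum]
    push_cast; ring

theorem HasBorder.of_eq (hb : HasBorder n lam mu nu h)
    (he : ∀ x, InTri n x → OnBorder n x → H x = h x) : HasBorder n lam mu nu H where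
  bottom i hi := by
    rw [← hb.bottom i hi]
    exact he _ ⟨by simp, by simp, by simp; omega⟩ (Or.inr (Or.inl rfl))
  left j hj := by
    rw [← hb.left j hj]
    exact he _ ⟨by simp, by simp, by simp; omega⟩ (Or.inl rfl)
  diag i j hij := by
    rw [← hb.diag i j hij]
    exact he _ ⟨by simp, by simp, by simp; omega⟩ (Or.inr (Or.inr (by simp; omega)))

namespace IsPattern

theorem hasBorder (hP : IsPattern n lam mu nu P) : HasBorder n lam mu nu (patternHive P) where
  bottom i _ := by
    have := patternHive_natCast P i 0
    simp only [hP.zero, add_zero] at this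
    exact this
  left j _ := by
    have := patternHive_natCast P 0 j
    rw [zero_add, Finset.sum_congr rfl fun r hr => hP.top r j (Finset.mem_range.1 hr)] at this
    exact this
  diag i j hij := by
    rw [patternHive_natCast, hij]
    clear hij
    congr 1
    induction j with
    | zero => simp [hP.zero]
    | succ j ih => rw [hP.content, ih, Finset.sum_range_succ, add_assoc]

theorem isHive (hP : IsPattern n lam mu nu P) (m : ℤ) : IsHive m (patternHive P) := by
  apply isHive_of_slack
  · intro i j hi hj _
    lift i to ℕ using hi
    obtain ⟨j, rfl⟩ : ∃ a : ℕ, j = ((a + 1 : ℕ) : ℤ) := ⟨(j - 1).toNat, by omega⟩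
    have e1 : ((j + 1 : ℕ) : ℤ) + 1 = ((j + 2 : ℕ) : ℤ) := by push_cast; ring
    have e2 : ((j + 1 : ℕ) : ℤ) - 1 = (j : ℤ) := by push_cast; ring
    have e3 : (i : ℤ) + 1 = ((i + 1 : ℕ) : ℤ) := by push_cast; ring
    rw [e1, e2, e3]
    simp only [patternHive_natCast]
    have := hP.lattice (i + 1 + j) j
    rw [show i + 1 + j + 1 = i + 1 + (j + 1) by ring] at this
    rw [show i + (j + 2) = i + 1 + (j + 1) by ring, show i + (j + 1) = i + 1 + j by ring]
    exact_mod_cast this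
  · intro i j hi hj _
    lift j to ℕ using hj
    obtain ⟨i, rfl⟩ : ∃ a : ℕ, i = ((a + 1 : ℕ) : ℤ) := ⟨(i - 1).toNat, by omega⟩
    have e1 : ((i + 1 : ℕ) : ℤ) + 1 = ((i + 2 : ℕ) : ℤ) := by push_cast; ring
    have e2 : ((i + 1 : ℕ) : ℤ) - 1 = (i : ℤ) := by push_cast; ring
    have e3 : (j : ℤ) + 1 = ((j + 1 : ℕ) : ℤ) := by push_cast; ring
    rw [e1, e2, e3]
    simp only [patternHive_natCast]
    have := hP.mono (i + 1 + j) j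
    rw [show i + 2 + j = i + 1 + j + 1 by ring, show i + 1 + (j + 1) = i + 1 + j + 1 by ring,
      show i + (j + 1) = i + 1 + j by ring, Finset.sum_range_succ, Finset.sum_range_succ]
    push_cast
    have : (P (i + 1 + j) j : ℤ) ≤ P (i + 1 + j) (j + 1) := by exact_mod_cast this
    linarith
  · intro i j hi hj _
    lift j to ℕ using hj
    obtain ⟨i, rfl⟩ : ∃ a : ℕ, i = ((a + 1 : ℕ) : ℤ) := ⟨(i - 1).toNat, by omega⟩
    have e2 : ((i + 1 : ℕ) : ℤ) - 1 = (i : ℤ) := by push_cast; ring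
    have e3 : (j : ℤ) + 1 = ((j + 1 : ℕ) : ℤ) := by push_cast; ring
    rw [e2, e3]
    simp only [patternHive_natCast]
    have := hP.strict (i + j) j
    rw [show i + 1 + (j + 1) = i + j + 1 + 1 by ring, show i + 1 + j = i + j + 1 by ring,
      show i + (j + 1) = i + j + 1 by ring,
      Finset.sum_range_succ (fun r => P r (j + 1)) (i + j + 1),
      Finset.sum_range_succ (fun r => P r j) (i + j)]
    push_cast
    have : (P (i + j + 1) (j + 1) : ℤ) ≤ P (i + j) j := by exact_mod_cast this
    linarith

/-- A pattern is determined by the values of its hive. -/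
theorem eq_of_patternHive_eq (hnu0 : ∀ i, n ≤ i → nu i = 0) (hP : IsPattern n lam mu nu P)
    (hP' : IsPattern n lam mu nu P')
    (he : ∀ x, InTri n x → patternHive P x = patternHive P' x) : P = P' := by
  ext r m
  rcases lt_or_ge r m with hrm | hrm
  · rw [hP.top r m hrm, hP'.top r m hrm]
  · rcases lt_or_ge r n with hrn | hrn
    · have e1 := he (((r - m : ℕ) : ℤ), (m : ℤ)) ⟨by simp, by simp, by simp; omega⟩
      have e2 := he (((r + 1 - m : ℕ) : ℤ), (m : ℤ)) ⟨by simp, by simp, by simp; omega⟩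
      rw [patternHive_natCast, patternHive_natCast] at e1 e2
      rw [show r - m + m = r by omega] at e1
      rw [show r + 1 - m + m = r + 1 by omega, Finset.sum_range_succ, Finset.sum_range_succ] at e2
      omega
    · have h1 := hP.le r m
      have h2 := hP'.le r m
      rw [hnu0 r hrn] at h1 h2
      omega

theorem smul (hP : IsPattern n lam mu nu P) (N : ℕ) :
    IsPattern n (fun i => N * lam i) (fun i => N * mu i) (fun i => N * nu i)
      (fun r m => N * P r m) where
  zero r := by rw [hP.zero]
  top r m hrm := by rw [hP.top r m hrm]
  mono r m := Nat.mul_le_mul_left N (hP.mono r m)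
  strict r m := Nat.mul_le_mul_left N (hP.strict r m)
  lattice r m := by
    simp only [← Finset.mul_sum, ← mul_add]
    exact Nat.mul_le_mul_left N (hP.lattice r m)
  content m := by
    simp only [← Finset.mul_sum, ← mul_add]
    rw [hP.content m]

end IsPattern

theorem patternHive_smul (N : ℕ) (P : ℕ → ℕ → ℕ) (x : ℤ × ℤ) :
    patternHive (fun r m => N * P r m) x = N * patternHive P x := by
  unfold patternHive
  rw [← Finset.mul_sum]
  push_cast; ring

end Hives

section Hives

variable {n : ℕ} {lam mu nu : ℕ → ℕ} {h : ℤ × ℤ → ℤ}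

/-- The hive inequalities in coordinates. -/
theorem IsHive.inequalities (hh : IsHive n h) (i j : ℕ) :
    (i + j + 2 ≤ n → h ((i : ℤ), (j : ℤ) + 2) + h ((i : ℤ) + 1, (j : ℤ)) ≤
      h ((i : ℤ), (j : ℤ) + 1) + h ((i : ℤ) + 1, (j : ℤ) + 1)) ∧
    (i + j + 2 ≤ n → h ((i : ℤ), (j : ℤ) + 1) + h ((i : ℤ) + 2, (j : ℤ)) ≤
      h ((i : ℤ) + 1, (j : ℤ)) + h ((i : ℤ) + 1, (j : ℤ) + 1)) ∧
    (i + j + 2 ≤ n → h ((i : ℤ), (j : ℤ)) + h ((i : ℤ) + 1, (j : ℤ) + 1) ≤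
      h ((i : ℤ) + 1, (j : ℤ)) + h ((i : ℤ), (j : ℤ) + 1)) := by
  have h0 := hh ((i : ℤ), (j : ℤ) + 1) 0
  have h1 := hh ((i : ℤ) + 1, (j : ℤ)) 1
  have h2 := hh ((i : ℤ) + 1, (j : ℤ)) 2
  obtain ⟨v0, v1, v2, v3, v4, v5⟩ := hexDir_values
  simp only [Cell, InTri, slack, zmod_six_add, zero_add, v0, v1, v2, v3, v5, Prod.mk_add_mk]
    at h0 h1 h2
  have e1 : (j : ℤ) + 1 + -1 = j := by ring
  have e2 : (j : ℤ) + 1 + 1 = j + 2 := by ring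
  have e3 : (i : ℤ) + 1 + -1 = i := by ring
  have e4 : (i : ℤ) + 1 + 1 = i + 2 := by ring
  simp only [add_zero, e1, e2, e3, e4] at h0 h1 h2
  refine ⟨fun hn => ?_, fun hn => ?_, fun hn => ?_⟩
  · have := h0 (by omega) (by omega)
    omega
  · have := h1 (by omega) (by omega)
    omega
  · have := h2 (by omega) (by omega)
    omega

/-- The increment of `h` along row `r` of its pattern, in column `m`. -/
def rowStep (h : ℤ × ℤ → ℤ) (r m : ℕ) : ℤ :=
  h ((r : ℤ) + 1 - m, (m : ℤ)) - h ((r : ℤ) - m, (m : ℤ))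

namespace HasBorder

theorem rowStep_zero (hb : HasBorder n lam mu nu h) {r : ℕ} (hr : r < n) :
    rowStep h r 0 = lam r := by
  have h1 := hb.bottom r hr.le
  have h2 := hb.bottom (r + 1) hr
  rw [Finset.sum_range_succ] at h2
  unfold rowStep
  push_cast at *
  rw [sub_zero, sub_zero, h1, h2]
  ring

theorem rowStep_le_succ (hh : IsHive n h) {r m : ℕ} (hm : m < r) (hr : r < n) :
    rowStep h r m ≤ rowStep h r (m + 1) := by
  have := (hh.inequalities (r - m - 1) m).2.1 (by omega)
  have e : ((r - m - 1 : ℕ) : ℤ) = r - m - 1 := by omega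
  rw [e] at this
  unfold rowStep
  push_cast
  rw [show (r : ℤ) - m - 1 + 1 = r - m by ring,
    show (r : ℤ) - m - 1 + 2 = r + 1 - m by ring] at this
  rw [show (r : ℤ) + 1 - (m + 1) = r - m by ring, show (r : ℤ) - (m + 1) = r - m - 1 by ring]
  linarith

theorem rowStep_nonneg (hb : HasBorder n lam mu nu h) (hh : IsHive n h) {r m : ℕ} (hm : m ≤ r)
    (hr : r < n) : 0 ≤ rowStep h r m := by
  induction m with
  | zero => rw [hb.rowStep_zero hr]; positivity
  | succ m ih => exact (ih (by omega)).trans (rowStep_le_succ hh (by omega) hr)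

theorem rowStep_strict (hh : IsHive n h) {r m : ℕ} (hm : m ≤ r) (hr : r + 1 < n) :
    rowStep h (r + 1) (m + 1) ≤ rowStep h r m := by
  have := (hh.inequalities (r - m) m).2.2 (by omega)
  have e : ((r - m : ℕ) : ℤ) = r - m := by omega
  rw [e] at this
  unfold rowStep
  push_cast
  rw [show (r : ℤ) - m + 1 = r + 1 - m by ring] at this
  rw [show (r : ℤ) + 1 + 1 - (m + 1) = r + 1 - m by ring,
    show (r : ℤ) + 1 - (m + 1) = r - m by ring]
  linarith

theorem rowStep_self_le (hb : HasBorder n lam mu nu h) (hh : IsHive n h) {r : ℕ} (hr : r < n) :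
    rowStep h r r ≤ nu r := by
  have anti : ∀ d r : ℕ, r + d + 1 = n → h (1, (r : ℤ)) ≤ h (0, (r : ℤ) + 1) := by
    intro d
    induction d with
    | zero =>
      intro r hr
      have h1 := hb.diag 0 (r + 1) (by omega)
      have h2 := hb.diag 1 r (by omega)
      push_cast at *
      rw [h1, h2, Finset.sum_range_succ]
      have : (0 : ℤ) ≤ mu r := by positivity
      linarith
    | succ d ih =>
      intro r hr
      have := ih (r + 1) (by omega)
      have := (hh.inequalities 0 r).1 (by omega)
      push_cast at *
      rw [show (r : ℤ) + 1 + 1 = r + 2 by ring] at *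
      linarith
  have h1 := anti (n - r - 1) r (by omega)
  have h2 := hb.left r hr.le
  have h3 := hb.left (r + 1) hr
  rw [Finset.sum_range_succ] at h3
  unfold rowStep
  push_cast at *
  rw [show (r : ℤ) + 1 - r = 1 by ring, sub_self]
  linarith

/-- The pattern of a hive. -/
noncomputable def pattern (n : ℕ) (nu : ℕ → ℕ) (h : ℤ × ℤ → ℤ) (r m : ℕ) : ℕ :=
  if m ≤ r ∧ r < n then (rowStep h r m).toNat else nu r

theorem patternHive_pattern_natCast (hb : HasBorder n lam mu nu h) (hh : IsHive n h) (i j : ℕ)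
    (hij : i + j ≤ n) :
    ((∑ r ∈ Finset.range (i + j), pattern n nu h r j : ℕ) : ℤ) = h ((i : ℤ), (j : ℤ)) := by
  induction i with
  | zero =>
    rw [Nat.cast_zero, hb.left j (by omega), zero_add]
    congr 1
    refine Finset.sum_congr rfl fun r hr => if_neg ?_
    rw [Finset.mem_range] at hr
    omega
  | succ i ih =>
    rw [show i + 1 + j = i + j + 1 by ring, Finset.sum_range_succ, Nat.cast_add, ih (by omega),
      pattern, if_pos (by omega), Int.toNat_of_nonneg (hb.rowStep_nonneg hh (by omega) (by omega)),
      rowStep]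
    push_cast
    rw [show (i : ℤ) + j + 1 - j = i + 1 by ring, show (i : ℤ) + j - j = i by ring]
    ring

theorem patternHive_pattern (hb : HasBorder n lam mu nu h) (hh : IsHive n h) {x : ℤ × ℤ}
    (hx : InTri n x) : patternHive (pattern n nu h) x = h x := by
  obtain ⟨i, j, hij, rfl⟩ := exists_natCast_of_inTri hx
  rw [patternHive_natCast, hb.patternHive_pattern_natCast hh i j hij]

theorem sum_pattern (hb : HasBorder n lam mu nu h) (hh : IsHive n h) {r m : ℕ} (hm : m ≤ r)
    (hr : r ≤ n) :
    ((∑ i ∈ Finset.range r, pattern n nu h i m : ℕ) : ℤ) = h ((r : ℤ) - m, (m : ℤ)) := by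
  have := hb.patternHive_pattern_natCast hh (r - m) m (by omega)
  rwa [show r - m + m = r by omega, Nat.cast_sub hm] at this

theorem isPattern (hb : HasBorder n lam mu nu h) (hh : IsHive n h) (hnu : Antitone nu)
    (hmu : Antitone mu) (hlam0 : ∀ i, n ≤ i → lam i = 0) (hmu0 : ∀ i, n ≤ i → mu i = 0)
    (hnu0 : ∀ i, n ≤ i → nu i = 0) : IsPattern n lam mu nu (pattern n nu h) := by
  have big : ∀ r m, n ≤ r → pattern n nu h r m = 0 := fun r m hr => by
    rw [pattern, if_neg (by omega), hnu0 r hr]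
  have top : ∀ r m, r < m → pattern n nu h r m = nu r := fun r m hr => if_neg (by omega)
  have content : ∀ m, ∑ i ∈ Finset.range n, pattern n nu h i (m + 1) =
      ∑ i ∈ Finset.range n, pattern n nu h i m + mu m := by
    intro m
    rcases lt_or_ge m n with hm | hm
    · have h1 := hb.sum_pattern hh hm.le le_rfl
      have h2 := hb.sum_pattern hh (show m + 1 ≤ n by omega) le_rfl
      have h3 := hb.diag (n - m) m (by omega)
      have h4 := hb.diag (n - (m + 1)) (m + 1) (by omega)
      rw [Nat.cast_sub hm.le, ← h1] at h3
      rw [Nat.cast_sub (show m + 1 ≤ n by omega), ← h2, Finset.sum_range_succ] at h4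
      have h3 := Nat.cast_injective h3
      have h4 := Nat.cast_injective h4
      omega
    · rw [hmu0 m hm, add_zero]
      refine Finset.sum_congr rfl fun i hi => ?_
      rw [Finset.mem_range] at hi
      rw [top i m (by omega), top i _ (by omega)]
  have ext : ∀ r m, n ≤ r → ∑ i ∈ Finset.range r, pattern n nu h i m =
      ∑ i ∈ Finset.range n, pattern n nu h i m := by
    intro r m hr
    symm
    refine Finset.sum_subset (Finset.range_mono hr) fun i _ hi => big i m ?_
    simpa using hi
  refine ⟨?_, top, ?_, ?_, ?_, content⟩
  · intro r
    rcases lt_or_ge r n with hr | hr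
    · rw [pattern, if_pos ⟨Nat.zero_le r, hr⟩, hb.rowStep_zero hr, Int.toNat_natCast]
    · rw [big r 0 hr, hlam0 r hr]
  · intro r m
    unfold pattern
    split_ifs with h1 h2 h2
    · exact Int.toNat_le_toNat (rowStep_le_succ hh (by omega) h1.2)
    · obtain rfl : m = r := by omega
      exact Int.toNat_le.2 (hb.rowStep_self_le hh h1.2)
    · omega
    · exact le_rfl
  · intro r m
    unfold pattern
    split_ifs with h1 h2 h2
    · exact Int.toNat_le_toNat (rowStep_strict hh (by omega) h1.2)
    · omega
    · rw [hnu0 (r + 1) (by omega)]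
      exact Nat.zero_le _
    · exact hnu (Nat.le_succ r)
  · intro r m
    rcases lt_or_ge r n with hr | hr
    · rcases le_or_gt r m with hrm | hrm
      · have e1 : ∑ i ∈ Finset.range (r + 1), pattern n nu h i (m + 2) =
            ∑ i ∈ Finset.range (r + 1), pattern n nu h i (m + 1) :=
          Finset.sum_congr rfl fun i hi => by
            rw [Finset.mem_range] at hi
            rw [top i _ (by omega), top i _ (by omega)]
        have e2 : ∑ i ∈ Finset.range r, pattern n nu h i m =
            ∑ i ∈ Finset.range r, pattern n nu h i (m + 1) :=
          Finset.sum_congr rfl fun i hi => by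
            rw [Finset.mem_range] at hi
            rw [top i _ (by omega), top i _ (by omega)]
        omega
      · have := (hh.inequalities (r - m - 1) m).1 (by omega)
        rw [show ((r - m - 1 : ℕ) : ℤ) = r - m - 1 by omega] at this
        have h1 := hb.sum_pattern hh (show m + 2 ≤ r + 1 by omega) (by omega)
        have h2 := hb.sum_pattern hh (show m ≤ r by omega) (by omega)
        have h3 := hb.sum_pattern hh (show m + 1 ≤ r by omega) (by omega)
        have h4 := hb.sum_pattern hh (show m + 1 ≤ r + 1 by omega) (by omega)
        simp only [Nat.cast_add, Nat.cast_one, Nat.cast_ofNat] at h1 h2 h3 h4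
        rw [show (r : ℤ) + 1 - (m + 2) = r - m - 1 by ring] at h1
        rw [show (r : ℤ) - (m + 1) = r - m - 1 by ring] at h3
        rw [show (r : ℤ) + 1 - (m + 1) = r - m by ring] at h4
        rw [show (r : ℤ) - m - 1 + 1 = r - m by ring, ← h1, ← h2, ← h3, ← h4] at this
        exact_mod_cast this
    · rw [ext r _ hr, ext r _ hr, ext (r + 1) _ (by omega), ext (r + 1) _ (by omega)]
      have h1 := content m
      have h2 := content (m + 1)
      have h3 := hmu (Nat.le_succ m)
      rw [show m + 1 + 1 = m + 2 from rfl] at h2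
      rw [Nat.succ_eq_add_one] at h3
      omega

end HasBorder

/-- If the scaled pattern is not unique, then neither is the original one. -/
theorem IsPattern.unique_smul {P : ℕ → ℕ → ℕ} (hnu : Antitone nu)
    (hmu : Antitone mu) (hlam0 : ∀ i, n ≤ i → lam i = 0) (hmu0 : ∀ i, n ≤ i → mu i = 0)
    (hnu0 : ∀ i, n ≤ i → nu i = 0) (hP : IsPattern n lam mu nu P)
    (huniq : ∀ P', IsPattern n lam mu nu P' → P' = P) {N : ℕ} {R : ℕ → ℕ → ℕ}
    (hR : IsPattern n (fun i => N * lam i) (fun i => N * mu i) (fun i => N * nu i) R) :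
    R = fun r m => N * P r m := by
  have hcomp : Comparable n N (patternHive P) (patternHive R) :=
    ⟨hP.isHive n, hR.isHive n, hP.hasBorder.smul_eq hR.hasBorder⟩
  refine eq_of_patternHive_eq (fun i hi => by rw [hnu0 i hi, mul_zero]) hR (hP.smul N) ?_
  intro x hx
  rw [patternHive_smul]
  by_contra hne
  obtain ⟨h', hh', hb', y, hy, hne'⟩ := hcomp.exists_ne hx hne
  have hB := hP.hasBorder.of_eq hb'
  have := huniq _ (hB.isPattern hh' hnu hmu hlam0 hmu0 hnu0)
  rw [← this, hB.patternHive_pattern hh' hy] at hne'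
  exact hne' rfl

end Hives

/-- **Fulton's conjecture.**  Partitions are weakly decreasing, eventually zero
sequences of naturals (`0`-indexed).  If `c^ν_{λ,μ} = 1` then
`c^{Nν}_{Nλ,Nμ} = 1` for every positive integer `N`. -/
theorem lrCoeff_scale_of_lrCoeff_eq_one
    (lam mu nu : ℕ → ℕ)
    (hlam : Antitone lam) (hmu : Antitone mu) (hnu : Antitone nu)
    (hlam0 : ∃ K, ∀ i, K ≤ i → lam i = 0)
    (hmu0 : ∃ K, ∀ i, K ≤ i → mu i = 0)
    (hnu0 : ∃ K, ∀ i, K ≤ i → nu i = 0)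
    (h : lrCoeff lam mu nu = 1) (N : ℕ) (hN : 0 < N) :
    lrCoeff (fun i => N * lam i) (fun i => N * mu i) (fun i => N * nu i) = 1 := by
  obtain ⟨K₁, h₁⟩ := hlam0
  obtain ⟨K₂, h₂⟩ := hmu0
  obtain ⟨K₃, h₃⟩ := hnu0
  have g₁ : ∀ i, K₁ + K₂ + K₃ ≤ i → lam i = 0 := fun i hi => h₁ i (by omega)
  have g₂ : ∀ i, K₁ + K₂ + K₃ ≤ i → mu i = 0 := fun i hi => h₂ i (by omega)
  have g₃ : ∀ i, K₁ + K₂ + K₃ ≤ i → nu i = 0 := fun i hi => h₃ i (by omega)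
  obtain ⟨P, hP, huniq⟩ := (lrCoeff_eq_one_iff hlam hnu g₃).1 h
  refine (lrCoeff_eq_one_iff (hlam.const_mul' N) (hnu.const_mul' N)
    (n := K₁ + K₂ + K₃) fun i hi => by rw [g₃ i hi, mul_zero]).2 ⟨_, hP.smul N, fun R hR => ?_⟩
  exact hP.unique_smul hnu hmu g₁ g₂ g₃ huniq hR
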